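/- There exist a sequence of natural numbers k_n → ∞ and a sequence of reals ε_n → 0, ε_n > 0, with the following property: for every sequence h_n ∈ Diff^∞(ℝ/ℤ) satisfying ‖h_n − id‖_{C^n} < ε_n for every n, there exists a finite subset S ⊆ Diff^∞(ℝ/ℤ) such that every h_n lies in the subgroup G generated by S and d_S(h_n, id) ≤ k_n for every n. -/

import Mathlib

open Filter Topology Set

noncomputable section

/-- The circle ℝ/ℤ. -/
abbrev S1 := AddCircle (1 : ℝ)

/-- `F : ℝ → ℝ` is a lift of the circle map `f`: it is C^∞, commutes with the unit
translation, has everywhere positive derivative, and descends to `f` on ℝ/ℤ. -/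
def IsLift (f : Equiv.Perm S1) (F : ℝ → ℝ) : Prop :=
  ContDiff ℝ (⊤ : ℕ∞) F ∧ (∀ x, F (x + 1) = F x + 1) ∧ (∀ x, 0 < deriv F x) ∧
    ∀ x : ℝ, f (x : S1) = ((F x : ℝ) : S1)

/-- `f` is an orientation preserving C^∞ diffeomorphism of ℝ/ℤ. -/
def HasLift (f : Equiv.Perm S1) : Prop := ∃ F, IsLift f F

/-- max over 0 ≤ j ≤ k of sup over x of |F^(j)(x) - G^(j)(x)|. -/
noncomputable def liftDist (k : ℕ) (F G : ℝ → ℝ) : ℝ :=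
  ⨆ j : Fin (k + 1), ⨆ x : ℝ, |iteratedDeriv (j : ℕ) F x - iteratedDeriv (j : ℕ) G x|

/-- The C^k distance between two smooth circle diffeomorphisms: infimum over lifts. -/
noncomputable def distC (k : ℕ) (f g : Equiv.Perm S1) : ℝ :=
  sInf {d | ∃ F G, IsLift f F ∧ IsLift g G ∧ d = liftDist k F G}

/-- `f` is recurrent: for every k and ε > 0 there are arbitrarily large n ≥ 1 with
‖f^n − id‖_{C^k} < ε. -/
def Recurrent (f : Equiv.Perm S1) : Prop :=
  ∀ k : ℕ, ∀ ε : ℝ, 0 < ε → ∀ N : ℕ, ∃ n : ℕ, N ≤ n ∧ 1 ≤ n ∧ distC k (f ^ n) 1 < ε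

/-- The word length of `g` with respect to the generating set `S`: the least `k` such that
`g` is a product of `k` elements of `S ∪ S⁻¹`. -/
noncomputable def wordLength (S : Set (Equiv.Perm S1)) (g : Equiv.Perm S1) : ℕ :=
  sInf {k | ∃ l : List (Equiv.Perm S1),
    l.length = k ∧ (∀ x ∈ l, x ∈ S ∨ x⁻¹ ∈ S) ∧ l.prod = g}

/-- The rotation by `t` on ℝ/ℤ, `x ↦ x + t`. -/
def rot (t : S1) : Equiv.Perm S1 := Equiv.addRight t

/-- `f` is a distortion element of Diff^∞(ℝ/ℤ). -/
def IsDistortion (f : Equiv.Perm S1) : Prop :=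
  ∃ S : Finset (Equiv.Perm S1), (∀ g ∈ S, HasLift g) ∧
    f ∈ Subgroup.closure (S : Set (Equiv.Perm S1)) ∧
    Tendsto (fun n : ℕ => (wordLength (S : Set (Equiv.Perm S1)) (f ^ n) : ℝ) / n)
      atTop (nhds 0)

/-- The open arc in ℝ/ℤ which is the image of the interval `(a,b)`. -/
def arcOO (a b : ℝ) : Set S1 := (fun x : ℝ => (x : S1)) '' Set.Ioo a b

/-- The closed arc in ℝ/ℤ which is the image of the interval `[a,b]`. -/
def arcCC (a b : ℝ) : Set S1 := (fun x : ℝ => (x : S1)) '' Set.Icc a b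

/-- `f` is supported on `U`: it is the identity outside `U`. -/
def SupportedOn (f : Equiv.Perm S1) (U : Set S1) : Prop := ∀ x : S1, x ∉ U → f x = x

/-- `f` has rotation number `t ∈ ℝ/ℤ`. -/
def HasRotNum (f : Equiv.Perm S1) (t : S1) : Prop :=
  ∃ F : ℝ → ℝ, ∃ τ : ℝ, IsLift f F ∧ ((τ : ℝ) : S1) = t ∧
    Tendsto (fun n : ℕ => F^[n] 0 / n) atTop (nhds τ)

/-- A real number is Diophantine. -/
def DiophantineReal (t : ℝ) : Prop :=
  ∃ C : ℝ, 0 < C ∧ ∃ n : ℕ, 0 < n ∧ ∀ p q : ℤ, q ≠ 0 →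
    C / |(q : ℝ)| ^ n < |(q : ℝ) * t - (p : ℝ)|

/-- An element of ℝ/ℤ is Diophantine if some (equivalently, every) lift is. -/
def Diophantine (t : S1) : Prop := ∃ τ : ℝ, (τ : S1) = t ∧ DiophantineReal τ


noncomputable section

abbrev Sm (f : ℝ → ℝ) : Prop := ContDiff ℝ (⊤ : ℕ∞) f

theorem Sm.diff {f : ℝ → ℝ} (h : Sm f) : Differentiable ℝ f :=
  h.differentiable (by simp)

theorem Sm.der {f : ℝ → ℝ} (h : Sm f) : Sm (deriv f) := by
  have : ContDiff ℝ ((⊤ : ℕ∞) + 1) f := h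
  exact ((contDiff_succ_iff_deriv).1 this).2.2

theorem Sm.iter {f : ℝ → ℝ} (h : Sm f) (n : ℕ) : Sm (iteratedDeriv n f) := by
  induction n with
  | zero => simpa using h
  | succ n ih => rw [iteratedDeriv_succ]; exact ih.der

theorem Sm.bdd_of_per {f : ℝ → ℝ} (hf : Continuous f) (hp : Function.Periodic f 1) :
    ∃ C, ∀ x, |f x| ≤ C := by
  obtain ⟨C, hC⟩ := (isCompact_Icc (a := (0:ℝ)) (b := 1)).exists_bound_of_continuousOn
    hf.continuousOn
  refine ⟨C, fun x => ?_⟩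
  have := hC (Int.fract x) ⟨Int.fract_nonneg x, (Int.fract_lt_one x).le⟩
  rw [Real.norm_eq_abs] at this
  have h2 : f (Int.fract x) = f x := by
    have := hp.sub_int_mul_eq (x := x) ⌊x⌋
    rw [Int.fract]; simpa using this
  rwa [h2] at this

variable {ι : Type*}

def BO (r : ℕ) (u : ι → ℝ → ℝ) (w : ι → ℝ) : Prop :=
  (∀ i, 0 ≤ w i) ∧ (∀ i, Sm (u i)) ∧
    ∃ C, 0 ≤ C ∧ ∀ i, ∀ j ≤ r, ∀ x, |iteratedDeriv j (u i) x| ≤ C * w i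

theorem BO.le {r s : ℕ} {u : ι → ℝ → ℝ} {w : ι → ℝ} (h : BO r u w) (hs : s ≤ r) : BO s u w := by
  obtain ⟨h0, h1, C, hC, h2⟩ := h
  exact ⟨h0, h1, C, hC, fun i j hj => h2 i j (hj.trans hs)⟩

theorem BO.wt {r : ℕ} {u : ι → ℝ → ℝ} {w w' : ι → ℝ} (h : BO r u w) (K : ℝ)
    (hw : ∀ i, w i ≤ K * w' i) (hw' : ∀ i, 0 ≤ w' i) : BO r u w' := by
  obtain ⟨h0, h1, C, hC, h2⟩ := h
  refine ⟨hw', h1, C * |K|, by positivity, fun i j hj x => (h2 i j hj x).trans ?_⟩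
  have := mul_le_mul_of_nonneg_right (le_abs_self K) (hw' i)
  have := mul_le_mul_of_nonneg_left ((hw i).trans this) hC
  linarith

theorem BO.one {r : ℕ} {u : ι → ℝ → ℝ} {w : ι → ℝ} (h : BO r u w) (hw : ∀ i, w i ≤ 1) :
    BO r u (fun _ => 1) :=
  h.wt 1 (by simpa using hw) (by simp)

theorem BO.reindex {κ : Type*} {r : ℕ} {u : ι → ℝ → ℝ} {w : ι → ℝ} (h : BO r u w) (e : κ → ι) :
    BO r (fun k => u (e k)) (fun k => w (e k)) := by
  obtain ⟨h0, h1, C, hC, h2⟩ := h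
  exact ⟨fun k => h0 _, fun k => h1 _, C, hC, fun i j hj x => h2 _ j hj x⟩

theorem BO.bd0 {r : ℕ} {u : ι → ℝ → ℝ} {w : ι → ℝ} (h : BO r u w) :
    ∃ C, 0 ≤ C ∧ ∀ i x, |u i x| ≤ C * w i := by
  obtain ⟨h0, h1, C, hC, h2⟩ := h
  exact ⟨C, hC, fun i x => by simpa using h2 i 0 (Nat.zero_le _) x⟩

theorem BO.mk0 {u : ι → ℝ → ℝ} {w : ι → ℝ} (hw : ∀ i, 0 ≤ w i) (hu : ∀ i, Sm (u i)) {C : ℝ}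
    (h : ∀ i x, |u i x| ≤ C * w i) : BO 0 u w := by
  refine ⟨hw, hu, |C|, abs_nonneg _, fun i j hj x => ?_⟩
  obtain rfl : j = 0 := by omega
  have := mul_le_mul_of_nonneg_right (le_abs_self C) (hw i)
  simpa using (h i x).trans this

theorem BO.der {r : ℕ} {u : ι → ℝ → ℝ} {w : ι → ℝ} (h : BO (r + 1) u w) :
    BO r (fun i => deriv (u i)) w := by
  obtain ⟨h0, h1, C, hC, h2⟩ := h
  refine ⟨h0, fun i => (h1 i).der, C, hC, fun i j hj x => ?_⟩
  rw [← iteratedDeriv_succ']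
  exact h2 i (j + 1) (by omega) x

theorem BO.succ {r : ℕ} {u : ι → ℝ → ℝ} {w : ι → ℝ} (h : BO 0 u w)
    (h' : BO r (fun i => deriv (u i)) w) : BO (r + 1) u w := by
  obtain ⟨h0, h1, C, hC, h2⟩ := h
  obtain ⟨_, _, C', hC', h2'⟩ := h'
  refine ⟨h0, h1, C + C', by positivity, fun i j hj x => ?_⟩
  have hw := h0 i
  have p1 := mul_nonneg hC hw
  have p2 := mul_nonneg hC' hw
  rcases j with _ | j
  · have := h2 i 0 le_rfl x
    linarith
  · rw [iteratedDeriv_succ']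
    have := h2' i j (by omega) x
    linarith

theorem BO.top {s : ℕ} {u : ι → ℝ → ℝ} {w : ι → ℝ} (h : BO s u w) {C : ℝ}
    (hC : ∀ i x, |iteratedDeriv (s + 1) (u i) x| ≤ C * w i) : BO (s + 1) u w := by
  obtain ⟨h0, h1, C', hC', h2⟩ := h
  refine ⟨h0, h1, |C| + C', by positivity, fun i j hj x => ?_⟩
  have hw := h0 i
  have p1 := mul_nonneg (abs_nonneg C) hw
  have p2 := mul_nonneg hC' hw
  rcases Nat.lt_or_ge j (s + 1) with h | h
  · have := h2 i j (by omega) x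
    linarith
  · obtain rfl : j = s + 1 := by omega
    have := hC i x
    have := mul_le_mul_of_nonneg_right (le_abs_self C) hw
    linarith

theorem BO.add {r : ℕ} {u v : ι → ℝ → ℝ} {w : ι → ℝ} (h : BO r u w) (h' : BO r v w) :
    BO r (fun i x => u i x + v i x) w := by
  obtain ⟨h0, h1, C, hC, h2⟩ := h
  obtain ⟨_, h1', C', hC', h2'⟩ := h'
  refine ⟨h0, fun i => (h1 i).add (h1' i), C + C', by positivity, fun i j hj x => ?_⟩
  have : iteratedDeriv j (fun x => u i x + v i x) x
      = iteratedDeriv j (u i) x + iteratedDeriv j (v i) x :=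
    iteratedDeriv_fun_add ((h1 i).of_le (by exact_mod_cast le_top)).contDiffAt
      ((h1' i).of_le (by exact_mod_cast le_top)).contDiffAt
  rw [this, add_mul]
  exact (abs_add_le _ _).trans (add_le_add (h2 i j hj x) (h2' i j hj x))

theorem BO.neg {r : ℕ} {u : ι → ℝ → ℝ} {w : ι → ℝ} (h : BO r u w) :
    BO r (fun i x => -u i x) w := by
  obtain ⟨h0, h1, C, hC, h2⟩ := h
  refine ⟨h0, fun i => (h1 i).neg, C, hC, fun i j hj x => ?_⟩
  have : iteratedDeriv j (fun x => -u i x) x = -iteratedDeriv j (u i) x := iteratedDeriv_fun_neg _ _ _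
  rw [this, abs_neg]
  exact h2 i j hj x

theorem BO.sub {r : ℕ} {u v : ι → ℝ → ℝ} {w : ι → ℝ} (h : BO r u w) (h' : BO r v w) :
    BO r (fun i x => u i x - v i x) w := by
  simpa [sub_eq_add_neg] using h.add h'.neg

theorem deriv_mul_fun {f g : ℝ → ℝ} (hf : Sm f) (hg : Sm g) :
    deriv (fun x => f x * g x) = fun x => deriv f x * g x + f x * deriv g x := by
  funext x
  exact deriv_fun_mul (hf.diff x) (hg.diff x)

theorem BO.mul {r : ℕ} {u v : ι → ℝ → ℝ} {w w' : ι → ℝ} (h : BO r u w) (h' : BO r v w') :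
    BO r (fun i x => u i x * v i x) (fun i => w i * w' i) := by
  induction r generalizing u v with
  | zero =>
    obtain ⟨C, hC, h2⟩ := h.bd0
    obtain ⟨C', hC', h2'⟩ := h'.bd0
    refine BO.mk0 (fun i => mul_nonneg (h.1 i) (h'.1 i)) (fun i => (h.2.1 i).mul (h'.2.1 i))
      (C := C * C') (fun i x => ?_)
    rw [abs_mul]
    calc _ ≤ (C * w i) * (C' * w' i) :=
          mul_le_mul (h2 i x) (h2' i x) (abs_nonneg _) (mul_nonneg hC (h.1 i))
      _ = _ := by ring
  | succ r ih =>
    refine BO.succ ((ih (h.le (by omega)) (h'.le (by omega))).le (by omega)) ?_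
    have : (fun i => deriv (fun x => u i x * v i x))
        = fun i x => deriv (u i) x * v i x + u i x * deriv (v i) x := by
      funext i
      exact deriv_mul_fun (h.2.1 i) (h'.2.1 i)
    rw [this]
    exact (ih h.der (h'.le (by omega))).add (ih (h.le (by omega)) h'.der)

theorem BO.mul1 {r : ℕ} {u v : ι → ℝ → ℝ} {w : ι → ℝ} (h : BO r u w)
    (h' : BO r v (fun _ => 1)) : BO r (fun i x => u i x * v i x) w := by
  simpa using h.mul h'

theorem BO.one_mul {r : ℕ} {u v : ι → ℝ → ℝ} {w : ι → ℝ} (h : BO r u (fun _ => 1))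
    (h' : BO r v w) : BO r (fun i x => u i x * v i x) w := by
  simpa using h.mul h'

/-- composition -/
theorem BO.comp {r : ℕ} {u G : ι → ℝ → ℝ} {w : ι → ℝ} (h : BO r u w) (hG : ∀ i, Sm (G i))
    (h' : BO (r - 1) (fun i => deriv (G i)) (fun _ => 1)) :
    BO r (fun i x => u i (G i x)) w := by
  induction r generalizing u with
  | zero =>
    obtain ⟨C, hC, h2⟩ := h.bd0
    exact BO.mk0 h.1 (fun i => (h.2.1 i).comp (hG i)) (fun i x => h2 i _)
  | succ r ih =>
    have hr := h'.le (s := r) (by omega)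
    refine BO.succ ((ih (h.le (by omega)) (h'.le (by omega))).le (by omega)) ?_
    have : (fun i => deriv (fun x => u i (G i x)))
        = fun i x => deriv (u i) (G i x) * deriv (G i) x := by
      funext i x
      exact deriv_comp (h₂ := u i) (h := G i) x ((h.2.1 i).diff _) ((hG i).diff _)
    rw [this]
    exact (ih h.der (h'.le (by omega))).mul1 hr

theorem BO.exp {r : ℕ} {u : ι → ℝ → ℝ} (h : BO r u (fun _ => 1)) :
    BO r (fun i x => Real.exp (u i x)) (fun _ => 1) := by
  induction r with
  | zero =>
    obtain ⟨C, hC, h2⟩ := h.bd0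
    refine BO.mk0 (by simp) (fun i => (h.2.1 i).exp) (C := Real.exp C) (fun i x => ?_)
    rw [abs_of_pos (Real.exp_pos _), mul_one]
    exact Real.exp_le_exp.2 ((le_abs_self _).trans (by simpa using h2 i x))
  | succ r ih =>
    have ih := ih (h.le (by omega))
    refine BO.succ (ih.le (by omega)) ?_
    have : (fun i => deriv (fun x => Real.exp (u i x)))
        = fun i x => Real.exp (u i x) * deriv (u i) x := by
      funext i x
      exact deriv_exp ((h.2.1 i).diff x)
    rw [this]
    exact ih.mul1 h.der

theorem abs_exp_sub_one_le' {t C : ℝ} (h : |t| ≤ C) : |Real.exp t - 1| ≤ Real.exp C * |t| := by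
  have h1 := Real.add_one_le_exp t
  have h2 := Real.add_one_le_exp (-t)
  have hC : 1 ≤ Real.exp C := Real.one_le_exp ((abs_nonneg t).trans h)
  have e : Real.exp t * Real.exp (-t) = 1 := by rw [← Real.exp_add]; simp
  have hp := Real.exp_pos t
  have ht : Real.exp t ≤ Real.exp C := Real.exp_le_exp.2 ((le_abs_self t).trans h)
  rcases le_or_gt 0 t with h0 | h0
  · rw [abs_of_nonneg h0, abs_of_nonneg (by linarith)]
    nlinarith
  · rw [abs_of_neg h0, abs_of_nonpos (by have := Real.exp_le_one_iff.2 h0.le; linarith)]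
    nlinarith

theorem BO.expm1 {r : ℕ} {u : ι → ℝ → ℝ} {w : ι → ℝ} (h : BO r u w) (hw : ∀ i, w i ≤ 1) :
    BO r (fun i x => Real.exp (u i x) - 1) w := by
  have hs : ∀ i, Sm (fun x => Real.exp (u i x) - 1) := fun i => (h.2.1 i).exp.sub contDiff_const
  have h0 : BO 0 (fun i x => Real.exp (u i x) - 1) w := by
    obtain ⟨C, hC, h2⟩ := h.bd0
    refine BO.mk0 h.1 hs (C := Real.exp C * C) (fun i x => ?_)
    have h3 : |u i x| ≤ C := (h2 i x).trans (by nlinarith [hw i])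
    calc _ ≤ _ := abs_exp_sub_one_le' h3
      _ ≤ Real.exp C * (C * w i) := by gcongr; exact h2 i x
      _ = _ := by ring
  rcases r with _ | r
  · exact h0
  · refine BO.succ h0 ?_
    have : (fun i => deriv (fun x => Real.exp (u i x) - 1))
        = fun i x => deriv (u i) x * Real.exp (u i x) := by
      funext i x
      rw [deriv_sub_const, deriv_exp ((h.2.1 i).diff x), mul_comm]
    rw [this]
    exact h.der.mul1 ((h.one hw).exp.le (by omega))

/-- a single smooth function with bounded derivatives -/
theorem BO.const {u : ℝ → ℝ} (hu : Sm u) (h : ∀ j, ∃ C, ∀ x, |iteratedDeriv j u x| ≤ C) (r : ℕ) :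
    BO r (fun _ : ι => u) (fun _ => 1) := by
  choose C hC using h
  refine ⟨by simp, fun _ => hu, ∑ j ∈ Finset.range (r + 1), |C j|, by positivity,
    fun i j hj x => ?_⟩
  rw [mul_one]
  exact (hC j x).trans ((le_abs_self _).trans
    (Finset.single_le_sum (f := fun j => |C j|) (fun _ _ => abs_nonneg _)
      (Finset.mem_range.2 (by omega))))

/-- leading term of a product -/
theorem BO.mul_lead {s : ℕ} {u v : ι → ℝ → ℝ} {w : ι → ℝ} (h : BO s u w)
    (h' : BO (s + 1) v (fun _ => 1)) :
    ∃ C, 0 ≤ C ∧ ∀ i x, |iteratedDeriv (s + 1) (fun x => u i x * v i x) x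
      - iteratedDeriv (s + 1) (u i) x * v i x| ≤ C * w i := by
  induction s generalizing u with
  | zero =>
    obtain ⟨C, hC, h2⟩ := (h.mul1 h'.der).bd0
    refine ⟨C, hC, fun i x => ?_⟩
    simp only [zero_add, iteratedDeriv_one]
    rw [deriv_mul_fun (h.2.1 i) (h'.2.1 i)]
    simpa using h2 i x
  | succ s ih =>
    obtain ⟨C, hC, h1⟩ := ih (u := fun i => deriv (u i)) h.der (h'.le (by omega))
    obtain ⟨h0, _, C', hC', h2⟩ := h.mul1 (h'.der.le (s := s + 1) (by omega))
    refine ⟨C + C', by positivity, fun i x => ?_⟩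
    rw [iteratedDeriv_succ', iteratedDeriv_succ' (f := u i), deriv_mul_fun (h.2.1 i) (h'.2.1 i)]
    have e : iteratedDeriv (s + 1) (fun x => deriv (u i) x * v i x + u i x * deriv (v i) x) x
      = iteratedDeriv (s + 1) (fun x => deriv (u i) x * v i x) x
        + iteratedDeriv (s + 1) (fun x => u i x * deriv (v i) x) x :=
      iteratedDeriv_fun_add
        (((h.2.1 i).der.mul (h'.2.1 i)).of_le (by exact_mod_cast le_top)).contDiffAt
        (((h.2.1 i).mul (h'.2.1 i).der).of_le (by exact_mod_cast le_top)).contDiffAt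
    rw [e, add_mul]
    have a1 := h1 i x
    have a2 := h2 i (s + 1) le_rfl x
    have := abs_add_le (iteratedDeriv (s + 1) (fun x => deriv (u i) x * v i x) x
      - iteratedDeriv (s + 1) (deriv (u i)) x * v i x)
      (iteratedDeriv (s + 1) (fun x => u i x * deriv (v i) x) x)
    rw [show iteratedDeriv (s + 1) (fun x => deriv (u i) x * v i x) x
      - iteratedDeriv (s + 1) (deriv (u i)) x * v i x +
      iteratedDeriv (s + 1) (fun x => u i x * deriv (v i) x) x =
      iteratedDeriv (s + 1) (fun x => deriv (u i) x * v i x) x +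
      iteratedDeriv (s + 1) (fun x => u i x * deriv (v i) x) x
      - iteratedDeriv (s + 1) (deriv (u i)) x * v i x by ring] at this
    linarith

/-- leading term of a composition -/
theorem BO.comp_lead {s : ℕ} {u G : ι → ℝ → ℝ} {w : ι → ℝ} (h : BO s u w) (hG : ∀ i, Sm (G i))
    (h' : BO s (fun i => deriv (G i)) (fun _ => 1)) :
    ∃ C, 0 ≤ C ∧ ∀ i x, |iteratedDeriv (s + 1) (fun x => u i (G i x)) x
      - iteratedDeriv (s + 1) (u i) (G i x) * deriv (G i) x ^ (s + 1)| ≤ C * w i := by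
  have hd : ∀ i, deriv (fun x => u i (G i x)) = fun x => deriv (u i) (G i x) * deriv (G i) x := by
    intro i
    funext x
    exact deriv_comp (h₂ := u i) (h := G i) x ((h.2.1 i).diff _) ((hG i).diff _)
  induction s generalizing u with
  | zero =>
    refine ⟨0, le_rfl, fun i x => ?_⟩
    simp only [zero_add, iteratedDeriv_one]
    rw [hd i]
    simp
  | succ s ih =>
    obtain ⟨C, hC, h1⟩ := ih (u := fun i => deriv (u i)) h.der (h'.le (by omega)) (by
      intro i
      funext x
      exact deriv_comp (h₂ := deriv (u i)) (h := G i) x ((h.2.1 i).der.diff _) ((hG i).diff _))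
    have hp : BO s (fun i x => deriv (u i) (G i x)) w := h.der.comp hG (h'.le (by omega))
    obtain ⟨C', hC', h2⟩ := hp.mul_lead h'
    obtain ⟨K, hK, h3⟩ := h'.bd0
    refine ⟨C * K + C', by positivity, fun i x => ?_⟩
    rw [iteratedDeriv_succ', iteratedDeriv_succ' (f := u i), hd i]
    have a1 := h1 i x
    have a2 := h2 i x
    have a3 := h3 i x
    rw [mul_one] at a3
    have key : |(iteratedDeriv (s + 1) (fun x => deriv (u i) (G i x)) x
      - iteratedDeriv (s + 1) (deriv (u i)) (G i x) * deriv (G i) x ^ (s + 1)) * deriv (G i) x|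
      ≤ (C * w i) * K := by
      rw [abs_mul]
      exact mul_le_mul a1 a3 (abs_nonneg _) (mul_nonneg hC (h.1 i))
    have := abs_add_le _ _ |>.trans (add_le_add a2 key)
    refine le_trans (le_of_eq ?_) (this.trans (le_of_eq ?_))
    · congr 1; ring
    · ring

end

noncomputable section
variable {ι : Type*}

def Dif : Subgroup (Equiv.Perm ℝ) where
  carrier := {p | Sm p ∧ Sm p.symm ∧ StrictMono p}
  one_mem' := ⟨contDiff_id, contDiff_id, strictMono_id⟩
  mul_mem' := fun {p q} hp hq => ⟨hp.1.comp hq.1, hq.2.1.comp hp.2.1, hp.2.2.comp hq.2.2⟩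
  inv_mem' := fun {p} hp => ⟨hp.2.1, hp.1, fun x y h => by
    by_contra hc
    have := hp.2.2.monotone (not_lt.1 hc)
    simp only [Equiv.Perm.inv_def, Equiv.apply_symm_apply] at this
    linarith⟩

theorem pinv1 (p : Equiv.Perm ℝ) (x : ℝ) : p⁻¹ (p x) = x := p.symm_apply_apply x
theorem pinv2 (p : Equiv.Perm ℝ) (x : ℝ) : p (p⁻¹ x) = x := p.apply_symm_apply x

theorem Dif.sm {p : Equiv.Perm ℝ} (h : p ∈ Dif) : Sm p := h.1
theorem Dif.mono {p : Equiv.Perm ℝ} (h : p ∈ Dif) : StrictMono p := h.2.2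

theorem Dif.deriv_inv {p : Equiv.Perm ℝ} (h : p ∈ Dif) (x : ℝ) :
    deriv (⇑p⁻¹) (p x) * deriv p x = 1 := by
  have h1 := deriv_comp (h₂ := ⇑p⁻¹) (h := p) x ((Dif.sm (inv_mem h)).diff _) ((Dif.sm h).diff _)
  have h2 : (⇑p⁻¹ ∘ ⇑p) = fun x => x := by funext y; simp
  rw [h2] at h1
  simpa using h1.symm

theorem Dif.pos {p : Equiv.Perm ℝ} (h : p ∈ Dif) (x : ℝ) : 0 < deriv p x := by
  have h1 := Dif.deriv_inv h x
  have h2 : 0 ≤ deriv p x := (Dif.mono h).monotone.deriv_nonneg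
  rcases h2.eq_or_lt with h | h
  · rw [← h] at h1; simp at h1
  · exact h

def lg (p : Equiv.Perm ℝ) (x : ℝ) : ℝ := Real.log (deriv p x)

theorem exp_lg {p : Equiv.Perm ℝ} (h : p ∈ Dif) (x : ℝ) : Real.exp (lg p x) = deriv p x :=
  Real.exp_log (Dif.pos h x)

theorem deriv_eq_exp_lg {p : Equiv.Perm ℝ} (h : p ∈ Dif) :
    deriv p = fun x => Real.exp (lg p x) := funext fun x => (exp_lg h x).symm

theorem Sm_lg {p : Equiv.Perm ℝ} (h : p ∈ Dif) : Sm (lg p) :=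
  (Dif.sm h).der.log fun x => (Dif.pos h x).ne'

theorem deriv_mul_perm {p q : Equiv.Perm ℝ} (hp : p ∈ Dif) (hq : q ∈ Dif) (x : ℝ) :
    deriv (⇑(p * q)) x = deriv p (q x) * deriv q x :=
  deriv_comp (h₂ := ⇑p) (h := q) x ((Dif.sm hp).diff _) ((Dif.sm hq).diff _)

theorem lg_mul {p q : Equiv.Perm ℝ} (hp : p ∈ Dif) (hq : q ∈ Dif) (x : ℝ) :
    lg (p * q) x = lg p (q x) + lg q x := by
  rw [lg, deriv_mul_perm hp hq, Real.log_mul (Dif.pos hp _).ne' (Dif.pos hq _).ne']; rfl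

theorem lg_one : lg 1 = fun _ => 0 := by
  funext x
  have : (⇑(1 : Equiv.Perm ℝ)) = fun x => x := rfl
  simp [lg, this]

theorem lg_inv {p : Equiv.Perm ℝ} (hp : p ∈ Dif) (x : ℝ) :
    lg p⁻¹ x = -lg p (p⁻¹ x) := by
  have := lg_mul hp (inv_mem hp) x
  rw [mul_inv_cancel, lg_one] at this
  linarith

/-- integral characterisation: functions with the same derivative and one value -/
theorem eq_of_deriv {f g : ℝ → ℝ} (hf : Sm f) (hg : Sm g) (h : ∀ x, deriv f x = deriv g x)
    (x0 : ℝ) (h0 : f x0 = g x0) : f = g := by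
  funext x
  have := is_const_of_deriv_eq_zero (f := fun x => f x - g x) (hf.diff.sub hg.diff)
    (fun y => by rw [deriv_fun_sub (hf.diff y) (hg.diff y), h y, sub_self]) x x0
  have this : f x - g x = f x0 - g x0 := this
  linarith

theorem perm_eq_of_lg {p q : Equiv.Perm ℝ} (hp : p ∈ Dif) (hq : q ∈ Dif)
    (h : ∀ x, lg p x = lg q x) (x0 : ℝ) (h0 : p x0 = q x0) : p = q := by
  apply Equiv.ext
  intro x
  exact congrFun (eq_of_deriv (Dif.sm hp) (Dif.sm hq)
    (fun x => by rw [← exp_lg hp, ← exp_lg hq, h]) x0 h0) x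

/-- total conversion of a map to a permutation -/
def toPerm (F : ℝ → ℝ) : Equiv.Perm ℝ :=
  open Classical in if h : Function.Bijective F then Equiv.ofBijective F h else 1

theorem mkDif {F : ℝ → ℝ} (hF : Sm F) (hpos : ∀ x, 0 < deriv F x) (hs : Function.Surjective F) :
    (⇑(toPerm F) = F) ∧ toPerm F ∈ Dif := by
  have hm : StrictMono F := strictMono_of_deriv_pos hpos
  have hb : Function.Bijective F := ⟨hm.injective, hs⟩
  have e : toPerm F = Equiv.ofBijective F hb := by rw [toPerm, dif_pos hb]
  have e1 : ⇑(toPerm F) = F := by rw [e]; rfl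
  refine ⟨e1, by rw [e1]; exact hF, ?_, by rw [e1]; exact hm⟩
  let o : ℝ ≃o ℝ := hm.orderIsoOfSurjective F hs
  let P : OpenPartialHomeomorph ℝ ℝ := o.toHomeomorph.toOpenPartialHomeomorph
  have e2 : ⇑(toPerm F).symm = P.symm := by
    funext x
    rw [Equiv.symm_apply_eq, e1]
    exact (o.apply_symm_apply x).symm
  rw [e2]
  refine contDiff_iff_contDiffAt.2 fun x => ?_
  refine P.contDiffAt_symm_deriv (f₀' := deriv F (P.symm x)) (hpos _).ne' (by simp [P]) ?_ ?_
  · exact (hF.diff _).hasDerivAt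
  · exact hF.contDiffAt

theorem surj_of_bdd {F : ℝ → ℝ} (hF : Continuous F) {C : ℝ} (h : ∀ x, |F x - x| ≤ C) :
    Function.Surjective F := by
  refine hF.surjective ?_ ?_
  · refine tendsto_atTop_mono (f := fun x => x - C) (fun x => ?_)
      (tendsto_atTop_add_const_right _ _ tendsto_id)
    have := abs_le.1 (h x); linarith
  · refine tendsto_atBot_mono (f := fun x => x + C) (fun x => ?_)
      (tendsto_atBot_add_const_right _ _ tendsto_id)
    have := abs_le.1 (h x); linarith

/-! families -/

theorem BO.congr {r : ℕ} {u v : ι → ℝ → ℝ} {w : ι → ℝ} (h : BO r u w) (e : ∀ i x, v i x = u i x) :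
    BO r v w := by
  have : v = u := by funext i x; exact e i x
  rwa [this]

theorem BO.zero {r : ℕ} {w : ι → ℝ} (hw : ∀ i, 0 ≤ w i) : BO r (fun _ _ => 0) w :=
  ⟨hw, fun _ => contDiff_const, 0, le_rfl, fun i j _ x => by
    rw [iteratedDeriv_const]; split_ifs <;> simp⟩

section fam
variable {p q p' q' : ι → Equiv.Perm ℝ} {w d : ι → ℝ} {s : ℕ}

theorem BO.dexp (h : BO s (fun i => lg (p i)) w) (hp : ∀ i, p i ∈ Dif) (hw : ∀ i, w i ≤ 1) :
    BO s (fun i => deriv (p i)) (fun _ => 1) :=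
  (h.one hw).exp.congr fun i x => (exp_lg (hp i) x).symm

theorem BO.dexpm1 (h : BO s (fun i => lg (p i)) w) (hp : ∀ i, p i ∈ Dif) (hw : ∀ i, w i ≤ 1) :
    BO s (fun i x => deriv (p i) x - 1) w :=
  (h.expm1 hw).congr fun i x => by rw [exp_lg (hp i) x]

theorem BO.lgcomp {u : ι → ℝ → ℝ} {v : ι → ℝ} (hu : BO s u v)
    (h : BO (s - 1) (fun i => lg (p i)) w) (hp : ∀ i, p i ∈ Dif)
    (hw : ∀ i, w i ≤ 1) : BO s (fun i x => u i (p i x)) v :=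
  hu.comp (fun i => Dif.sm (hp i)) (h.dexp hp hw)

theorem BO.lgmul (h : BO s (fun i => lg (p i)) w) (h' : BO s (fun i => lg (q i)) w)
    (hp : ∀ i, p i ∈ Dif) (hq : ∀ i, q i ∈ Dif) (hw : ∀ i, w i ≤ 1) :
    BO s (fun i => lg (p i * q i)) w :=
  ((h.lgcomp (h'.le (by omega)) hq hw).add h').congr fun i x => lg_mul (hp i) (hq i) x

theorem BO.lginv (h : BO s (fun i => lg (p i)) w) (hp : ∀ i, p i ∈ Dif) (hw : ∀ i, w i ≤ 1) :
    BO s (fun i => lg (p i)⁻¹) w := by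
  induction s with
  | zero =>
    obtain ⟨C, hC, h2⟩ := h.bd0
    refine BO.mk0 h.1 (fun i => Sm_lg (inv_mem (hp i))) (C := C) fun i x => ?_
    rw [lg_inv (hp i), abs_neg]
    exact h2 i _
  | succ s ih =>
    exact ((h.lgcomp (ih (h.le (by omega))) (fun i => inv_mem (hp i)) hw).neg).congr
      fun i x => lg_inv (hp i) x

theorem mvt_bd {f : ℝ → ℝ} (hf : Sm f) {C : ℝ} (h : ∀ x, |deriv f x| ≤ C) (x y : ℝ) :
    |f x - f y| ≤ C * |x - y| := by
  have := Convex.norm_image_sub_le_of_norm_deriv_le (f := f) (C := C) (s := univ) (x := y) (y := x)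
    (fun x _ => hf.diff x) (fun x _ => h x) convex_univ (mem_univ _) (mem_univ _)
  simpa using this

theorem BO.subcomp {u G H : ι → ℝ → ℝ} (hu : BO (s + 1) u w) (hG : ∀ i, Sm (G i))
    (hH : ∀ i, Sm (H i)) (hG' : BO (s - 1) (fun i => deriv (G i)) (fun _ => 1))
    (hH' : BO (s - 1) (fun i => deriv (H i)) (fun _ => 1))
    (hd : BO (s - 1) (fun i x => deriv (H i) x - deriv (G i) x) d)
    {C : ℝ} (hC : ∀ i x, |H i x - G i x| ≤ C * d i) :
    BO s (fun i x => u i (H i x) - u i (G i x)) (fun i => w i * d i) := by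
  have base : BO 0 (fun i x => u i (H i x) - u i (G i x)) (fun i => w i * d i) := by
    obtain ⟨K, hK, h2⟩ := (hu.le (s := 0 + 1) (by omega)).der.bd0
    refine BO.mk0 (fun i => mul_nonneg (hu.1 i) (hd.1 i))
      (fun i => ((hu.2.1 i).comp (hH i)).sub ((hu.2.1 i).comp (hG i))) (C := K * C)
      fun i x => ?_
    calc _ ≤ (K * w i) * |H i x - G i x| := mvt_bd (hu.2.1 i) (h2 i) _ _
      _ ≤ (K * w i) * (C * d i) := by
          have := mul_nonneg hK (hu.1 i)
          gcongr; exact hC i x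
      _ = _ := by ring
  induction s generalizing u with
  | zero => exact base
  | succ s ih =>
    refine BO.succ base ?_
    have : (fun i => deriv (fun x => u i (H i x) - u i (G i x))) = fun i x =>
        (deriv (u i) (H i x) - deriv (u i) (G i x)) * deriv (H i) x +
        deriv (u i) (G i x) * (deriv (H i) x - deriv (G i) x) := by
      funext i x
      have e1 : deriv (fun x => u i (H i x)) x = _ :=
        deriv_comp (h₂ := u i) (h := H i) x ((hu.2.1 i).diff _) ((hH i).diff _)
      have e2 : deriv (fun x => u i (G i x)) x = _ :=
        deriv_comp (h₂ := u i) (h := G i) x ((hu.2.1 i).diff _) ((hG i).diff _)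
      have e3 : deriv (fun x => u i (H i x) - u i (G i x)) x = _ :=
        deriv_fun_sub (Sm.diff ((hu.2.1 i).comp (hH i)) x) (Sm.diff ((hu.2.1 i).comp (hG i)) x)
      exact e3.trans (by rw [e1, e2]; ring)
    rw [this]
    have a1 : BO s (fun i x => deriv (u i) (H i x) - deriv (u i) (G i x)) (fun i => w i * d i) := by
      refine ih hu.der (hG'.le (by omega)) (hH'.le (by omega)) (hd.le (by omega)) ?_
      obtain ⟨K, hK, h2⟩ := (hu.le (s := 0 + 1 + 1) (by omega)).der.der.bd0
      refine BO.mk0 (fun i => mul_nonneg (hu.1 i) (hd.1 i))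
        (fun i => ((hu.2.1 i).der.comp (hH i)).sub ((hu.2.1 i).der.comp (hG i))) (C := K * C)
        fun i x => ?_
      calc _ ≤ (K * w i) * |H i x - G i x| := mvt_bd (hu.2.1 i).der (h2 i) _ _
        _ ≤ (K * w i) * (C * d i) := by
            have := mul_nonneg hK (hu.1 i)
            gcongr; exact hC i x
        _ = _ := by ring
    have hH2 : BO s (fun i => deriv (H i)) (fun _ => 1) := hH'.le (by omega)
    have hd2 : BO s (fun i x => deriv (H i) x - deriv (G i) x) d := hd.le (by omega)
    have hd3 : BO s (fun i x => deriv (u i) (G i x)) w :=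
      (hu.der.le (s := s) (by omega)).comp hG (hG'.le (by omega))
    exact (a1.mul1 hH2).add (hd3.mul hd2)

/-- closeness of two families -/
def DP (s : ℕ) (q p : ι → Equiv.Perm ℝ) (d : ι → ℝ) : Prop :=
  BO s (fun i x => lg (q i) x - lg (p i) x) d ∧ ∃ C, 0 ≤ C ∧ ∀ i x, |q i x - p i x| ≤ C * d i

theorem DP.dsub (h : DP s q p d) (hp : ∀ i, p i ∈ Dif) (hq : ∀ i, q i ∈ Dif)
    (hpb : BO s (fun i => lg (p i)) (fun _ => 1)) (hd : ∀ i, d i ≤ 1) :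
    BO s (fun i x => deriv (q i) x - deriv (p i) x) d :=
  (hpb.exp.one_mul (h.1.expm1 hd)).congr fun i x => by
    rw [mul_sub, ← Real.exp_add, add_sub_cancel, exp_lg (hp i), exp_lg (hq i), mul_one]

theorem DP.le {r : ℕ} (h : DP s q p d) (hr : r ≤ s) : DP r q p d := ⟨h.1.le hr, h.2⟩

theorem DP.subcomp {u : ι → ℝ → ℝ} (hu : BO (s + 1) u w) (h : DP (s - 1) q p d)
    (hp : ∀ i, p i ∈ Dif) (hq : ∀ i, q i ∈ Dif)
    (hpb : BO (s - 1) (fun i => lg (p i)) (fun _ => 1))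
    (hqb : BO (s - 1) (fun i => lg (q i)) (fun _ => 1)) (hd : ∀ i, d i ≤ 1) :
    BO s (fun i x => u i (q i x) - u i (p i x)) (fun i => w i * d i) := by
  obtain ⟨C, _, hC⟩ := h.2
  exact BO.subcomp hu (fun i => Dif.sm (hp i)) (fun i => Dif.sm (hq i))
    (hpb.dexp hp (by simp)) (hqb.dexp hq (by simp)) (h.dsub hp hq hpb hd) hC

theorem DP.mul (h : DP s p' p d) (h' : DP s q' q d)
    (hp : ∀ i, p i ∈ Dif) (hp' : ∀ i, p' i ∈ Dif) (hq : ∀ i, q i ∈ Dif) (hq' : ∀ i, q' i ∈ Dif)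
    (bp : BO (s + 1) (fun i => lg (p i)) (fun _ => 1))
    (bq : BO s (fun i => lg (q i)) (fun _ => 1))
    (bq' : BO s (fun i => lg (q' i)) (fun _ => 1))
    (hd : ∀ i, d i ≤ 1) : DP s (fun i => p' i * q' i) (fun i => p i * q i) d := by
  constructor
  · have a1 := h.1.lgcomp (bq'.le (s := s - 1) (by omega)) hq' (by simp)
    have a2 := (h'.le (r := s - 1) (by omega)).subcomp bp hq hq' (bq.le (by omega))
      (bq'.le (by omega)) hd
    simp only [_root_.one_mul] at a2
    exact ((a1.add a2).add h'.1).congr fun i x => by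
      rw [lg_mul (hp' i) (hq' i), lg_mul (hp i) (hq i)]; ring
  · obtain ⟨C, hC, h1⟩ := h.2
    obtain ⟨C', hC', h1'⟩ := h'.2
    obtain ⟨K, hK, h2⟩ := (bp.dexp hp (by simp)).bd0
    simp only [mul_one] at h2
    refine ⟨C + K * C', by positivity, fun i x => ?_⟩
    have b1 := h1 i (q' i x)
    have b2 := mvt_bd (Dif.sm (hp i)) (h2 i) (q' i x) (q i x)
    have b3 := mul_le_mul_of_nonneg_left (h1' i x) hK
    have := abs_add_le (p' i (q' i x) - p i (q' i x)) (p i (q' i x) - p i (q i x))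
    rw [sub_add_sub_cancel] at this
    simp only [Equiv.Perm.mul_apply]
    nlinarith

theorem DP.inv (h : DP s q p d) (hp : ∀ i, p i ∈ Dif) (hq : ∀ i, q i ∈ Dif)
    (bp : BO (s + 1) (fun i => lg (p i)) (fun _ => 1))
    (bq : BO s (fun i => lg (q i)) (fun _ => 1))
    (hd : ∀ i, d i ≤ 1) : DP s (fun i => (q i)⁻¹) (fun i => (p i)⁻¹) d := by
  have hp' := fun i => inv_mem (hp i)
  have hq' := fun i => inv_mem (hq i)
  have bp' := bp.lginv hp (by simp)
  have bq' := bq.lginv hq (by simp)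
  have hdisp : ∃ C, 0 ≤ C ∧ ∀ i x, |(q i)⁻¹ x - (p i)⁻¹ x| ≤ C * d i := by
    obtain ⟨C, hC, h1⟩ := h.2
    obtain ⟨K, hK, h2⟩ := (bp'.dexp hp' (by simp)).bd0
    simp only [mul_one] at h2
    refine ⟨K * C, by positivity, fun i x => ?_⟩
    have b2 := mvt_bd (Dif.sm (hp' i)) (h2 i) (p i ((q i)⁻¹ x)) x
    rw [pinv1] at b2
    have b3 := h1 i ((q i)⁻¹ x)
    rw [pinv2, abs_sub_comm] at b3
    nlinarith
  refine ⟨?_, hdisp⟩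
  induction s with
  | zero =>
    have a1 := h.1.lgcomp (bq'.le (s := 0 - 1) (by omega)) hq' (by simp)
    obtain ⟨C, hC, h1⟩ := hdisp
    obtain ⟨C', hC', h1'⟩ := a1.bd0
    obtain ⟨K, hK, h2⟩ := bp.der.bd0
    simp only [mul_one] at h2
    refine BO.mk0 h.1.1 (fun i => (Sm_lg (hq' i)).sub (Sm_lg (hp' i))) (C := C' + K * C)
      fun i x => ?_
    rw [lg_inv (hp i), lg_inv (hq i)]
    have b1 := h1' i x
    have b2 := mvt_bd (Sm_lg (hp i)) (h2 i) ((q i)⁻¹ x) ((p i)⁻¹ x)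
    have b3 := mul_le_mul_of_nonneg_left (h1 i x) hK
    have := abs_add_le (lg (q i) ((q i)⁻¹ x) - lg (p i) ((q i)⁻¹ x))
      (lg (p i) ((q i)⁻¹ x) - lg (p i) ((p i)⁻¹ x))
    rw [sub_add_sub_cancel] at this
    rw [neg_sub_neg, abs_sub_comm]
    nlinarith
  | succ s ih =>
    have ih := ih (h.le (by omega)) (bp.le (by omega)) (bq.le (by omega)) (bp'.le (by omega))
      (bq'.le (by omega))
    have a1 := h.1.lgcomp (bq'.le (s := s + 1 - 1) (by omega)) hq' (by simp)
    have a2 := DP.subcomp (s := s + 1) bp ⟨ih, hdisp⟩ hp' hq' (bp'.le (by omega))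
      (bq'.le (by omega)) hd
    simp only [_root_.one_mul] at a2
    exact (a1.add a2).neg.congr fun i x => by
      rw [lg_inv (hp i), lg_inv (hq i)]; ring

end fam
end

noncomputable section
variable {ι : Type*}

/-! translations and dilations -/
def tr (t : ℝ) : Equiv.Perm ℝ := Equiv.addRight t
@[simp] theorem tr_apply (t x : ℝ) : tr t x = x + t := rfl
@[simp] theorem tr_inv_apply (t x : ℝ) : (tr t)⁻¹ x = x - t := by
  have : (tr t)⁻¹ x = x + -t := rfl
  rw [this, sub_eq_add_neg]
@[simp] theorem tr_symm_apply (t x : ℝ) : (tr t).symm x = x - t := tr_inv_apply t x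
theorem tr_mem (t : ℝ) : tr t ∈ Dif :=
  ⟨contDiff_id.add contDiff_const, (contDiff_id.add contDiff_const : Sm (fun x => x + -t)),
    fun x y h => by simpa using h⟩
theorem tr_mul (s t : ℝ) : tr s * tr t = tr (s + t) := by
  apply Equiv.ext; intro x; simp only [Equiv.Perm.mul_apply, tr_apply]; ring
theorem lg_tr (t : ℝ) : lg (tr t) = fun _ => 0 := by
  funext x
  have : (⇑(tr t)) = fun x => x + t := rfl
  simp [lg, this]

def Dl (c : ℝ) : Equiv.Perm ℝ := toPerm fun x => c * x
theorem Dl_aux {c : ℝ} (hc : 0 < c) : (⇑(Dl c) = fun x => c * x) ∧ Dl c ∈ Dif := by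
  refine mkDif (contDiff_const.mul contDiff_id) (fun x => ?_) fun y => ⟨y / c, ?_⟩
  · rw [deriv_const_mul_field]; simpa using hc
  · field_simp
theorem Dl_apply {c : ℝ} (hc : 0 < c) (x : ℝ) : Dl c x = c * x := by rw [(Dl_aux hc).1]
theorem Dl_mem {c : ℝ} (hc : 0 < c) : Dl c ∈ Dif := (Dl_aux hc).2
theorem Dl_inv_apply {c : ℝ} (hc : 0 < c) (x : ℝ) : (Dl c)⁻¹ x = x / c := by
  rw [Equiv.Perm.inv_def, Equiv.symm_apply_eq, Dl_apply hc]; field_simp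
theorem lg_Dl {c : ℝ} (hc : 0 < c) (x : ℝ) : lg (Dl c) x = Real.log c := by
  rw [lg, (Dl_aux hc).1, deriv_const_mul_field]; simp

theorem lg_conj_tr {p : Equiv.Perm ℝ} (hp : p ∈ Dif) (t x : ℝ) :
    lg (tr t * p * (tr t)⁻¹) x = lg p (x - t) := by
  rw [lg_mul (mul_mem (tr_mem t) hp) (inv_mem (tr_mem t)), lg_mul (tr_mem t) hp,
    lg_inv (tr_mem t), lg_tr]
  simp

theorem lg_conj_Dl {p : Equiv.Perm ℝ} (hp : p ∈ Dif) {c : ℝ} (hc : 0 < c) (x : ℝ) :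
    lg (Dl c * p * (Dl c)⁻¹) x = lg p (x / c) := by
  rw [lg_mul (mul_mem (Dl_mem hc) hp) (inv_mem (Dl_mem hc)), lg_mul (Dl_mem hc) hp,
    lg_inv (Dl_mem hc), lg_Dl hc, lg_Dl hc, Dl_inv_apply hc]
  simp

theorem BO.constfn {r : ℕ} (c : ℝ) : BO r (fun (_ : ι) _ => c) (fun _ => 1) :=
  ⟨by simp, fun _ => contDiff_const, |c|, abs_nonneg _, fun i j _ x => by
    rw [iteratedDeriv_const]; split_ifs <;> simp⟩

theorem BO.shift {s : ℕ} {u : ι → ℝ → ℝ} {w : ι → ℝ} (h : BO s u w) (t : ℝ) :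
    BO s (fun i x => u i (x + t)) w :=
  h.lgcomp (p := fun _ => tr t) (w := fun _ => 1)
    ((BO.constfn 0).congr fun i x => by rw [lg_tr]) (fun _ => tr_mem t) (by simp)

theorem BO.scale {s : ℕ} {u : ι → ℝ → ℝ} {w : ι → ℝ} (h : BO s u w) {c : ℝ} (hc : 0 < c) :
    BO s (fun i x => u i (c * x)) w :=
  (h.lgcomp (p := fun _ => Dl c) (w := fun _ => 1)
    ((BO.constfn (Real.log c)).congr fun i x => by rw [lg_Dl hc]) (fun _ => Dl_mem hc)
    (by simp)).congr fun i x => by rw [Dl_apply hc]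

section fam
variable {p q : ι → Equiv.Perm ℝ} {w d : ι → ℝ} {s : ℕ}
theorem DP.refl (hd : ∀ i, 0 ≤ d i) : DP s p p d :=
  ⟨(BO.zero hd).congr fun i x => by rw [sub_self], 0, le_rfl, fun i x => by simp⟩

theorem BO.conj_tr (h : BO s (fun i => lg (p i)) w) (hp : ∀ i, p i ∈ Dif) (t : ℝ) :
    BO s (fun i => lg (tr t * p i * (tr t)⁻¹)) w :=
  (h.shift (-t)).congr fun i x => by rw [lg_conj_tr (hp i), sub_eq_add_neg]

theorem DP.conj_tr (h : DP s q p d) (hp : ∀ i, p i ∈ Dif) (hq : ∀ i, q i ∈ Dif) (t : ℝ) :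
    DP s (fun i => tr t * q i * (tr t)⁻¹) (fun i => tr t * p i * (tr t)⁻¹) d := by
  refine ⟨(h.1.shift (-t)).congr fun i x => by
    rw [lg_conj_tr (hp i), lg_conj_tr (hq i), sub_eq_add_neg x t], ?_⟩
  obtain ⟨C, hC, h2⟩ := h.2
  exact ⟨C, hC, fun i x => by simpa using h2 i (x - t)⟩

theorem BO.conj_Dl (h : BO s (fun i => lg (p i)) w) (hp : ∀ i, p i ∈ Dif) {c : ℝ} (hc : 0 < c) :
    BO s (fun i => lg (Dl c * p i * (Dl c)⁻¹)) w :=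
  (h.scale (inv_pos.2 hc)).congr fun i x => by rw [lg_conj_Dl (hp i) hc, div_eq_inv_mul]

theorem DP.conj_Dl (h : DP s q p d) (hp : ∀ i, p i ∈ Dif) (hq : ∀ i, q i ∈ Dif) {c : ℝ}
    (hc : 0 < c) :
    DP s (fun i => Dl c * q i * (Dl c)⁻¹) (fun i => Dl c * p i * (Dl c)⁻¹) d := by
  refine ⟨(h.1.scale (inv_pos.2 hc)).congr fun i x => by
    rw [lg_conj_Dl (hp i) hc, lg_conj_Dl (hq i) hc, div_eq_inv_mul], ?_⟩
  obtain ⟨C, hC, h2⟩ := h.2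
  refine ⟨c * C, by positivity, fun i x => ?_⟩
  simp only [Equiv.Perm.mul_apply, Dl_apply hc, Dl_inv_apply hc, ← mul_sub, abs_mul, abs_of_pos hc,
    mul_assoc]
  exact mul_le_mul_of_nonneg_left (h2 i _) hc.le
end fam

/-! cut-off -/
theorem bdd_cpt {u : ℝ → ℝ} (hu : Sm u) {a b M : ℝ} (hM : ∀ x, |u x| ≤ M)
    (h : ∀ x, x ∉ Icc a b → deriv u x = 0) (j : ℕ) : ∃ C, ∀ x, |iteratedDeriv j u x| ≤ C := by
  rcases j with _ | j
  · exact ⟨M, by simpa using hM⟩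
  · obtain ⟨C, hC⟩ := (isCompact_Icc (a := a) (b := b)).exists_bound_of_continuousOn
      (hu.iter (j + 1)).continuous.continuousOn
    refine ⟨|C|, fun x => ?_⟩
    by_cases hx : x ∈ Icc a b
    · exact (hC x hx).trans (le_abs_self _)
    · have h0 : iteratedDeriv (j + 1) u x = 0 := by
        rw [iteratedDeriv_succ']
        have : deriv u =ᶠ[𝓝 x] fun _ => 0 :=
          mem_of_superset (isClosed_Icc.isOpen_compl.mem_nhds hx) fun y hy => h y hy
        rw [(this.iteratedDeriv_eq j), iteratedDeriv_const]; split_ifs <;> rfl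
      rw [h0]; simp

def chi (x : ℝ) : ℝ := Real.smoothTransition (x - 1)
theorem chi_sm : Sm chi := Real.smoothTransition.contDiff.comp (contDiff_id.sub contDiff_const)
theorem chi_le {x : ℝ} (h : x ≤ 1) : chi x = 0 := Real.smoothTransition.zero_of_nonpos (by linarith)
theorem chi_ge {x : ℝ} (h : 2 ≤ x) : chi x = 1 := Real.smoothTransition.one_of_one_le (by linarith)
theorem chi_nonneg (x : ℝ) : 0 ≤ chi x := Real.smoothTransition.nonneg _
theorem chi_le_one (x : ℝ) : chi x ≤ 1 := Real.smoothTransition.le_one _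
theorem chi_abs (x : ℝ) : |chi x| ≤ 1 := by rw [abs_of_nonneg (chi_nonneg x)]; exact chi_le_one x

theorem chi_BO (r : ℕ) : BO r (fun _ : ι => chi) (fun _ => 1) := by
  refine BO.const chi_sm (fun j => bdd_cpt chi_sm (M := 1) chi_abs (a := 1) (b := 2) ?_ j) r
  intro x hx
  simp only [mem_Icc, not_and_or, not_le] at hx
  rcases hx with hx | hx
  · have : chi =ᶠ[𝓝 x] fun _ => 0 :=
      mem_of_superset (Iio_mem_nhds hx) fun y hy => chi_le (le_of_lt hy)
    rw [this.deriv_eq]; simp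
  · have : chi =ᶠ[𝓝 x] fun _ => 1 :=
      mem_of_superset (Ioi_mem_nhds hx) fun y hy => chi_ge (le_of_lt hy)
    rw [this.deriv_eq]; simp

theorem Sm_of_deriv {f g : ℝ → ℝ} (hg : Sm g) (h : ∀ x, HasDerivAt f (g x) x) : Sm f := by
  have : ContDiff ℝ ((⊤ : ℕ∞) + 1) f := by
    refine contDiff_succ_iff_deriv.2 ⟨fun x => (h x).differentiableAt, by simp, ?_⟩
    rw [show deriv f = g from funext fun x => (h x).deriv]
    exact hg
  exact this

theorem surj_of_deriv {F : ℝ → ℝ} (hF : Sm F) {m : ℝ} (hm : 0 < m) (h : ∀ x, m ≤ deriv F x) :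
    Function.Surjective F := by
  have key : ∀ x y, x ≤ y → m * (y - x) ≤ F y - F x := fun x y hxy =>
    Convex.mul_sub_le_image_sub_of_le_deriv convex_univ hF.continuous.continuousOn
      hF.diff.differentiableOn (fun z _ => h z) x (mem_univ _) y (mem_univ _) hxy
  refine hF.continuous.surjective ?_ ?_
  · refine tendsto_atTop_mono' _ (f₁ := fun x => m * x + F 0) ?_
      (tendsto_atTop_add_const_right _ _ (tendsto_id.const_mul_atTop hm))
    filter_upwards [eventually_ge_atTop 0] with x hx
    have := key 0 x hx
    linarith
  · refine tendsto_atBot_mono' _ (f₂ := F) (f₁ := fun x => m * x + F 0) ?_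
      (tendsto_atBot_add_const_right _ _ (tendsto_id.const_mul_atBot hm))
    filter_upwards [eventually_le_atBot 0] with x hx
    have := key x 0 hx
    linarith

/-! states -/
def IsState (L : ℝ → ℝ) : Prop :=
  Sm L ∧ Function.Periodic L 1 ∧ ∫ x in (0:ℝ)..1, Real.exp (L x) = 1

theorem IsState.zero : IsState fun _ => 0 := ⟨contDiff_const, fun x => rfl, by simp⟩

def bF (L : ℝ → ℝ) (x : ℝ) : ℝ := ∫ t in (0:ℝ)..x, Real.exp (chi t * L t)
def bP (L : ℝ → ℝ) : Equiv.Perm ℝ := toPerm (bF L)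

section bP
variable {L : ℝ → ℝ} (hL : IsState L)
include hL

theorem Sm_chiL : Sm fun x => chi x * L x := chi_sm.mul hL.1

theorem bF_hasDeriv (x : ℝ) : HasDerivAt (bF L) (Real.exp (chi x * L x)) x :=
  ((Sm_chiL hL).exp.continuous).integral_hasStrictDerivAt 0 x |>.hasDerivAt

theorem bF_sm : Sm (bF L) := Sm_of_deriv (Sm_chiL hL).exp (bF_hasDeriv hL)

theorem bP_aux : ⇑(bP L) = bF L ∧ bP L ∈ Dif := by
  have hd : ∀ x, deriv (bF L) x = Real.exp (chi x * L x) := fun x => (bF_hasDeriv hL x).deriv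
  refine mkDif (bF_sm hL) (fun x => by rw [hd]; exact Real.exp_pos _) ?_
  obtain ⟨C, hC⟩ := Sm.bdd_of_per hL.1.continuous hL.2.1
  refine surj_of_deriv (bF_sm hL) (Real.exp_pos (-C)) fun x => ?_
  rw [hd]
  apply Real.exp_le_exp.2
  have h1 : |chi x * L x| ≤ C := by
    rw [abs_mul]
    have := hC x
    have := abs_nonneg (L x)
    have := chi_abs x
    have := abs_nonneg (chi x)
    nlinarith
  exact (abs_le.1 h1).1

theorem bP_apply (x : ℝ) : bP L x = bF L x := by rw [(bP_aux hL).1]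
theorem bP_mem : bP L ∈ Dif := (bP_aux hL).2
theorem lg_bP (x : ℝ) : lg (bP L) x = chi x * L x := by
  rw [lg, (bP_aux hL).1, (bF_hasDeriv hL x).deriv, Real.log_exp]

theorem bP_le {x : ℝ} (h : x ≤ 1) : bP L x = x := by
  rw [bP_apply hL, bF]
  have : ∫ t in (0:ℝ)..x, Real.exp (chi t * L t) = ∫ t in (0:ℝ)..x, 1 := by
    refine intervalIntegral.integral_congr fun t ht => ?_
    have : t ≤ 1 := (mem_uIcc.1 ht).elim (fun h' => by linarith [h'.2]) fun h' => by linarith [h'.2]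
    simp [chi_le this]
  rw [this]; simp

theorem bP_ge {x : ℝ} (h : 2 ≤ x) : bP L (x + 1) = bP L x + 1 := by
  have hc := (Sm_chiL hL).exp.continuous
  rw [bP_apply hL, bP_apply hL, bF, bF, ← intervalIntegral.integral_add_adjacent_intervals
    (b := x) (hc.intervalIntegrable _ _) (hc.intervalIntegrable _ _)]
  congr 1
  have : ∫ t in x..(x+1), Real.exp (chi t * L t) = ∫ t in x..(x+1), Real.exp (L t) := by
    refine intervalIntegral.integral_congr fun t ht => ?_
    rw [uIcc_of_le (by linarith)] at ht
    simp [chi_ge (h.trans ht.1)]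
  rw [this]
  have hp : Function.Periodic (fun t => Real.exp (L t)) 1 := fun t => by simp [hL.2.1 t]
  rw [hp.intervalIntegral_add_eq x 0, zero_add]
  exact hL.2.2

/-- the basic compactly supported element -/
theorem bP_inv_le {y : ℝ} (h : y ≤ 1) : (bP L)⁻¹ y = y := by
  rw [Equiv.Perm.inv_def, Equiv.symm_apply_eq, bP_le hL h]
end bP

def fP (L : ℝ → ℝ) : Equiv.Perm ℝ := (tr (-1) * bP L * (tr (-1))⁻¹) * (bP L)⁻¹

theorem fP_mem {L : ℝ → ℝ} (hL : IsState L) : fP L ∈ Dif :=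
  mul_mem (mul_mem (mul_mem (tr_mem _) (bP_mem hL)) (inv_mem (tr_mem _))) (inv_mem (bP_mem hL))

theorem fP_apply (L : ℝ → ℝ) (y : ℝ) : fP L y = bP L ((bP L)⁻¹ y + 1) - 1 := by
  simp [fP, sub_eq_add_neg]

def kap (x : ℝ) : ℝ := chi (x + 1) - chi x

theorem lg_fP {L : ℝ → ℝ} (hL : IsState L) (y : ℝ) :
    lg (fP L) y = kap ((bP L)⁻¹ y) * L ((bP L)⁻¹ y) := by
  have hb := bP_mem hL
  rw [fP, lg_mul (mul_mem (mul_mem (tr_mem _) hb) (inv_mem (tr_mem _))) (inv_mem hb),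
    lg_conj_tr hb, lg_inv hb, lg_bP hL, lg_bP hL, sub_neg_eq_add, hL.2.1, kap]
  ring

theorem fP_le {L : ℝ → ℝ} (hL : IsState L) {y : ℝ} (h : y ≤ 0) : fP L y = y := by
  rw [fP_apply, bP_inv_le hL (by linarith), bP_le hL (by linarith)]; ring

theorem fP_ge {L : ℝ → ℝ} (hL : IsState L) (h2 : bP L 2 ≤ 3) {y : ℝ} (h : 3 ≤ y) :
    fP L y = y := by
  have : 2 ≤ (bP L)⁻¹ y := by
    have := (Dif.mono (inv_mem (bP_mem hL))).monotone (h2.trans h)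
    rwa [pinv1] at this
  rw [fP_apply, bP_ge hL this, pinv2]; ring

section fam
variable {L M : ι → ℝ → ℝ} {h k : ι → Equiv.Perm ℝ} {w d : ι → ℝ} {s : ℕ}

theorem kap_BO (r : ℕ) : BO r (fun _ : ι => kap) (fun _ => 1) := ((chi_BO r).shift 1).sub (chi_BO r)

theorem BO.bP (hs : ∀ i, IsState (L i)) (hL : BO s L w) : BO s (fun i => lg (bP (L i))) w :=
  ((chi_BO s).one_mul hL).congr fun i x => lg_bP (hs i) x

theorem BO.fP (hs : ∀ i, IsState (L i)) (hL : BO s L w) (hw : ∀ i, w i ≤ 1) :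
    BO s (fun i => lg (fP (L i))) w :=
  (((kap_BO s).one_mul hL).lgcomp (((BO.bP hs hL).lginv (fun i => bP_mem (hs i)) hw).le
    (by omega)) (fun i => inv_mem (bP_mem (hs i))) hw).congr fun i x => lg_fP (hs i) x

theorem per_ext {u : ℝ → ℝ} {M : ℝ} (hp : ∀ x, 2 ≤ x → u (x + 1) = u x)
    (h : ∀ x < 3, |u x| ≤ M) (x : ℝ) : |u x| ≤ M := by
  obtain ⟨n, hn⟩ := exists_nat_gt (x - 3)
  have : ∀ n : ℕ, ∀ x : ℝ, x < 3 + n → |u x| ≤ M := by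
    intro n
    induction n with
    | zero => intro x hx; exact h x (by simpa using hx)
    | succ n ih =>
      intro x hx
      rcases lt_or_ge x 3 with h3 | h3
      · exact h x h3
      · have := hp (x - 1) (by linarith)
        rw [sub_add_cancel] at this
        rw [this]
        exact ih _ (by push_cast at hx; linarith)
  exact this n x (by linarith)

theorem DP.bP (hL : ∀ i, IsState (L i)) (hM : ∀ i, IsState (M i))
    (bL : BO s L (fun _ => 1)) (hd : ∀ i, d i ≤ 1)
    (hLM : BO s (fun i x => M i x - L i x) d) :
    DP s (fun i => bP (M i)) (fun i => bP (L i)) d := by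
  have h1 : BO s (fun i x => lg (_root_.bP (M i)) x - lg (_root_.bP (L i)) x) d :=
    ((chi_BO s).one_mul hLM).congr fun i x => by rw [lg_bP (hL i), lg_bP (hM i)]; ring
  refine ⟨h1, ?_⟩
  have h2 : BO 0 (fun i x => deriv (_root_.bP (M i)) x - deriv (_root_.bP (L i)) x) d :=
    ((BO.bP hL bL).le (Nat.zero_le s)).exp.one_mul ((h1.le (Nat.zero_le s)).expm1 hd) |>.congr
      fun i x => by
        rw [mul_sub, ← Real.exp_add, add_sub_cancel, exp_lg (bP_mem (hL i)),
          exp_lg (bP_mem (hM i)), mul_one]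
  obtain ⟨C, hC, h3⟩ := h2.bd0
  refine ⟨2 * C, by positivity, fun i => ?_⟩
  have hCd : 0 ≤ C * d i := mul_nonneg hC (hLM.1 i)
  refine per_ext (fun x hx => by rw [bP_ge (hL i) hx, bP_ge (hM i) hx]; ring) fun x hx => ?_
  rcases le_or_gt x 1 with h | h
  · rw [bP_le (hL i) h, bP_le (hM i) h, sub_self, abs_zero]; linarith
  · have sM := Dif.sm (bP_mem (hM i))
    have sL := Dif.sm (bP_mem (hL i))
    have := mvt_bd (f := fun x => _root_.bP (M i) x - _root_.bP (L i) x) (sM.sub sL) (C := C * d i)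
      (fun y => by rw [deriv_fun_sub (sM.diff y) (sL.diff y)]; exact h3 i y) x 1
    simp only [bP_le (hL i) le_rfl, bP_le (hM i) le_rfl, sub_self, sub_zero] at this
    rw [abs_of_pos (by linarith : 0 < x - 1)] at this
    nlinarith

theorem DP.fP (hL : ∀ i, IsState (L i)) (hM : ∀ i, IsState (M i))
    (bL : BO (s + 1) L (fun _ => 1)) (bM : BO s M (fun _ => 1)) (hd : ∀ i, d i ≤ 1)
    (hLM : BO s (fun i x => M i x - L i x) d) :
    DP s (fun i => fP (M i)) (fun i => fP (L i)) d := by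
  have h1 := DP.bP hL hM (bL.le (by omega)) hd hLM
  have mL := fun i => bP_mem (hL i)
  have mM := fun i => bP_mem (hM i)
  have cL := BO.bP hL bL
  have cM := BO.bP hM bM
  exact (h1.conj_tr mL mM (-1)).mul (h1.inv mL mM cL cM hd)
    (fun i => mul_mem (mul_mem (tr_mem _) (mL i)) (inv_mem (tr_mem _)))
    (fun i => mul_mem (mul_mem (tr_mem _) (mM i)) (inv_mem (tr_mem _)))
    (fun i => inv_mem (mL i)) (fun i => inv_mem (mM i))
    (cL.conj_tr mL (-1)) ((cL.lginv mL (by simp)).le (by omega)) (cM.lginv mM (by simp)) hd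
end fam
end

noncomputable section
variable {ι : Type*}

def aA (A : ℕ) (a : Equiv.Perm ℝ) : Equiv.Perm ℝ := Dl A * a * (Dl A)⁻¹

def cR (A : ℕ) (a : Equiv.Perm ℝ) : ℕ → Equiv.Perm ℝ
  | 0 => 1
  | j + 1 => tr 1 * (aA A a * cR A a j) * (tr 1)⁻¹

/-- admissible input of the rolling construction -/
structure Adm (A : ℕ) (a : Equiv.Perm ℝ) : Prop where
  pos : 0 < A
  mem : a ∈ Dif
  le : ∀ y ≤ 0, a y = y
  ge : ∀ y, 3 ≤ y → a y = y
  disp : ∀ y, A * |a y - y| * (3 * A + 4) ≤ 1 / 2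
  lgb : ∀ y, |lg a y| * (3 * A + 4) ≤ 1 / 2

def Lam (A : ℕ) (a : Equiv.Perm ℝ) (x : ℝ) : ℝ :=
  lg (cR A a (3 * A + 4)) (3 * A + 1 + Int.fract x)

theorem aA_mem {A : ℕ} (hA : 0 < A) {a : Equiv.Perm ℝ} (h : a ∈ Dif) : aA A a ∈ Dif :=
  mul_mem (mul_mem (Dl_mem (by exact_mod_cast hA)) h) (inv_mem (Dl_mem (by exact_mod_cast hA)))

theorem aA_apply {A : ℕ} (hA : 0 < A) (a : Equiv.Perm ℝ) (x : ℝ) : aA A a x = A * a (x / A) := by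
  have : (0:ℝ) < A := by exact_mod_cast hA
  rw [aA, Equiv.Perm.mul_apply, Equiv.Perm.mul_apply, Dl_inv_apply this, Dl_apply this]

theorem lg_aA {A : ℕ} (hA : 0 < A) {a : Equiv.Perm ℝ} (h : a ∈ Dif) (x : ℝ) :
    lg (aA A a) x = lg a (x / A) := lg_conj_Dl h (by exact_mod_cast hA) x

theorem cR_succ (A : ℕ) (a : Equiv.Perm ℝ) (j : ℕ) (x : ℝ) :
    cR A a (j + 1) x = aA A a (cR A a j (x - 1)) + 1 := by
  simp [cR]

theorem cR_mem {A : ℕ} (hA : 0 < A) {a : Equiv.Perm ℝ} (h : a ∈ Dif) (j : ℕ) : cR A a j ∈ Dif := by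
  induction j with
  | zero => exact one_mem _
  | succ j ih =>
    exact mul_mem (mul_mem (tr_mem _) (mul_mem (aA_mem hA h) ih)) (inv_mem (tr_mem _))

theorem lg_cR_succ {A : ℕ} (hA : 0 < A) {a : Equiv.Perm ℝ} (h : a ∈ Dif) (j : ℕ) (x : ℝ) :
    lg (cR A a (j + 1)) x = lg (aA A a) (cR A a j (x - 1)) + lg (cR A a j) (x - 1) := by
  rw [cR, lg_conj_tr (mul_mem (aA_mem hA h) (cR_mem hA h j)), lg_mul (aA_mem hA h) (cR_mem hA h j)]

namespace Adm
variable {A : ℕ} {a : Equiv.Perm ℝ} (H : Adm A a)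
include H

theorem posR : (0:ℝ) < A := by exact_mod_cast H.pos
theorem aA_le {y : ℝ} (hy : y ≤ 0) : aA A a y = y := by
  have := H.posR
  rw [aA_apply H.pos, H.le _ (div_nonpos_of_nonpos_of_nonneg hy this.le)]; field_simp
theorem aA_ge {y : ℝ} (hy : 3 * A ≤ y) : aA A a y = y := by
  have := H.posR
  rw [aA_apply H.pos, H.ge _ (by rwa [le_div_iff₀ this])]; field_simp
theorem lgA_ge {y : ℝ} (hy : 3 * A < y) : lg (aA A a) y = 0 := by
  have : ⇑(aA A a) =ᶠ[𝓝 y] fun y => y :=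
    mem_of_superset (Ioi_mem_nhds hy) fun z hz => H.aA_ge (le_of_lt hz)
  rw [lg, this.deriv_eq]; simp
theorem aA_disp (y : ℝ) : |aA A a y - y| * (3 * A + 4) ≤ 1 / 2 := by
  have hA := H.posR
  have e : aA A a y - y = A * (a (y / A) - y / A) := by
    rw [aA_apply H.pos]; field_simp
  rw [e, abs_mul, abs_of_pos hA]
  exact H.disp _

theorem cR_disp (j : ℕ) (x : ℝ) : |cR A a j x - x| * (3 * A + 4) ≤ j / 2 := by
  induction j generalizing x with
  | zero => simp [cR]
  | succ j ih =>
    rw [cR_succ]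
    have h1 := H.aA_disp (cR A a j (x - 1))
    have h2 := ih (x - 1)
    have hA := H.posR
    have := abs_add_le (aA A a (cR A a j (x - 1)) - cR A a j (x - 1)) (cR A a j (x - 1) - (x - 1))
    rw [show aA A a (cR A a j (x - 1)) - cR A a j (x - 1) + (cR A a j (x - 1) - (x - 1))
      = aA A a (cR A a j (x - 1)) + 1 - x by ring] at this
    have := mul_le_mul_of_nonneg_right this (by linarith : (0:ℝ) ≤ 3 * A + 4)
    push_cast
    linarith

theorem cR_half {j : ℕ} (hj : j ≤ 3 * A + 4) (x : ℝ) : |cR A a j x - x| ≤ 1 / 2 := by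
  have := H.cR_disp j x
  have h2 : (j : ℝ) ≤ 3 * A + 4 := by exact_mod_cast hj
  have hA := H.posR
  by_contra hc
  push Not at hc
  have := mul_lt_mul_of_pos_right hc (by linarith : (0:ℝ) < 3 * A + 4)
  linarith

theorem cR_lg (j : ℕ) (x : ℝ) : |lg (cR A a j) x| * (3 * A + 4) ≤ j / 2 := by
  induction j generalizing x with
  | zero => simp [cR, lg_one]
  | succ j ih =>
    rw [lg_cR_succ H.pos H.mem, lg_aA H.pos H.mem]
    have h1 := H.lgb (cR A a j (x - 1) / A)
    have h2 := ih (x - 1)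
    have hA := H.posR
    have := mul_le_mul_of_nonneg_right (abs_add_le (lg a (cR A a j (x - 1) / A))
      (lg (cR A a j) (x - 1))) (by linarith : (0:ℝ) ≤ 3 * A + 4)
    push_cast
    linarith

theorem cR_deriv {j : ℕ} (hj : j ≤ 3 * A + 4) (x : ℝ) : |deriv (cR A a j) x| ≤ 2 := by
  rw [abs_of_pos (Dif.pos (cR_mem H.pos H.mem j) x), ← exp_lg (cR_mem H.pos H.mem j)]
  have := H.cR_lg j x
  have h2 : (j : ℝ) ≤ 3 * A + 4 := by exact_mod_cast hj
  have hA := H.posR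
  have h3 : |lg (cR A a j) x| ≤ 1 / 2 := by
    by_contra hc
    push Not at hc
    have := mul_lt_mul_of_pos_right hc (by linarith : (0:ℝ) < 3 * A + 4)
    linarith
  have h4 : lg (cR A a j) x ≤ Real.log 2 := by
    have := Real.log_two_gt_d9
    have := (abs_le.1 h3).2
    linarith
  calc _ ≤ Real.exp (Real.log 2) := Real.exp_le_exp.2 h4
    _ = 2 := Real.exp_log (by norm_num)

theorem cR_stab (j : ℕ) {x : ℝ} (hx : x ≤ j + 1) : cR A a (j + 1) x = cR A a j x := by
  induction j generalizing x with
  | zero =>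
    rw [cR_succ]
    have : x ≤ 1 := by simpa using hx
    simp only [cR, Equiv.Perm.one_apply]
    rw [H.aA_le (by linarith)]; ring
  | succ j ih =>
    rw [cR_succ A a (j + 1) x, ih (x := x - 1) (by push_cast at hx; linarith), cR_succ A a j x]

theorem cR_stab' {j k : ℕ} (hjk : j ≤ k) {x : ℝ} (hx : x ≤ j + 1) : cR A a k x = cR A a j x := by
  induction k, hjk using Nat.le_induction with
  | base => rfl
  | succ k hk ih =>
    have : (j : ℝ) ≤ k := by exact_mod_cast hk
    rw [H.cR_stab k (by linarith), ih]

theorem cR_per {x : ℝ} (h1 : 3 * A + 1 / 2 ≤ x) (h2 : x ≤ 3 * A + 4) :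
    cR A a (3 * A + 4) (x + 1) = cR A a (3 * A + 4) x + 1 := by
  have e : cR A a (3 * A + 4) (x + 1) = aA A a (cR A a (3 * A + 3) x) + 1 := by
    rw [show 3 * A + 4 = 3 * A + 3 + 1 by rfl, cR_succ, add_sub_cancel_right]
  have e2 : cR A a (3 * A + 4) x = cR A a (3 * A + 3) x :=
    H.cR_stab _ (by push_cast; linarith)
  have := abs_le.1 (H.cR_half (show 3 * A + 3 ≤ 3 * A + 4 by omega) x)
  rw [e, e2, H.aA_ge (by linarith)]

theorem lgc_per {x : ℝ} (h1 : 3 * A + 1 / 2 < x) (h2 : x < 3 * A + 4) :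
    lg (cR A a (3 * A + 4)) (x + 1) = lg (cR A a (3 * A + 4)) x := by
  have : (fun x => cR A a (3 * A + 4) (x + 1)) =ᶠ[𝓝 x] fun x => cR A a (3 * A + 4) x + 1 :=
    mem_of_superset (Ioo_mem_nhds h1 h2) fun y hy => H.cR_per hy.1.le hy.2.le
  have := this.deriv_eq
  rw [deriv_comp_add_const, deriv_add_const] at this
  rw [lg, lg, this]

theorem Lam_eq (k : ℤ) {x : ℝ} (h1 : k - 1 / 2 < x) (h2 : x < k + 2) :
    Lam A a x = lg (cR A a (3 * A + 4)) (3 * A + 1 + (x - k)) := by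
  rw [Lam, Int.fract]
  have hf1 := Int.floor_le x
  have hf2 := Int.lt_floor_add_one x
  have a1 : k - 1 ≤ ⌊x⌋ := by rw [Int.le_floor]; push_cast; linarith
  have a2 : ⌊x⌋ < k + 2 := by
    have : ((⌊x⌋ : ℤ) : ℝ) < ((k + 2 : ℤ) : ℝ) := by push_cast; linarith
    exact_mod_cast this
  have : ⌊x⌋ = k - 1 ∨ ⌊x⌋ = k ∨ ⌊x⌋ = k + 1 := by omega
  rcases this with h | h | h
  · rw [h] at hf2 ⊢
    push_cast at hf2 ⊢
    rw [show 3 * (A:ℝ) + 1 + (x - (k - 1)) = 3 * A + 1 + (x - k) + 1 by ring,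
      H.lgc_per (by linarith) (by linarith)]
  · rw [h]
  · rw [h] at hf1 hf2 ⊢
    push_cast at hf1 hf2 ⊢
    rw [show 3 * (A:ℝ) + 1 + (x - k) = 3 * A + 1 + (x - (k + 1)) + 1 by ring,
      H.lgc_per (by linarith) (by linarith)]

theorem Lam_nhds (x : ℝ) : Lam A a =ᶠ[𝓝 x] fun y =>
    lg (cR A a (3 * A + 4)) (y + (3 * A + 1 - ⌊x⌋)) := by
  refine mem_of_superset (Ioo_mem_nhds (a := (⌊x⌋ : ℝ) - 1 / 2) (b := (⌊x⌋ : ℝ) + 2) ?_ ?_) fun y hy => ?_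
  · linarith [Int.floor_le x]
  · linarith [Int.lt_floor_add_one x]
  · have := H.Lam_eq ⌊x⌋ hy.1 hy.2
    simp only [mem_ofPred_eq, this]
    congr 1; ring

theorem Lam_iter (j : ℕ) (x : ℝ) : iteratedDeriv j (Lam A a) x =
    iteratedDeriv j (lg (cR A a (3 * A + 4))) (3 * A + 1 + Int.fract x) := by
  rw [(H.Lam_nhds x).iteratedDeriv_eq, iteratedDeriv_comp_add_const]
  beta_reduce
  rw [Int.fract, show x + (3 * (A:ℝ) + 1 - ⌊x⌋) = 3 * A + 1 + (x - ⌊x⌋) by ring]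

theorem Lam_sm : Sm (Lam A a) := by
  refine contDiff_iff_contDiffAt.2 fun x => ?_
  refine ContDiffAt.congr_of_eventuallyEq ?_ (H.Lam_nhds x)
  exact (((Sm_lg (cR_mem H.pos H.mem _)).comp
    (contDiff_id.add contDiff_const : Sm fun y => y + (3 * A + 1 - ⌊x⌋)))).contDiffAt

theorem Lam_state : IsState (Lam A a) := by
  refine ⟨H.Lam_sm, fun x => by simp [Lam], ?_⟩
  have hm := cR_mem H.pos H.mem (3 * A + 4)
  have e : ∫ x in (0:ℝ)..1, Real.exp (Lam A a x)
      = ∫ x in (0:ℝ)..1, deriv (cR A a (3 * A + 4)) (3 * A + 1 + x) := by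
    refine intervalIntegral.integral_congr fun x hx => ?_
    rw [uIcc_of_le zero_le_one] at hx
    have := H.Lam_eq 0 (x := x) (by push_cast; linarith [hx.1]) (by push_cast; linarith [hx.2])
    simp only [this, exp_lg hm]
    simp
  rw [e, intervalIntegral.integral_comp_add_left (deriv (cR A a (3 * A + 4))),
    intervalIntegral.integral_deriv_eq_sub (fun x _ => (Dif.sm hm).diff x)
      ((Dif.sm hm).der.continuous.intervalIntegrable _ _), add_zero,
    H.cR_per (by linarith) (by linarith)]
  ring
end Adm

section fam
variable {A : ℕ} {a a' : ι → Equiv.Perm ℝ} {w d : ι → ℝ} {s : ℕ}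

theorem BO.aA (hA : 0 < A) (h : BO s (fun i => lg (a i)) w) (ha : ∀ i, a i ∈ Dif) :
    BO s (fun i => lg (aA A (a i))) w := h.conj_Dl ha (by exact_mod_cast hA)

theorem BO.cR (hA : 0 < A) (h : BO s (fun i => lg (a i)) w) (ha : ∀ i, a i ∈ Dif)
    (hw : ∀ i, w i ≤ 1) (j : ℕ) : BO s (fun i => lg (cR A (a i) j)) w := by
  induction j with
  | zero => exact (BO.zero h.1).congr fun i x => by simp only [_root_.cR, lg_one]
  | succ j ih =>
    exact (((h.aA hA ha).lgmul ih (fun i => aA_mem hA (ha i)) (fun i => cR_mem hA (ha i) j)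
      hw).conj_tr (fun i => mul_mem (aA_mem hA (ha i)) (cR_mem hA (ha i) j)) 1)

theorem BO.Lam (h : BO s (fun i => lg (a i)) w) (H : ∀ i, Adm A (a i)) (hA : 0 < A)
    (hw : ∀ i, w i ≤ 1) : BO s (fun i => Lam A (a i)) w := by
  obtain ⟨h0, h1, C, hC, h2⟩ := h.cR hA (fun i => (H i).mem) hw (3 * A + 4)
  exact ⟨h0, fun i => (H i).Lam_sm, C, hC, fun i j hj x => by
    rw [(H i).Lam_iter]; exact h2 i j hj _⟩

theorem DP.cR (hA : 0 < A) (h : DP s a' a d) (ha : ∀ i, a i ∈ Dif) (ha' : ∀ i, a' i ∈ Dif)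
    (b : BO (s + 1) (fun i => lg (a i)) (fun _ => 1)) (b' : BO s (fun i => lg (a' i)) (fun _ => 1))
    (hd : ∀ i, d i ≤ 1) (j : ℕ) : DP s (fun i => cR A (a' i) j) (fun i => cR A (a i) j) d := by
  induction j with
  | zero => exact DP.refl h.1.1
  | succ j ih =>
    refine DP.conj_tr (DP.mul (h.conj_Dl ha ha' (by exact_mod_cast hA)) ih
      (fun i => aA_mem hA (ha i)) (fun i => aA_mem hA (ha' i)) (fun i => cR_mem hA (ha i) j)
      (fun i => cR_mem hA (ha' i) j) (b.aA hA ha) ((b.cR hA ha (by simp) j).le (by omega))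
      (b'.cR hA ha' (by simp) j) hd) (fun i => mul_mem (aA_mem hA (ha i)) (cR_mem hA (ha i) j))
      (fun i => mul_mem (aA_mem hA (ha' i)) (cR_mem hA (ha' i) j)) 1

theorem iter2 (f : ℝ → ℝ) : iteratedDeriv 2 f = deriv (deriv f) := by
  rw [iteratedDeriv_succ, iteratedDeriv_one]

/-- second derivative of a composition with a near-identity map -/
theorem BO.comp2 {v : ι → ℝ → ℝ} {p : ι → Equiv.Perm ℝ} (hv : BO 2 v d)
    (hp : ∀ i, p i ∈ Dif) (h : BO 2 (fun i => lg (p i)) w) (hw : ∀ i, w i ≤ 1) :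
    ∃ C, 0 ≤ C ∧ ∀ i x, |iteratedDeriv 2 (fun x => v i (p i x)) x - iteratedDeriv 2 (v i) (p i x)|
      ≤ C * (d i * w i) := by
  have hd1 := h.dexpm1 hp hw
  have b1 : BO 0 (fun i x => iteratedDeriv 2 (v i) (p i x)) d := by
    simp only [iter2]
    exact (hv.der.der).lgcomp (h.le (by omega)) hp hw
  have b2 : BO 1 (fun i x => deriv (v i) (p i x)) d := (hv.der).lgcomp (h.le (by omega)) hp hw
  have q : BO 0 (fun i x => deriv (p i) x + 1) (fun _ => 1) :=
    ((h.dexp hp hw).le (by omega)).add (BO.constfn 1)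
  have q2 : BO 0 (fun i x => (deriv (p i) x - 1) * (deriv (p i) x + 1)) w :=
    (hd1.le (by omega)).mul1 q
  have q3 : BO 0 (fun i => deriv (deriv (p i))) w := by
    have := (hd1.le (s := 1) (by omega)).der
    refine this.congr fun i x => ?_
    rw [deriv_sub_const]
  obtain ⟨C, hC, hh⟩ := ((b1.mul q2).add ((b2.le (by omega)).mul q3)).bd0
  refine ⟨C, hC, fun i x => le_trans (le_of_eq ?_) (hh i x)⟩
  congr 1
  rw [iter2, iter2]
  have e1 : deriv (fun x => v i (p i x)) = fun x => deriv (v i) (p i x) * deriv (p i) x := by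
    funext x
    exact deriv_comp (h₂ := v i) (h := p i) x ((hv.2.1 i).diff _) ((Dif.sm (hp i)).diff _)
  have e2 : deriv (fun x => deriv (v i) (p i x)) x = deriv (deriv (v i)) (p i x) * deriv (p i) x :=
    deriv_comp (h₂ := deriv (v i)) (h := p i) x ((hv.2.1 i).der.diff _) ((Dif.sm (hp i)).diff _)
  rw [e1, deriv_mul_fun (b2.2.1 i) (Dif.sm (hp i)).der]
  beta_reduce
  rw [e2]
  ring

theorem iter_add {f g : ℝ → ℝ} (hf : Sm f) (hg : Sm g) (j : ℕ) (x : ℝ) :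
    iteratedDeriv j (fun x => f x + g x) x = iteratedDeriv j f x + iteratedDeriv j g x :=
  iteratedDeriv_fun_add (hf.of_le (by exact_mod_cast le_top)).contDiffAt
    (hg.of_le (by exact_mod_cast le_top)).contDiffAt

theorem iter_sub {f g : ℝ → ℝ} (hf : Sm f) (hg : Sm g) (j : ℕ) (x : ℝ) :
    iteratedDeriv j (fun x => f x - g x) x = iteratedDeriv j f x - iteratedDeriv j g x :=
  iteratedDeriv_fun_sub (hf.of_le (by exact_mod_cast le_top)).contDiffAt
    (hg.of_le (by exact_mod_cast le_top)).contDiffAt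

theorem iter_scale {f : ℝ → ℝ} (hf : Sm f) (c : ℝ) (n : ℕ) (x : ℝ) :
    iteratedDeriv n (fun x => f (c * x)) x = c ^ n * iteratedDeriv n f (c * x) := by
  have h : ContDiff ℝ (n : ℕ) f := hf.of_le (by exact_mod_cast le_top)
  rw [iteratedDeriv_comp_const_mul h]

/-- sharp comparison estimate at order two -/
theorem sharp_cR (hA : 0 < A) (h : DP 2 a' a d) (ha : ∀ i, a i ∈ Dif) (ha' : ∀ i, a' i ∈ Dif)
    (b : BO 3 (fun i => lg (a i)) w) (b' : BO 2 (fun i => lg (a' i)) w)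
    (hd : ∀ i, d i ≤ 1) (hw : ∀ i, w i ≤ 1) {C0 : ℝ}
    (h0 : ∀ i x, |iteratedDeriv 2 (fun x => lg (a' i) x - lg (a i) x) x| ≤ C0 * d i) (j : ℕ) :
    ∃ C, 0 ≤ C ∧ ∀ i x, |iteratedDeriv 2 (fun x => lg (cR A (a' i) j) x - lg (cR A (a i) j) x) x|
      ≤ j * (C0 * d i / A ^ 2) + C * (d i * w i) := by
  have hAR : (0:ℝ) < A := by exact_mod_cast hA
  induction j with
  | zero => exact ⟨0, le_rfl, fun i x => by simp [cR]⟩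
  | succ j ih =>
    obtain ⟨C, hC, hh⟩ := ih
    have hc := fun i => cR_mem hA (ha i) j
    have hc' := fun i => cR_mem hA (ha' i) j
    have b1 := b.cR hA ha hw j
    have b1' := b'.cR hA ha' hw j
    have hv : BO 2 (fun i x => lg (aA A (a' i)) x - lg (aA A (a i)) x) d :=
      (h.conj_Dl ha ha' hAR).1
    obtain ⟨C1, hC1, h1⟩ := hv.comp2 hc' b1' hw
    have h2 := DP.subcomp (s := 2) (b.aA hA ha)
      ((DP.cR hA h ha ha' (b.one hw) (b'.one hw) hd j).le (by omega)) hc hc'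
      ((b1.one hw).le (by omega)) ((b1'.one hw).le (by omega)) hd
    obtain ⟨_, _, C2, hC2, h2⟩ := h2
    refine ⟨C + C1 + C2, by positivity, fun i x => ?_⟩
    let F1 : ℝ → ℝ := fun x =>
      lg (aA A (a' i)) (cR A (a' i) j x) - lg (aA A (a i)) (cR A (a' i) j x)
    let F2 : ℝ → ℝ := fun x =>
      lg (aA A (a i)) (cR A (a' i) j x) - lg (aA A (a i)) (cR A (a i) j x)
    let F3 : ℝ → ℝ := fun x => lg (cR A (a' i) j) x - lg (cR A (a i) j) x
    let F : ℝ → ℝ := fun x => (F1 x + F2 x) + F3 x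
    have e : (fun x => lg (cR A (a' i) (j + 1)) x - lg (cR A (a i) (j + 1)) x) =
        fun x => F (x - 1) := by
      funext x
      simp only [F, F1, F2, F3]
      rw [lg_cR_succ hA (ha i), lg_cR_succ hA (ha' i)]; ring
    have s1 := Sm_lg (aA_mem hA (ha i))
    have s2 := Sm_lg (aA_mem hA (ha' i))
    have s3 := Dif.sm (hc i)
    have s4 := Dif.sm (hc' i)
    have t1 : Sm F1 := (s2.comp s4).sub (s1.comp s4)
    have t2 : Sm F2 := (s1.comp s4).sub (s1.comp s3)
    have t3 : Sm F3 := (Sm_lg (hc' i)).sub (Sm_lg (hc i))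
    rw [e, iteratedDeriv_comp_sub_const]
    have eF : iteratedDeriv 2 F (x - 1) = _ := iter_add (t1.add t2) t3 2 (x - 1)
    have eF' : iteratedDeriv 2 (F1 + F2) (x - 1) = _ := iter_add t1 t2 2 (x - 1)
    beta_reduce
    rw [eF]
    erw [eF']
    have e3 : |iteratedDeriv 2 (fun x => lg (aA A (a' i)) x - lg (aA A (a i)) x)
        (cR A (a' i) j (x - 1))| ≤ C0 * d i / A ^ 2 := by
      have : (fun x => lg (aA A (a' i)) x - lg (aA A (a i)) x)
          = fun x => (fun x => lg (a' i) x - lg (a i) x) ((A:ℝ)⁻¹ * x) := by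
        funext x
        rw [lg_aA hA (ha i), lg_aA hA (ha' i), div_eq_inv_mul]
      rw [this, iter_scale ((Sm_lg (ha' i)).sub (Sm_lg (ha i))), abs_mul, abs_of_pos (by positivity), div_eq_inv_mul, inv_pow]
      gcongr
      exact h0 i _
    have f1 : |iteratedDeriv 2 F1 (x - 1) - _| ≤ _ := h1 i (x - 1)
    have f2 : |iteratedDeriv 2 F2 (x - 1)| ≤ C2 * (w i * d i) := h2 i 2 le_rfl (x - 1)
    have f3 : |iteratedDeriv 2 F3 (x - 1)| ≤ _ := hh i (x - 1)
    rw [abs_le] at *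
    push_cast
    constructor <;> nlinarith
end fam
end

noncomputable section
variable {ι : Type*}

def TB (r : ℕ) (ρ : ℝ) (Q u : ι → ℝ → ℝ) (w : ι → ℝ) : Prop :=
  ∃ C, 0 ≤ C ∧ ∀ i B, (∀ x, |iteratedDeriv (r + 1) (Q i) x| ≤ B) →
    ∀ x, |iteratedDeriv (r + 1) (u i) x| ≤ ρ * B + C * w i

section tb
variable {r : ℕ} {ρ ρ' : ℝ} {Q u v : ι → ℝ → ℝ} {w : ι → ℝ}

theorem TB.congr (h : TB r ρ Q u w) (e : ∀ i x, v i x = u i x) : TB r ρ Q v w := by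
  obtain rfl : v = u := by funext i x; exact e i x
  exact h

theorem TB.ofBO (h : BO (r + 1) u w) : TB r 0 Q u w := by
  obtain ⟨_, _, C, hC, h⟩ := h
  exact ⟨C, hC, fun i B _ x => by simpa using h i (r + 1) le_rfl x⟩

theorem TB.add (h : TB r ρ Q u w) (h' : TB r ρ' Q v w) (hu : ∀ i, Sm (u i)) (hv : ∀ i, Sm (v i)) :
    TB r (ρ + ρ') Q (fun i x => u i x + v i x) w := by
  obtain ⟨C, hC, h⟩ := h
  obtain ⟨C', hC', h'⟩ := h'
  refine ⟨C + C', by positivity, fun i B hB x => ?_⟩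
  rw [iter_add (hu i) (hv i)]
  have := h i B hB x
  have := h' i B hB x
  have := abs_add_le (iteratedDeriv (r + 1) (u i) x) (iteratedDeriv (r + 1) (v i) x)
  linarith

theorem TB.comp (h : TB r ρ Q u w) (hu : BO r u w) {p : ι → Equiv.Perm ℝ} (hp : ∀ i, p i ∈ Dif)
    (h2 : ∀ i x, |deriv (p i) x| ≤ 2) (hb : BO r (fun i => deriv (p i)) (fun _ => 1)) :
    TB r (ρ * 2 ^ (r + 1)) Q (fun i x => u i (p i x)) w := by
  obtain ⟨C, hC, h⟩ := h
  obtain ⟨C', hC', h'⟩ := hu.comp_lead (fun i => Dif.sm (hp i)) hb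
  refine ⟨C * 2 ^ (r + 1) + C', by positivity, fun i B hB x => ?_⟩
  have a1 := h i B hB (p i x)
  have a2 := h' i x
  have a3 : |iteratedDeriv (r + 1) (u i) (p i x) * deriv (p i) x ^ (r + 1)|
      ≤ (ρ * B + C * w i) * 2 ^ (r + 1) := by
    rw [abs_mul, abs_pow]
    have := h2 i x
    gcongr
    exact (abs_nonneg _).trans a1
  have := abs_sub_abs_le_abs_sub (iteratedDeriv (r + 1) (fun x => u i (p i x)) x)
    (iteratedDeriv (r + 1) (u i) (p i x) * deriv (p i) x ^ (r + 1))
  linarith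

theorem TB.mulb (hu : BO r u w) (hv : BO (r + 1) v (fun _ => 1)) (h1 : ∀ i x, |v i x| ≤ 1) :
    TB r 1 u (fun i x => u i x * v i x) w := by
  obtain ⟨C', hC', h'⟩ := hu.mul_lead hv
  refine ⟨C', hC', fun i B hB x => ?_⟩
  have a1 := hB x
  have a2 := h' i x
  have a3 : |iteratedDeriv (r + 1) (u i) x * v i x| ≤ B * 1 := by
    rw [abs_mul]
    exact mul_le_mul a1 (h1 i x) (abs_nonneg _) ((abs_nonneg _).trans a1)
  have := abs_sub_abs_le_abs_sub (iteratedDeriv (r + 1) (fun x => u i x * v i x) x)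
    (iteratedDeriv (r + 1) (u i) x * v i x)
  linarith

theorem TB.scale (h : TB r ρ Q u w) (hu : ∀ i, Sm (u i)) (h0 : ∀ i, 0 ≤ w i) {c : ℝ} (hc : 0 < c)
    (hc1 : c ≤ 1) : TB r (c ^ (r + 1) * ρ) Q (fun i x => u i (c * x)) w := by
  obtain ⟨C, hC, h⟩ := h
  refine ⟨C, hC, fun i B hB x => ?_⟩
  rw [iter_scale (hu i), abs_mul, abs_of_pos (by positivity)]
  have := mul_le_mul_of_nonneg_left (h i B hB (c * x)) (by positivity : 0 ≤ c ^ (r + 1))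
  have h2 : c ^ (r + 1) * (C * w i) ≤ C * w i :=
    mul_le_of_le_one_left (mul_nonneg hC (h0 i)) (pow_le_one₀ hc.le hc1)
  linarith

theorem TB.shift (h : TB r ρ Q u w) (t : ℝ) : TB r ρ Q (fun i x => u i (x - t)) w := by
  obtain ⟨C, hC, h⟩ := h
  refine ⟨C, hC, fun i B hB x => ?_⟩
  rw [iteratedDeriv_comp_sub_const]
  exact h i B hB _
end tb

theorem kap_abs (x : ℝ) : |kap x| ≤ 1 := by
  have := chi_nonneg x
  have := chi_nonneg (x + 1)
  have := chi_le_one x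
  have := chi_le_one (x + 1)
  rw [kap, abs_le]; constructor <;> linarith

theorem TB.Lam {A r : ℕ} {L : ι → ℝ → ℝ} {h : ι → Equiv.Perm ℝ} {w : ι → ℝ} (hA : 0 < A)
    (hL : ∀ i, IsState (L i)) (bL : BO r L w) (hh : ∀ i, h i ∈ Dif)
    (bh : BO (r + 1) (fun i => lg (h i)) w) (hw : ∀ i, w i ≤ 1)
    (H : ∀ i, Adm A (fP (L i) * h i)) (h2 : ∀ i x, |deriv (h i) x| ≤ 2)
    (b2 : ∀ i x, |deriv ((bP (L i))⁻¹ : Equiv.Perm ℝ) x| ≤ 2) :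
    TB r ((3 * A + 4) * (8 / A) ^ (r + 1)) L (fun i => Lam A (fP (L i) * h i)) w := by
  have hAR : (0:ℝ) < A := by exact_mod_cast hA
  have hA1 : (1:ℝ) ≤ A := by exact_mod_cast hA
  have bbi := (BO.bP hL bL).lginv (fun i => bP_mem (hL i)) hw
  have m1 : TB r 1 L (fun i x => L i x * kap x) w := TB.mulb bL (kap_BO _) (fun _ x => kap_abs x)
  have mb : BO r (fun i x => L i x * kap x) w := bL.mul1 (kap_BO _)
  have m2 : TB r (1 * 2 ^ (r + 1)) L (fun i => lg (fP (L i))) w :=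
    (m1.comp mb (p := fun i => (bP (L i))⁻¹) (fun i => inv_mem (bP_mem (hL i))) b2
      (bbi.dexp (fun i => inv_mem (bP_mem (hL i))) hw)).congr fun i x => by
        rw [lg_fP (hL i), mul_comm]
  have bf := BO.fP hL bL hw
  have hf := fun i => fP_mem (hL i)
  have m3 : TB r (1 * 2 ^ (r + 1) * 2 ^ (r + 1) + 0) L (fun i => lg (fP (L i) * h i)) w :=
    ((m2.comp bf hh h2 (((bh.le (by omega)).dexp hh hw))).add (TB.ofBO bh)
      (fun i => (Sm_lg (hf i)).comp (Dif.sm (hh i))) (fun i => Sm_lg (hh i))).congr fun i x => by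
        rw [lg_mul (hf i) (hh i)]
  have ba : BO r (fun i => lg (fP (L i) * h i)) w := bf.lgmul (bh.le (by omega)) hf hh hw
  have hm := fun i => (H i).mem
  have m4 : TB r (((A:ℝ)⁻¹) ^ (r + 1) * (1 * 2 ^ (r + 1) * 2 ^ (r + 1) + 0)) L
      (fun i => lg (aA A (fP (L i) * h i))) w :=
    (m3.scale (fun i => Sm_lg (hm i)) bL.1 (inv_pos.2 hAR) (inv_le_one_of_one_le₀ hA1)).congr
      fun i x => by rw [lg_aA hA (hm i), div_eq_inv_mul]
  have key : ∀ j ≤ 3 * A + 4, TB r (j * (8 / A) ^ (r + 1)) L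
      (fun i => lg (cR A (fP (L i) * h i) j)) w := by
    intro j
    induction j with
    | zero =>
      intro _
      have := (TB.ofBO (Q := L) (BO.zero (r := r + 1) bL.1)).congr (v :=
        (fun i => lg (cR A (fP (L i) * h i) 0))) fun i x => by simp only [cR, lg_one]
      simpa using this
    | succ j ih =>
      intro hj
      have hc := fun i => cR_mem hA (hm i) j
      have n1 := m4.comp (ba.aA hA hm) hc (fun i => (H i).cR_deriv (by omega))
        ((ba.cR hA hm hw j).dexp hc hw)
      have n2 := ((n1.add (ih (by omega))
        (fun i => (Sm_lg (aA_mem hA (hm i))).comp (Dif.sm (hc i))) (fun i => Sm_lg (hc i))).shift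
          1).congr (v := (fun i => lg (cR A (fP (L i) * h i) (j + 1)))) fun i x => by
            rw [lg_cR_succ hA (hm i)]
      convert n2 using 1
      have : (8 / (A:ℝ)) ^ (r + 1) = (A:ℝ)⁻¹ ^ (r + 1) * 2 ^ (r + 1) * 2 ^ (r + 1) * 2 ^ (r + 1) := by
        rw [← mul_pow, ← mul_pow, ← mul_pow]; congr 1; ring
      rw [this]; push_cast; ring
  obtain ⟨C, hC, h'⟩ := key (3 * A + 4) le_rfl
  refine ⟨C, hC, fun i B hB x => ?_⟩
  rw [(H i).Lam_iter]
  have := h' i B hB (3 * A + 1 + Int.fract x)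
  push_cast at this
  exact this
end

noncomputable section
variable {ι : Type*}

theorem tsum_sm {f : ℕ → ℝ → ℝ} (hf : ∀ i, Sm (f i))
    (h : ∀ j, ∃ v : ℕ → ℝ, Summable v ∧ ∀ i x, |iteratedDeriv j (f i) x| ≤ v i) :
    Sm (fun x => ∑' i, f i x) ∧
      ∀ j x, HasSum (fun i => iteratedDeriv j (f i) x) (iteratedDeriv j (fun x => ∑' i, f i x) x) := by
  choose v hv hb using h
  have hb' : ∀ (k : ℕ) (i : ℕ) (x : ℝ), (k : ℕ∞) ≤ (⊤ : ℕ∞) → ‖iteratedFDeriv ℝ k (f i) x‖ ≤ v k i := by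
    intro k i x _
    rw [norm_iteratedFDeriv_eq_norm_iteratedDeriv]; exact hb k i x
  refine ⟨contDiff_tsum hf (fun k _ => hv k) hb', fun j x => ?_⟩
  have hs : Summable fun i => iteratedDeriv j (f i) x :=
    Summable.of_norm_bounded (hv j) fun i => hb j i x
  have e : iteratedDeriv j (fun x => ∑' i, f i x) x = ∑' i, iteratedDeriv j (f i) x := by
    rw [iteratedDeriv, iteratedFDeriv_tsum hf (fun k _ => hv k) hb' (k := j) le_top]
    have hs' : Summable fun i => iteratedFDeriv ℝ j (f i) x :=
      Summable.of_norm_bounded (hv j) fun i => hb' j i x le_top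
    simp only [iteratedDeriv]
    exact (ContinuousMultilinearMap.apply ℝ (fun _ : Fin j => ℝ) ℝ (fun _ => 1)).map_tsum hs'
  rw [e]
  exact hs.hasSum

/-- Landau interpolation -/
theorem landau {g : ℝ → ℝ} (hg : Sm g) {a b t : ℝ} (ht : 0 < t) (h0 : ∀ x, |g x| ≤ a * (t * t))
    (h2 : ∀ x, |deriv (deriv g) x| ≤ b) (x : ℝ) : |deriv g x| ≤ (2 * a + b) * t := by
  obtain ⟨c, hc, e⟩ := exists_deriv_eq_slope g (show x < x + t by linarith)
    hg.continuous.continuousOn hg.diff.differentiableOn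
  have h3 := mvt_bd hg.der h2 x c
  have hb : 0 ≤ b := (abs_nonneg _).trans (h2 x)
  have h4 : |x - c| ≤ t := by rw [abs_le]; constructor <;> linarith [hc.1, hc.2]
  have h5 : |deriv g c| ≤ 2 * a * t := by
    rw [e, add_sub_cancel_left, abs_div, abs_of_pos ht, div_le_iff₀ ht]
    have := abs_sub (g (x + t)) (g x)
    have := h0 x
    have := h0 (x + t)
    nlinarith
  have h6 := mul_le_mul_of_nonneg_left h4 hb
  have := abs_sub_abs_le_abs_sub (deriv g x) (deriv g c)
  linarith

theorem per_bd {u : ℝ → ℝ} (hu : Sm u) (hp : Function.Periodic u 1) {d : ℝ}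
    (h : ∀ x, |deriv u x| ≤ d) {x0 : ℝ} (h0 : u x0 = 0) (x : ℝ) : |u x| ≤ d := by
  have hd : 0 ≤ d := (abs_nonneg _).trans (h x)
  have e : u x = u (x0 + Int.fract (x - x0)) := by
    have := hp.sub_int_mul_eq (x := x) ⌊x - x0⌋
    rw [← this]; congr 1; rw [Int.fract]; ring
  have := mvt_bd hu h (x0 + Int.fract (x - x0)) x0
  rw [← e, h0, sub_zero, add_sub_cancel_left, abs_of_nonneg (Int.fract_nonneg (x - x0))] at this
  have := mul_le_of_le_one_right hd (Int.fract_lt_one (x - x0)).le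
  linarith

theorem per_der {u : ℝ → ℝ} (hp : Function.Periodic u 1) : Function.Periodic (deriv u) 1 := by
  intro x
  have : (fun y => u (y + 1)) = u := funext hp
  rw [← deriv_comp_add_const, this]

theorem state_diff {L M : ℝ → ℝ} (hL : IsState L) (hM : IsState M) {d : ℝ}
    (h : ∀ x, |iteratedDeriv 2 (fun x => M x - L x) x| ≤ d) :
    ∀ j ≤ 2, ∀ x, |iteratedDeriv j (fun x => M x - L x) x| ≤ d := by
  set u : ℝ → ℝ := fun x => M x - L x with hu
  have su : Sm u := hM.1.sub hL.1
  have pu : Function.Periodic u 1 := fun x => by simp only [hu, hL.2.1 x, hM.2.1 x]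
  rw [iter2] at h
  have h1 : ∀ x, |deriv u x| ≤ d := by
    obtain ⟨c, -, hc⟩ := exists_deriv_eq_zero (f := u) zero_lt_one su.continuous.continuousOn
      (by simpa using (pu 0).symm)
    exact per_bd su.der (per_der pu) h hc
  have hz : ∃ x0, u x0 = 0 := by
    have cL := hL.1.continuous
    have cM := hM.1.continuous
    by_contra hne
    push Not at hne
    have iL : IntervalIntegrable (fun x => Real.exp (L x)) MeasureTheory.volume 0 1 :=
      (Real.continuous_exp.comp cL).intervalIntegrable _ _
    have iM : IntervalIntegrable (fun x => Real.exp (M x)) MeasureTheory.volume 0 1 :=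
      (Real.continuous_exp.comp cM).intervalIntegrable _ _
    have sgn : (∀ x, 0 < u x) ∨ (∀ x, u x < 0) := by
      by_contra hc
      push Not at hc
      obtain ⟨⟨a, ha⟩, ⟨b, hb⟩⟩ := hc
      obtain ⟨c, hc⟩ := mem_range_of_exists_le_of_exists_ge su.continuous ⟨a, ha⟩ ⟨b, hb⟩
      exact hne c hc
    rcases sgn with s | s
    · have := intervalIntegral.integral_lt_integral_of_continuousOn_of_le_of_exists_lt
        (f := fun x => Real.exp (L x)) (g := fun x => Real.exp (M x)) zero_lt_one
        (Real.continuous_exp.comp cL).continuousOn (Real.continuous_exp.comp cM).continuousOn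
        (fun x _ => Real.exp_le_exp.2 (by have := s x; simp only [hu] at this; linarith))
        ⟨0, ⟨le_rfl, zero_le_one⟩, Real.exp_lt_exp.2 (by have := s 0; simp only [hu] at this; linarith)⟩
      rw [hL.2.2, hM.2.2] at this
      exact lt_irrefl _ this
    · have := intervalIntegral.integral_lt_integral_of_continuousOn_of_le_of_exists_lt
        (f := fun x => Real.exp (M x)) (g := fun x => Real.exp (L x)) zero_lt_one
        (Real.continuous_exp.comp cM).continuousOn (Real.continuous_exp.comp cL).continuousOn
        (fun x _ => Real.exp_le_exp.2 (by have := s x; simp only [hu] at this; linarith))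
        ⟨0, ⟨le_rfl, zero_le_one⟩, Real.exp_lt_exp.2 (by have := s 0; simp only [hu] at this; linarith)⟩
      rw [hL.2.2, hM.2.2] at this
      exact lt_irrefl _ this
  obtain ⟨x0, hx0⟩ := hz
  intro j hj x
  interval_cases j
  · simpa using per_bd su pu h1 hx0 x
  · simpa using h1 x
  · rw [iter2]; exact h x

/-- the maps `fP L * h` depend nicely on `L` -/
theorem DP_a {L M : ι → ℝ → ℝ} {h : ι → Equiv.Perm ℝ} {d : ι → ℝ}
    (hL : ∀ i, IsState (L i)) (hM : ∀ i, IsState (M i)) (hh : ∀ i, h i ∈ Dif)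
    (bL : BO 3 L (fun _ => 1)) (bM : BO 2 M (fun _ => 1))
    (bh : BO 2 (fun i => lg (h i)) (fun _ => 1)) (hd : ∀ i, d i ≤ 1)
    (hLM : BO 2 (fun i x => M i x - L i x) d) :
    DP 2 (fun i => fP (M i) * h i) (fun i => fP (L i) * h i) d :=
  (DP.fP hL hM bL bM hd hLM).mul (DP.refl hLM.1) (fun i => fP_mem (hL i)) (fun i => fP_mem (hM i))
    hh hh (BO.fP hL bL (by simp)) bh bh hd

theorem exists_C0 : ∃ C0 : ℝ, 0 ≤ C0 ∧ ∀ (L M : ℝ → ℝ) (h : Equiv.Perm ℝ) (d : ℝ), IsState L →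
    IsState M → h ∈ Dif → (∀ j ≤ 3, ∀ x, |iteratedDeriv j L x| ≤ 1) →
    (∀ j ≤ 2, ∀ x, |iteratedDeriv j M x| ≤ 1) → (∀ j ≤ 2, ∀ x, |iteratedDeriv j (lg h) x| ≤ 1) →
    0 ≤ d → d ≤ 1 → (∀ j ≤ 2, ∀ x, |iteratedDeriv j (fun x => M x - L x) x| ≤ d) →
    ∀ x, |iteratedDeriv 2 (fun x => lg (fP M * h) x - lg (fP L * h) x) x| ≤ C0 * d := by
  let I := {q : (ℝ → ℝ) × (ℝ → ℝ) × Equiv.Perm ℝ × ℝ // IsState q.1 ∧ IsState q.2.1 ∧ q.2.2.1 ∈ Dif ∧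
    (∀ j ≤ 3, ∀ x, |iteratedDeriv j q.1 x| ≤ 1) ∧ (∀ j ≤ 2, ∀ x, |iteratedDeriv j q.2.1 x| ≤ 1) ∧
    (∀ j ≤ 2, ∀ x, |iteratedDeriv j (lg q.2.2.1) x| ≤ 1) ∧ 0 ≤ q.2.2.2 ∧ q.2.2.2 ≤ 1 ∧
    (∀ j ≤ 2, ∀ x, |iteratedDeriv j (fun x => q.2.1 x - q.1 x) x| ≤ q.2.2.2)}
  have := DP_a (ι := I) (L := fun q => q.1.1) (M := fun q => q.1.2.1) (h := fun q => q.1.2.2.1)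
    (d := fun q => q.1.2.2.2) (fun q => q.2.1) (fun q => q.2.2.1) (fun q => q.2.2.2.1)
    ⟨by simp, fun q => q.2.1.1, 1, zero_le_one, fun q j hj x => by simpa using q.2.2.2.2.1 j hj x⟩
    ⟨by simp, fun q => q.2.2.1.1, 1, zero_le_one, fun q j hj x => by simpa using q.2.2.2.2.2.1 j hj x⟩
    ⟨by simp, fun q => Sm_lg q.2.2.2.1, 1, zero_le_one,
      fun q j hj x => by simpa using q.2.2.2.2.2.2.1 j hj x⟩
    (fun q => q.2.2.2.2.2.2.2.2.1)
    ⟨fun q => q.2.2.2.2.2.2.2.1, fun q => q.2.2.1.1.sub q.2.1.1, 1, zero_le_one,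
      fun q j hj x => by simpa using q.2.2.2.2.2.2.2.2.2 j hj x⟩
  obtain ⟨⟨_, _, C, hC, h⟩, _⟩ := this
  exact ⟨C, hC, fun L M p d h1 h2 h3 h4 h5 h6 h7 h8 h9 x =>
    h ⟨(L, M, p, d), h1, h2, h3, h4, h5, h6, h7, h8, h9⟩ 2 le_rfl x⟩

theorem exp_half_le {x : ℝ} (h : x ≤ 1 / 2) : Real.exp x ≤ 2 := by
  have := Real.log_two_gt_d9
  calc _ ≤ Real.exp (Real.log 2) := Real.exp_le_exp.2 (by linarith)
    _ = 2 := Real.exp_log (by norm_num)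

theorem deriv_le2 {p : Equiv.Perm ℝ} (hp : p ∈ Dif) (h : ∀ x, |lg p x| ≤ 1 / 2) (x : ℝ) :
    |deriv p x| ≤ 2 := by
  rw [abs_of_pos (Dif.pos hp x), ← exp_lg hp]
  exact exp_half_le (abs_le.1 (h x)).2

theorem exists_adm {A : ℕ} (hA : 0 < A) : ∃ η : ℝ, 0 < η ∧ ∀ (L : ℝ → ℝ) (h : Equiv.Perm ℝ),
    IsState L → h ∈ Dif → (∀ y ≤ 0, h y = y) → (∀ y, 3 ≤ y → h y = y) → (∀ x, |L x| ≤ η) →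
    (∀ x, |lg h x| ≤ η) → Adm A (fP L * h) ∧ (∀ x, |deriv h x| ≤ 2) ∧
      (∀ x, |deriv ((bP L)⁻¹ : Equiv.Perm ℝ) x| ≤ 2) := by
  have hAR : (0:ℝ) < A := by exact_mod_cast hA
  have hA1 : (1:ℝ) ≤ A := by exact_mod_cast hA
  refine ⟨1 / (24 * A * (3 * A + 4)), by positivity, fun L h hL hh h0 h3 bL bh => ?_⟩
  set η : ℝ := 1 / (24 * A * (3 * A + 4)) with hη
  have e1 : η * (24 * A * (3 * A + 4)) = 1 := by rw [hη]; field_simp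
  have hη0 : 0 < η := by positivity
  have e2 : η ≤ 1 / 8 := by
    rw [hη]; apply one_div_le_one_div_of_le (by norm_num); nlinarith
  have hb := bP_mem hL
  have lb : ∀ x, |lg (bP L) x| ≤ η := fun x => by
    rw [lg_bP hL, abs_mul]
    exact (mul_le_of_le_one_left (abs_nonneg _) (chi_abs x)).trans (bL x)
  have hb2 : bP L 2 ≤ 3 := by
    have := mvt_bd (Dif.sm hb) (deriv_le2 hb fun x => (lb x).trans (by linarith)) 2 1
    rw [bP_le hL le_rfl] at this
    have := (abs_le.1 this).2
    norm_num at this; linarith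
  have hm : fP L * h ∈ Dif := mul_mem (fP_mem hL) hh
  have la : ∀ x, |lg (fP L * h) x| ≤ 2 * η := fun x => by
    rw [lg_mul (fP_mem hL) hh, lg_fP hL]
    refine (abs_add_le _ _).trans ?_
    rw [abs_mul]
    have := mul_le_of_le_one_left (abs_nonneg (L ((bP L)⁻¹ (h x)))) (kap_abs ((bP L)⁻¹ (h x)))
    linarith [bL ((bP L)⁻¹ (h x)), bh x]
  have le0 : ∀ y ≤ 0, (fP L * h) y = y := fun y hy => by
    rw [Equiv.Perm.mul_apply, h0 y hy, fP_le hL hy]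
  have ge3 : ∀ y, 3 ≤ y → (fP L * h) y = y := fun y hy => by
    rw [Equiv.Perm.mul_apply, h3 y hy, fP_ge hL hb2 hy]
  refine ⟨⟨hA, hm, le0, ge3, fun y => ?_, fun y => ?_⟩, deriv_le2 hh fun x => (bh x).trans (by linarith),
    deriv_le2 (inv_mem hb) fun x => ?_⟩
  · have hdisp : |(fP L * h) y - y| ≤ 12 * η := by
      rcases le_total y 0 with hy | hy
      · rw [le0 y hy]; simp; positivity
      rcases le_total 3 y with hy3 | hy3
      · rw [ge3 y hy3]; simp; positivity
      have hd : ∀ x, |deriv (fun x => (fP L * h) x - x) x| ≤ 4 * η := fun x => by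
        have : deriv (fun x => (fP L * h) x - x) x = deriv (fP L * h) x - 1 := by
          rw [deriv_fun_sub ((Dif.sm hm).diff x) differentiableAt_fun_id]; simp
        rw [this, ← exp_lg hm]
        have h2 : |lg (fP L * h) x| ≤ 1 := (la x).trans (by linarith)
        have := Real.abs_exp_sub_one_le h2
        linarith [la x]
      have := mvt_bd ((Dif.sm hm).sub contDiff_id : Sm fun x => (fP L * h) x - x) hd y 0
      rw [le0 0 le_rfl, sub_self, sub_zero, sub_zero, abs_of_nonneg hy] at this
      nlinarith
    have := mul_le_mul_of_nonneg_left hdisp (by positivity : (0:ℝ) ≤ A * (3 * A + 4))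
    nlinarith
  · have := mul_le_mul_of_nonneg_right (la y) (by positivity : (0:ℝ) ≤ 3 * A + 4)
    nlinarith
  · rw [lg_inv hb, abs_neg]
    exact (lb _).trans (by linarith)
end

noncomputable section
variable {ι : Type*}

def stp (A : ℕ) (h : Equiv.Perm ℝ) (L : ℝ → ℝ) : ℝ → ℝ := Lam A (fP L * h)

def Bd (r : ℕ) (u : ℝ → ℝ) (c : ℝ) : Prop := ∀ j ≤ r, ∀ x, |iteratedDeriv j u x| ≤ c

theorem Bd.mono {r : ℕ} {u : ℝ → ℝ} {c d : ℝ} (h : Bd r u c) (hc : c ≤ d) : Bd r u d :=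
  fun j hj x => (h j hj x).trans hc
theorem Bd.zero {r : ℕ} {u : ℝ → ℝ} {c : ℝ} (h : Bd r u c) (x : ℝ) : |u x| ≤ c := by
  simpa using h 0 (Nat.zero_le _) x
theorem Bd.snoc {r : ℕ} {u : ℝ → ℝ} {c d : ℝ} (h : Bd r u c)
    (h' : ∀ x, |iteratedDeriv (r + 1) u x| ≤ d) (hc : c ≤ d) : Bd (r + 1) u d := by
  intro j hj x
  rcases Nat.lt_or_ge j (r + 1) with hl | hl
  · exact (h j (by omega) x).trans hc
  · obtain rfl : j = r + 1 := by omega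
    exact h' x
theorem BO.ofBd {r : ℕ} {u : ι → ℝ → ℝ} {w : ι → ℝ} {C : ℝ} (hw : ∀ i, 0 ≤ w i)
    (hu : ∀ i, Sm (u i)) (hC : 0 ≤ C) (h : ∀ i, Bd r (u i) (C * w i)) : BO r u w :=
  ⟨hw, hu, C, hC, h⟩

theorem iter_zero_fn (j : ℕ) (x : ℝ) : iteratedDeriv j (fun _ : ℝ => (0:ℝ)) x = 0 := by
  have h : iteratedDeriv j (fun _ : ℝ => (0:ℝ)) = fun _ => 0 := by
    induction j with
    | zero => simp
    | succ j ih => rw [iteratedDeriv_succ, ih]; simp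
  rw [h]

theorem contr {h : ι → Equiv.Perm ℝ} {w : ι → ℝ} (hh : ∀ i, h i ∈ Dif)
    (h0 : ∀ i, ∀ y ≤ 0, h i y = y) (h3 : ∀ i, ∀ y, 3 ≤ y → h i y = y)
    (bh : BO 3 (fun i => lg (h i)) w) :
    ∃ A : ℕ, 100 ≤ A ∧ ∃ C1 C3 δ : ℝ, 0 ≤ C1 ∧ 0 ≤ C3 ∧ 0 < δ ∧ δ ≤ 1 ∧ C1 * δ ≤ 1 / 2 ∧
      (∀ i L, w i ≤ δ → IsState L → Bd 2 L (2 * C1 * w i) → Adm A (fP L * h i) ∧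
        (∀ x, |deriv (h i) x| ≤ 2) ∧ ∀ x, |deriv ((bP L)⁻¹ : Equiv.Perm ℝ) x| ≤ 2) ∧
      (∀ i, w i ≤ δ → Bd 2 (stp A (h i) fun _ => 0) (C1 * w i)) ∧
      (∀ i L B, w i ≤ δ → IsState L → Bd 2 L (2 * C1 * w i) →
        (∀ x, |iteratedDeriv 3 L x| ≤ B) →
          ∀ x, |iteratedDeriv 3 (stp A (h i) L) x| ≤ B / 4 + C3 * w i) ∧
      (∀ i L M d, w i ≤ δ → IsState L → IsState M → Bd 2 L (2 * C1 * w i) →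
        (∀ x, |iteratedDeriv 3 L x| ≤ 2 * C3 * w i) → Bd 2 M (2 * C1 * w i) →
        0 ≤ d → d ≤ 1 → Bd 2 (fun x => M x - L x) d →
        Bd 2 (fun x => stp A (h i) M x - stp A (h i) L x) (d / 2)) := by
  obtain ⟨C0, hC0, key0⟩ := exists_C0
  obtain ⟨A, hA⟩ := exists_nat_ge (16 * C0 + 100)
  have hA100 : (100:ℝ) ≤ A := by linarith
  have hA' : 100 ≤ A := by exact_mod_cast hA100
  have hAp : 0 < A := by omega
  have hAR : (0:ℝ) < A := by linarith
  obtain ⟨η0, hη0, adm⟩ := exists_adm hAp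
  obtain ⟨η, hη, hη1, hηη⟩ : ∃ η : ℝ, 0 < η ∧ η ≤ 1 / 2 ∧ η ≤ η0 :=
    ⟨min η0 (1 / 2), by positivity, min_le_right _ _, min_le_left _ _⟩
  obtain ⟨hw, _, Ch, hCh, hbh⟩ := bh
  -- restricted index types carry the bound on `h`
  have bhr : ∀ {κ : Type _} (e : κ → ι), BO 3 (fun k => lg (h (e k))) (fun k => w (e k)) :=
    fun e => ⟨fun k => hw _, fun k => Sm_lg (hh _), Ch, hCh, fun k j hj x => hbh _ j hj x⟩
  -- first iterate
  obtain ⟨C1, hC1, k1⟩ : ∃ C1 : ℝ, 0 ≤ C1 ∧ ∀ i, Ch * w i ≤ η → w i ≤ 1 →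
      Bd 2 (stp A (h i) fun _ => 0) (C1 * w i) := by
    let I := {i : ι // Ch * w i ≤ η ∧ w i ≤ 1}
    have b1 := BO.fP (ι := I) (s := 2) (L := fun _ _ => 0) (w := fun i => w i.1)
      (fun _ => IsState.zero) (BO.zero fun i => hw _) (fun i => i.2.2)
    have b2 := b1.lgmul ((bhr (fun i : I => i.1)).le (by omega)) (fun i => fP_mem IsState.zero)
      (fun i => hh _) (fun i => i.2.2)
    obtain ⟨_, _, C, hC, hb⟩ := b2.Lam (A := A) (fun i => (adm _ _ IsState.zero (hh i.1) (h0 _) (h3 _)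
      (by simp; linarith) fun x => by
        have := hbh i.1 0 (by omega) x
        rw [iteratedDeriv_zero] at this
        exact (this.trans i.2.1).trans hηη).1) hAp (fun i => i.2.2)
    exact ⟨C, hC, fun i hi1 hi2 => hb ⟨i, hi1, hi2⟩⟩
  have adm1 : ∀ i L, Ch * w i ≤ η → 2 * C1 * w i ≤ η → IsState L → Bd 2 L (2 * C1 * w i) →
      Adm A (fP L * h i) ∧
        (∀ x, |deriv (h i) x| ≤ 2) ∧ ∀ x, |deriv ((bP L)⁻¹ : Equiv.Perm ℝ) x| ≤ 2 := by
    intro i L hi1 hi2 hL bL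
    refine adm L (h i) hL (hh i) (h0 i) (h3 i) (fun x => (bL.zero x).trans (hi2.trans hηη))
      fun x => ?_
    have := hbh i 0 (by omega) x
    rw [iteratedDeriv_zero] at this
    exact (this.trans hi1).trans hηη
  -- third derivative
  obtain ⟨C3, hC3, k3⟩ : ∃ C3 : ℝ, 0 ≤ C3 ∧ ∀ i L B, Ch * w i ≤ η → w i ≤ 1 → 2 * C1 * w i ≤ η →
      IsState L → Bd 2 L (2 * C1 * w i) → (∀ x, |iteratedDeriv 3 L x| ≤ B) →
          ∀ x, |iteratedDeriv 3 (stp A (h i) L) x| ≤ B / 4 + C3 * w i := by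
    let I := {q : ι × (ℝ → ℝ) // Ch * w q.1 ≤ η ∧ w q.1 ≤ 1 ∧ 2 * C1 * w q.1 ≤ η ∧
      IsState q.2 ∧ Bd 2 q.2 (2 * C1 * w q.1)}
    have ad := fun q : I => adm1 q.1.1 q.1.2 q.2.1 q.2.2.2.1 q.2.2.2.2.1 q.2.2.2.2.2
    have := TB.Lam (ι := I) (A := A) (r := 2) (L := fun q => q.1.2) (h := fun q => h q.1.1)
      (w := fun q => w q.1.1) hAp (fun q => q.2.2.2.2.1)
      (BO.ofBd (fun q => hw _) (fun q => q.2.2.2.2.1.1) (by positivity) (fun q => q.2.2.2.2.2))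
      (fun q => hh _) (bhr _) (fun q => q.2.2.1) (fun q => (ad q).1) (fun q => (ad q).2.1)
      (fun q => (ad q).2.2)
    obtain ⟨C, hC, hb⟩ := this
    refine ⟨C, hC, fun i L B hi1 hi2 hi3 hL bL hB x => ?_⟩
    have h1 := hb ⟨(i, L), hi1, hi2, hi3, hL, bL⟩ B hB x
    refine h1.trans ?_
    have hB0 : 0 ≤ B := (abs_nonneg _).trans (hB 0)
    have : (3 * (A:ℝ) + 4) * (8 / A) ^ (2 + 1) ≤ 1 / 4 := by
      rw [div_pow, mul_div_assoc', div_le_iff₀ (by positivity)]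
      norm_num
      nlinarith [sq_nonneg ((A:ℝ) - 100), mul_nonneg hAR.le hAR.le]
    have := mul_le_mul_of_nonneg_right this hB0
    simp only
    linarith
  -- contraction
  obtain ⟨C4, hC4, k4⟩ : ∃ C4 : ℝ, 0 ≤ C4 ∧ ∀ i L M d, Ch * w i ≤ η → w i ≤ 1 → 2 * C1 * w i ≤ η →
      2 * C3 * w i ≤ η →
      IsState L → IsState M → Bd 2 L (2 * C1 * w i) →
        (∀ x, |iteratedDeriv 3 L x| ≤ 2 * C3 * w i) → Bd 2 M (2 * C1 * w i) →
        0 ≤ d → d ≤ 1 → Bd 2 (fun x => M x - L x) d →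
        ∀ x, |iteratedDeriv 2 (fun x => stp A (h i) M x - stp A (h i) L x) x| ≤
          d / 4 + C4 * (d * w i) := by
    let I := {q : ι × (ℝ → ℝ) × (ℝ → ℝ) × ℝ // Ch * w q.1 ≤ η ∧ w q.1 ≤ 1 ∧ 2 * C1 * w q.1 ≤ η ∧
      2 * C3 * w q.1 ≤ η ∧ IsState q.2.1 ∧ IsState q.2.2.1 ∧ Bd 2 q.2.1 (2 * C1 * w q.1) ∧
        (∀ x, |iteratedDeriv 3 q.2.1 x| ≤ 2 * C3 * w q.1) ∧ Bd 2 q.2.2.1 (2 * C1 * w q.1) ∧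
        0 ≤ q.2.2.2 ∧ q.2.2.2 ≤ 1 ∧ Bd 2 (fun x => q.2.2.1 x - q.2.1 x) q.2.2.2}
    let i' : I → ι := fun q => q.1.1
    let L' : I → ℝ → ℝ := fun q => q.1.2.1
    let M' : I → ℝ → ℝ := fun q => q.1.2.2.1
    let d' : I → ℝ := fun q => q.1.2.2.2
    have sL : ∀ q, IsState (L' q) := fun q => q.2.2.2.2.2.1
    have sM : ∀ q, IsState (M' q) := fun q => q.2.2.2.2.2.2.1
    have cL : ∀ q, Bd 2 (L' q) (2 * C1 * w (i' q)) := fun q => q.2.2.2.2.2.2.2.1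
    have cL3 : ∀ q x, |iteratedDeriv 3 (L' q) x| ≤ 2 * C3 * w (i' q) := fun q => q.2.2.2.2.2.2.2.2.1
    have cM : ∀ q, Bd 2 (M' q) (2 * C1 * w (i' q)) := fun q => q.2.2.2.2.2.2.2.2.2.1
    have d0 : ∀ q, 0 ≤ d' q := fun q => q.2.2.2.2.2.2.2.2.2.2.1
    have d1 : ∀ q, d' q ≤ 1 := fun q => q.2.2.2.2.2.2.2.2.2.2.2.1
    have cd : ∀ q, Bd 2 (fun x => M' q x - L' q x) (d' q) := fun q => q.2.2.2.2.2.2.2.2.2.2.2.2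
    have w1 : ∀ q, w (i' q) ≤ 1 := fun q => q.2.2.1
    have bL2 : BO 2 L' (fun q => w (i' q)) :=
      BO.ofBd (fun q => hw _) (fun q => (sL q).1) (by positivity) cL
    have bL : BO 3 L' (fun q => w (i' q)) := bL2.top cL3
    have bM : BO 2 M' (fun q => w (i' q)) :=
      BO.ofBd (fun q => hw _) (fun q => (sM q).1) (by positivity) cM
    have bh' := bhr i'
    have bLM : BO 2 (fun q x => M' q x - L' q x) d' :=
      BO.ofBd d0 (fun q => (sM q).1.sub (sL q).1) zero_le_one (fun q => by rw [one_mul]; exact cd q)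
    have dp := DP_a sL sM (fun q => hh (i' q)) (bL.one w1) (bM.one w1) ((bh'.one w1).le (by omega))
      d1 bLM
    have admL := fun q : I => (adm1 _ _ q.2.1 q.2.2.2.1 (sL q) (cL q)).1
    have admM := fun q : I => (adm1 _ _ q.2.1 q.2.2.2.1 (sM q) (cM q)).1
    have ba : BO 3 (fun q => lg (fP (L' q) * h (i' q))) (fun q => w (i' q)) :=
      (BO.fP sL bL w1).lgmul bh' (fun q => fP_mem (sL q)) (fun q => hh _) w1
    have ba' : BO 2 (fun q => lg (fP (M' q) * h (i' q))) (fun q => w (i' q)) :=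
      (BO.fP sM bM w1).lgmul (bh'.le (by omega)) (fun q => fP_mem (sM q)) (fun q => hh _) w1
    obtain ⟨C, hC, hb⟩ := sharp_cR hAp dp (fun q => (admL q).mem) (fun q => (admM q).mem) ba ba' d1 w1
      (C0 := C0) (fun q x => key0 (L' q) (M' q) (h (i' q)) (d' q) (sL q) (sM q) (hh _)
        (((cL q).mono (q.2.2.2.1.trans (by linarith))).snoc (d := 1) (fun x => (cL3 q x).trans
          (q.2.2.2.2.1.trans (by linarith))) le_rfl)
        ((cM q).mono (q.2.2.2.1.trans (by linarith)))
        (fun j hj x => (hbh (i' q) j (by omega) x).trans (q.2.1.trans (by linarith)))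
        (d0 q) (d1 q) (cd q) x) (3 * A + 4)
    refine ⟨C, hC, fun i L M d z1 z2 z3 z4 z5 z6 z7 z8 z9 z10 z11 z12 x => ?_⟩
    let q : I := ⟨(i, L, M, d), z1, z2, z3, z4, z5, z6, z7, z8, z9, z10, z11, z12⟩
    have hq := hb q (3 * A + 1 + Int.fract x)
    have aL : Adm A (fP L * h i) := admL q
    have aM : Adm A (fP M * h i) := admM q
    have e : iteratedDeriv 2 (fun x => stp A (h i) M x - stp A (h i) L x) x =
        iteratedDeriv 2 (fun x => lg (cR A (fP (M' q) * h (i' q)) (3 * A + 4)) x -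
          lg (cR A (fP (L' q) * h (i' q)) (3 * A + 4)) x) (3 * A + 1 + Int.fract x) := by
      rw [iter_sub (Sm_lg (cR_mem hAp aM.mem _)) (Sm_lg (cR_mem hAp aL.mem _))]
      have := iter_sub aM.Lam_sm aL.Lam_sm 2 x
      rw [aM.Lam_iter, aL.Lam_iter] at this
      exact this
    rw [e]
    refine hq.trans ?_
    have : ((3 * A + 4 : ℕ) : ℝ) * (C0 * d / A ^ 2) ≤ d / 4 := by
      push_cast
      rw [mul_div_assoc', div_le_div_iff₀ (by positivity) (by norm_num)]
      have t1 : (3 * (A:ℝ) + 4) * C0 * 4 ≤ A ^ 2 := by nlinarith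
      nlinarith [mul_le_mul_of_nonneg_right t1 z10]
    show _ * (C0 * d / A ^ 2) + C * (d * w i) ≤ _
    linarith
  refine ⟨A, hA', C1, C3, η / (Ch + 1 + 2 * C1 + 2 * C3 + C4 * 4), hC1, hC3, by positivity, ?_, ?_, ?_⟩
  · rw [div_le_iff₀ (by positivity)]; nlinarith
  · rw [mul_div_assoc', div_le_iff₀ (by positivity)]; nlinarith
  have sm : ∀ i, w i ≤ η / (Ch + 1 + 2 * C1 + 2 * C3 + C4 * 4) → Ch * w i ≤ η ∧ w i ≤ 1 ∧
      2 * C1 * w i ≤ η ∧ 2 * C3 * w i ≤ η ∧ C4 * w i ≤ 1 / 4 := by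
    intro i hi
    rw [le_div_iff₀ (by positivity)] at hi
    have := hw i
    have e1 := mul_nonneg this hCh
    have e2 := mul_nonneg this hC1
    have e3 := mul_nonneg this hC3
    have e4 := mul_nonneg this hC4
    refine ⟨?_, ?_, ?_, ?_, ?_⟩ <;> nlinarith
  refine ⟨fun i L hi hL bL => adm1 i L (sm i hi).1 (sm i hi).2.2.1 hL bL,
    fun i hi => k1 i (sm i hi).1 (sm i hi).2.1,
    fun i L B hi hL bL hB => k3 i L B (sm i hi).1 (sm i hi).2.1 (sm i hi).2.2.1 hL bL hB, ?_⟩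
  intro i L M d hi hL hM bL bL3 bM hd hd1 hLM
  obtain ⟨z1, z2, z3, z4, z5⟩ := sm i hi
  refine state_diff (adm1 i L z1 z3 hL bL).1.Lam_state (adm1 i M z1 z3 hM bM).1.Lam_state fun x => ?_
  refine (k4 i L M d z1 z2 z3 z4 hL hM bL bL3 bM hd hd1 hLM x).trans ?_
  nlinarith
end

noncomputable section
variable {ι : Type*}

theorem rho_le {A : ℕ} (hA : 100 ≤ A) (s : ℕ) : (3 * (A:ℝ) + 4) * (8 / A) ^ (s + 3) ≤ 1 / 4 := by
  have hA100 : (100:ℝ) ≤ A := by exact_mod_cast hA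
  have hAR : (0:ℝ) < A := by linarith
  have h1 : (8 / (A:ℝ)) ^ (s + 3) ≤ (8 / (A:ℝ)) ^ 3 :=
    pow_le_pow_of_le_one (by positivity) (by rw [div_le_one hAR]; linarith) (by omega)
  have : (3 * (A:ℝ) + 4) * (8 / A) ^ 3 ≤ 1 / 4 := by
    rw [div_pow, mul_div_assoc', div_le_iff₀ (by positivity)]
    norm_num
    nlinarith [sq_nonneg ((A:ℝ) - 100), mul_nonneg hAR.le hAR.le]
  have := mul_le_mul_of_nonneg_left h1 (by positivity : 0 ≤ 3 * (A:ℝ) + 4)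
  linarith

theorem fixpt {h : ι → Equiv.Perm ℝ} {w : ι → ℝ} (hh : ∀ i, h i ∈ Dif)
    (h0 : ∀ i, ∀ y ≤ 0, h i y = y) (h3 : ∀ i, ∀ y, 3 ≤ y → h i y = y)
    (bh : ∀ s, BO s (fun i => lg (h i)) w) :
    ∃ A : ℕ, 100 ≤ A ∧ ∃ δ : ℝ, 0 < δ ∧ δ ≤ 1 ∧ ∃ L : {i // w i ≤ δ} → ℝ → ℝ,
      (∀ i, IsState (L i) ∧ Adm A (fP (L i) * h i) ∧ stp A (h i) (L i) = L i) ∧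
      ∀ s, BO s L (fun i => w i) := by
  obtain ⟨A, hA, C1, C3, δ, hC1, hC3, hδ, hδ1, hCδ, adm, k1, k3, k4⟩ := contr hh h0 h3 (bh 3)
  have hAp : 0 < A := by omega
  have hw := (bh 0).1
  refine ⟨A, hA, δ, hδ, hδ1, ?_⟩
  let X : {i // w i ≤ δ} → ℕ → ℝ → ℝ := fun i k => (stp A (h i))^[k] fun _ => 0
  have X0 : ∀ i, X i 0 = fun _ => 0 := fun i => rfl
  have Xs : ∀ i k, X i (k + 1) = stp A (h i) (X i k) := fun i k =>
    Function.iterate_succ_apply' _ _ _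
  have hCw : ∀ i : {i // w i ≤ δ}, C1 * w i ≤ 1 / 2 := fun i =>
    (mul_le_mul_of_nonneg_left i.2 hC1).trans hCδ
  have inv : ∀ i k, IsState (X i k) ∧ Bd 2 (X i k) (2 * C1 * w i * (1 - (1 / 2) ^ k)) ∧
      (∀ x, |iteratedDeriv 3 (X i k) x| ≤ 2 * C3 * w i) ∧
      Bd 2 (fun x => X i (k + 1) x - X i k x) (C1 * w i * (1 / 2) ^ k) := by
    intro i k
    have hwi := hw i
    induction k with
    | zero =>
      refine ⟨IsState.zero, fun j _ x => ?_, fun x => ?_, ?_⟩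
      · rw [X0, iter_zero_fn]; simp
      · rw [X0, iter_zero_fn]; simp; positivity
      · have := k1 i i.2
        rw [← X0 i, ← Xs] at this
        simpa [X0] using this
    | succ k ih =>
      obtain ⟨s1, s2, s3, s4⟩ := ih
      have hle : ∀ m : ℕ, 2 * C1 * w i * (1 - (1 / 2) ^ m) ≤ 2 * C1 * w i := fun m => by
        have : (0:ℝ) ≤ (1 / 2) ^ m := by positivity
        exact mul_le_of_le_one_right (by positivity) (by linarith)
      have s2' := s2.mono (hle k)
      have a1 := adm i _ i.2 s1 s2'
      have t1 : IsState (X i (k + 1)) := by rw [Xs]; exact a1.1.Lam_state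
      have t2 : Bd 2 (X i (k + 1)) (2 * C1 * w i * (1 - (1 / 2) ^ (k + 1))) := by
        intro j hj x
        have e := s4 j hj x
        rw [iter_sub t1.1 s1.1] at e
        have := abs_sub_abs_le_abs_sub (iteratedDeriv j (X i (k + 1)) x) (iteratedDeriv j (X i k) x)
        have := s2 j hj x
        rw [pow_succ]
        nlinarith
      refine ⟨t1, t2, fun x => ?_, ?_⟩
      · have := k3 i _ _ i.2 s1 s2' s3 x
        rw [← Xs] at this
        have : 0 ≤ C3 * w i := mul_nonneg hC3 hwi
        linarith
      · have hp : (1 / 2 : ℝ) ^ k ≤ 1 := pow_le_one₀ (by norm_num) (by norm_num)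
        have := k4 i _ _ _ i.2 s1 t1 s2' s3 (t2.mono (hle _)) (by positivity)
          ((mul_le_of_le_one_right (mul_nonneg hC1 hwi) hp).trans ((hCw i).trans (by norm_num))) s4
        rw [← Xs, ← Xs] at this
        refine this.mono (le_of_eq ?_)
        rw [pow_succ]; ring
  have st := fun i k => (inv i k).1
  have bd2 : ∀ i k, Bd 2 (X i k) (2 * C1 * w i) := fun i k => (inv i k).2.1.mono (by
    have : (0:ℝ) ≤ (1 / 2) ^ k := by positivity
    exact mul_le_of_le_one_right (mul_nonneg (by positivity) (hw i)) (by linarith))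
  have ad := fun (i : {i // w i ≤ δ}) (k : ℕ) => adm i _ i.2 (st i k) (bd2 i k)
  have bdd : ∀ s, BO (s + 2) (fun q : {i // w i ≤ δ} × ℕ => X q.1 q.2) (fun q => w q.1) := by
    intro s
    induction s with
    | zero => exact BO.ofBd (fun q => hw _) (fun q => (st _ _).1) (by positivity) fun q => bd2 q.1 q.2
    | succ s ih =>
      obtain ⟨C, hC, hT⟩ := TB.Lam (h := fun q : {i // w i ≤ δ} × ℕ => h q.1) hAp
        (fun q => st q.1 q.2) ih (fun q => hh _) ((bh _).reindex _)
        (fun q => q.1.2.trans hδ1) (fun q => (ad q.1 q.2).1) (fun q => (ad q.1 q.2).2.1)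
        (fun q => (ad q.1 q.2).2.2)
      have key : ∀ i k x, |iteratedDeriv (s + 2 + 1) (X i k) x| ≤ 2 * C * w i := by
        intro i k
        have hCw := mul_nonneg hC (hw i)
        induction k with
        | zero => intro x; rw [X0, iter_zero_fn]; simp; linarith
        | succ k ihk =>
          intro x
          have e1 := hT (i, k) _ ihk x
          have e2 := mul_le_mul_of_nonneg_right (rho_le hA s) (by linarith : 0 ≤ 2 * C * w i)
          rw [Xs]
          refine e1.trans ?_
          simp only
          linarith
      exact ih.top (C := 2 * C) fun q x => key q.1 q.2 x
  have bddj : ∀ j, ∃ C, 0 ≤ C ∧ ∀ i k x, |iteratedDeriv j (X i k) x| ≤ C * w i := by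
    intro j
    obtain ⟨_, _, C, hC, hb⟩ := bdd j
    exact ⟨C, hC, fun i k x => hb (i, k) j (by omega) x⟩
  let Y : {i // w i ≤ δ} → ℕ → ℝ → ℝ := fun i k x => X i (k + 1) x - X i k x
  have Ysm : ∀ i k, Sm (Y i k) := fun i k => (st i (k + 1)).1.sub (st i k).1
  have Yit : ∀ i k j x, iteratedDeriv j (Y i k) x
      = iteratedDeriv j (X i (k + 1)) x - iteratedDeriv j (X i k) x := fun i k j x =>
    iter_sub (st i (k + 1)).1 (st i k).1 j x
  have Ybd : ∀ j, ∃ C, 0 ≤ C ∧ ∀ i k x, |iteratedDeriv j (Y i k) x| ≤ C := by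
    intro j
    obtain ⟨C, hC, hb⟩ := bddj j
    refine ⟨2 * C, by positivity, fun i k x => ?_⟩
    rw [Yit]
    have w1 : C * w i ≤ C := mul_le_of_le_one_right hC (i.2.trans hδ1)
    have := abs_sub (iteratedDeriv j (X i (k + 1)) x) (iteratedDeriv j (X i k) x)
    linarith [hb i (k + 1) x, hb i k x]
  have Yg : ∀ j, ∃ K ρ : ℝ, 0 ≤ K ∧ 0 < ρ ∧ ρ < 1 ∧ ∀ i k x, |iteratedDeriv j (Y i k) x| ≤ K * ρ ^ k := by
    intro j
    induction j with
    | zero =>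
      refine ⟨1 / 2, 1 / 2, by norm_num, by norm_num, by norm_num, fun i k x => ?_⟩
      refine ((inv i k).2.2.2 0 (by omega) x).trans ?_
      exact mul_le_mul_of_nonneg_right (hCw i) (by positivity)
    | succ j ih =>
      obtain ⟨K, ρ, hK, hρ, hρ1, hb⟩ := ih
      obtain ⟨C, hC, hb2⟩ := Ybd (j + 2)
      have hs := Real.mul_self_sqrt hρ.le
      refine ⟨2 * K + C, Real.sqrt ρ, by positivity, Real.sqrt_pos.2 hρ, ?_, fun i k x => ?_⟩
      · rw [Real.sqrt_lt' one_pos]; simpa using hρ1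
      rw [iteratedDeriv_succ]
      refine landau ((Ysm i k).iter j) (pow_pos (Real.sqrt_pos.2 hρ) k) (fun x => ?_) (fun x => ?_) x
      · rw [← mul_pow, hs]; exact hb i k x
      · rw [← iteratedDeriv_succ, ← iteratedDeriv_succ]; exact hb2 i k x
  let L : {i // w i ≤ δ} → ℝ → ℝ := fun i x => ∑' k, Y i k x
  have T := fun i => tsum_sm (Ysm i) fun j => by
    obtain ⟨K, ρ, hK, hρ, hρ1, hb⟩ := Yg j
    exact ⟨fun k => K * ρ ^ k, (summable_geometric_of_lt_one hρ.le hρ1).mul_left K, hb i⟩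
  have lim : ∀ i j x, Tendsto (fun k => iteratedDeriv j (X i k) x) atTop (𝓝 (iteratedDeriv j (L i) x)) := by
    intro i j x
    have := ((T i).2 j x).tendsto_sum_nat
    refine this.congr fun n => ?_
    simp only [Yit]
    rw [Finset.sum_range_sub (fun k => iteratedDeriv j (X i k) x), X0, iter_zero_fn, sub_zero]
  have lim0 : ∀ i x, Tendsto (fun k => X i k x) atTop (𝓝 (L i x)) := fun i x => by
    simpa using lim i 0 x
  have Lbd : ∀ i, Bd 2 (L i) (2 * C1 * w i) := fun i j hj x =>
    le_of_tendsto (lim i j x).abs (Eventually.of_forall fun k => bd2 i k j hj x)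
  have Lst : ∀ i, IsState (L i) := by
    intro i
    refine ⟨(T i).1, fun x => ?_, ?_⟩
    · exact tendsto_nhds_unique (lim0 i (x + 1)) ((lim0 i x).congr fun k => ((st i k).2.1 x).symm)
    · have : Tendsto (fun k => ∫ x in (0:ℝ)..1, Real.exp (X i k x)) atTop
          (𝓝 (∫ x in (0:ℝ)..1, Real.exp (L i x))) := by
        refine intervalIntegral.tendsto_integral_filter_of_dominated_convergence (fun _ => Real.exp 1)
          (Eventually.of_forall fun k =>
            (Real.continuous_exp.comp (st i k).1.continuous).aestronglyMeasurable)
          (Eventually.of_forall fun k => Eventually.of_forall fun x _ => ?_)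
          (continuous_const.intervalIntegrable _ _)
          (Eventually.of_forall fun x _ => (Real.continuous_exp.tendsto _).comp (lim0 i x))
        rw [Real.norm_eq_abs, Real.abs_exp]
        have := (abs_le.1 ((bd2 i k).zero x)).2
        have := hCw i
        exact Real.exp_le_exp.2 (by linarith)
      simp only [(st i _).2.2] at this
      exact tendsto_nhds_unique this tendsto_const_nhds
  refine ⟨L, fun i => ⟨Lst i, (adm i _ i.2 (Lst i) (Lbd i)).1, ?_⟩, fun s => ?_⟩
  · funext x
    have hd : Tendsto (fun k : ℕ => 2 * C1 * w i / 2 ^ k) atTop (𝓝 0) := by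
      have := (tendsto_pow_atTop_nhds_zero_of_lt_one (r := (1 / 2 : ℝ)) (by norm_num)
        (by norm_num)).const_mul (2 * C1 * w i)
      rw [mul_zero] at this
      refine this.congr fun k => by rw [one_div, inv_pow]; rfl
    have hk : ∀ k, |stp A (h i) (L i) x - X i (k + 1) x| ≤ 2 * C1 * w i / 2 ^ k := by
      intro k
      have hwi : 0 ≤ 2 * C1 * w i := mul_nonneg (by positivity) (hw i)
      have dd : Bd 2 (fun x => L i x - X i k x) (2 * C1 * w i / 2 ^ k) := by
        intro j hj y
        rw [iter_sub (T i).1 (st i k).1]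
        have := dist_le_of_le_geometric_two_of_tendsto (C := 2 * C1 * w i)
          (f := fun k => iteratedDeriv j (X i k) y) (fun n => ?_) (lim i j y) k
        · rw [Real.dist_eq, abs_sub_comm] at this; exact this
        · rw [Real.dist_eq, abs_sub_comm, ← Yit]
          refine ((inv i n).2.2.2 j hj y).trans (le_of_eq ?_)
          rw [one_div, inv_pow]; field_simp
      have := k4 i (X i k) (L i) _ i.2 (st i k) (Lst i) (bd2 i k) (inv i k).2.2.1 (Lbd i)
        (by positivity) ?_ dd
      · have := this.zero x
        rw [← Xs] at this
        have h2 : 0 ≤ 2 * C1 * w i / 2 ^ k := by positivity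
        linarith
      · refine (div_le_self hwi (one_le_pow₀ (by norm_num))).trans ?_
        linarith [hCw i]
    have t1 : Tendsto (fun k => stp A (h i) (L i) x - X i (k + 1) x) atTop (𝓝 0) :=
      squeeze_zero_norm hk hd
    have t2 : Tendsto (fun k => stp A (h i) (L i) x - X i (k + 1) x) atTop
        (𝓝 (stp A (h i) (L i) x - L i x)) :=
      tendsto_const_nhds.sub ((tendsto_add_atTop_iff_nat 1).2 (lim0 i x))
    exact sub_eq_zero.1 (tendsto_nhds_unique t2 t1)
  · obtain ⟨_, _, C, hC, hb⟩ := (bdd s).le (s := s) (by omega)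
    exact ⟨fun i => hw _, fun i => (T i).1, C, hC, fun i j hj x =>
      le_of_tendsto (lim i j x).abs (Eventually.of_forall fun k => hb (i, k) j hj x)⟩
end

noncomputable section
variable {ι : Type*}

def cF (A : ℕ) (a : Equiv.Perm ℝ) (x : ℝ) : ℝ := cR A a ⌈x⌉₊ x
def cP (A : ℕ) (a : Equiv.Perm ℝ) : Equiv.Perm ℝ := toPerm (cF A a)

namespace Adm
variable {A : ℕ} {a : Equiv.Perm ℝ} (H : Adm A a)
include H

theorem cF_eq {j : ℕ} {x : ℝ} (hx : x ≤ j + 1) : cF A a x = cR A a j x := by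
  have h1 := Nat.le_ceil x
  rcases le_total ⌈x⌉₊ j with h | h
  · exact (H.cR_stab' h (by linarith)).symm
  · exact H.cR_stab' h hx

theorem cF_nhds {j : ℕ} {x : ℝ} (hx : x < j + 1) : cF A a =ᶠ[𝓝 x] cR A a j :=
  mem_of_superset (Iio_mem_nhds hx) fun _ hy => H.cF_eq (le_of_lt hy)

theorem cF_sm : Sm (cF A a) := contDiff_iff_contDiffAt.2 fun x => by
  have h1 := Nat.le_ceil x
  exact (Dif.sm (cR_mem H.pos H.mem ⌈x⌉₊)).contDiffAt.congr_of_eventuallyEq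
    (H.cF_nhds (j := ⌈x⌉₊) (by linarith))

theorem cF_rec (x : ℝ) : cF A a (x + 1) = aA A a (cF A a x) + 1 := by
  have h1 := Nat.le_ceil x
  rw [H.cF_eq (j := ⌈x⌉₊ + 1) (x := x + 1) (by push_cast; linarith), cR_succ, add_sub_cancel_right]
  rfl

theorem cF_big (n : ℕ) : ∀ x : ℝ, 3 * (A:ℝ) + 1 / 2 ≤ x → x ≤ 3 * A + 5 + n → 3 * A ≤ cF A a x := by
  induction n with
  | zero =>
    intro x h1 h2
    rw [H.cF_eq (j := 3 * A + 4) (by push_cast at *; linarith)]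
    have := abs_le.1 (H.cR_half le_rfl x)
    linarith
  | succ n ih =>
    intro x h1 h2
    push_cast at h2
    by_cases h3 : x ≤ 3 * A + 5 + n
    · exact ih x h1 h3
    · push Not at h3
      have hn : (0:ℝ) ≤ n := Nat.cast_nonneg n
      have := ih (x - 1) (by linarith) (by linarith)
      have e := H.cF_rec (x - 1)
      rw [sub_add_cancel, H.aA_ge this] at e
      linarith

theorem cF_per {x : ℝ} (hx : 3 * A + 1 / 2 ≤ x) : cF A a (x + 1) = cF A a x + 1 := by
  obtain ⟨n, hn⟩ := exists_nat_ge (x - (3 * A + 5))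
  rw [H.cF_rec, H.aA_ge (H.cF_big n x hx (by linarith))]

theorem dcF_per {x : ℝ} (hx : 3 * A + 1 / 2 < x) (m : ℕ) :
    deriv (cF A a) (x + m) = deriv (cF A a) x := by
  induction m with
  | zero => simp
  | succ m ih =>
    rw [← ih]
    have hm : (0:ℝ) ≤ m := Nat.cast_nonneg m
    have : (fun x => cF A a (x + 1)) =ᶠ[𝓝 (x + m)] fun x => cF A a x + 1 :=
      mem_of_superset (Ioi_mem_nhds (show 3 * (A:ℝ) + 1 / 2 < x + m by linarith)) fun y hy =>
        H.cF_per (le_of_lt hy)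
    have := this.deriv_eq
    rw [deriv_comp_add_const, deriv_add_const] at this
    rw [← this]; push_cast; ring_nf

theorem dcF_lo {x : ℝ} (hx : x < 3 * A + 5) :
    deriv (cF A a) x = Real.exp (lg (cR A a (3 * A + 4)) x) := by
  rw [(H.cF_nhds (j := 3 * A + 4) (by push_cast; linarith)).deriv_eq, exp_lg (cR_mem H.pos H.mem _)]

theorem dcF_hi {x : ℝ} (hx : 3 * A + 1 ≤ x) : deriv (cF A a) x = Real.exp (Lam A a x) := by
  have h1 := Int.fract_nonneg x
  have h2 := Int.fract_lt_one x
  obtain ⟨m, hm⟩ : ∃ m : ℕ, (m : ℤ) = ⌊x⌋ - (3 * A + 1) := by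
    refine ⟨(⌊x⌋ - (3 * A + 1)).toNat, Int.toNat_of_nonneg ?_⟩
    have : (3 * A + 1 : ℤ) ≤ ⌊x⌋ := by rw [Int.le_floor]; push_cast; exact hx
    omega
  have hm' : (m : ℝ) = ⌊x⌋ - (3 * A + 1) := by exact_mod_cast hm
  have e : x = 3 * A + 1 + Int.fract x + m := by rw [hm', Int.fract]; ring
  conv_lhs => rw [e]
  rw [H.dcF_per (by linarith), H.dcF_lo (by linarith), Lam]

theorem dcF_ge (x : ℝ) : 1 / 2 ≤ deriv (cF A a) x := by
  have hA := H.posR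
  have key : ∀ y, 1 / 2 ≤ Real.exp (lg (cR A a (3 * A + 4)) y) := fun y => by
    have := H.cR_lg (3 * A + 4) y
    push_cast at this
    have h3 : |lg (cR A a (3 * A + 4)) y| ≤ 1 / 2 := by
      by_contra hc
      push Not at hc
      have := mul_lt_mul_of_pos_right hc (by linarith : (0:ℝ) < 3 * A + 4)
      linarith
    have := Real.add_one_le_exp (lg (cR A a (3 * A + 4)) y)
    linarith [(abs_le.1 h3).1]
  rcases le_total (3 * (A:ℝ) + 1) x with h | h
  · rw [H.dcF_hi h]; exact key _
  · rw [H.dcF_lo (by linarith)]; exact key _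

theorem cP_aux : ⇑(cP A a) = cF A a ∧ cP A a ∈ Dif :=
  mkDif H.cF_sm (fun x => by linarith [H.dcF_ge x])
    (surj_of_deriv H.cF_sm (by norm_num : (0:ℝ) < 1 / 2) H.dcF_ge)

theorem cP_mem : cP A a ∈ Dif := H.cP_aux.2
theorem cP_apply (x : ℝ) : cP A a x = cF A a x := by rw [H.cP_aux.1]
theorem lg_cP_lo {x : ℝ} (hx : x < 3 * A + 5) : lg (cP A a) x = lg (cR A a (3 * A + 4)) x := by
  rw [lg, H.cP_aux.1, H.dcF_lo hx, Real.log_exp]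
theorem lg_cP_hi {x : ℝ} (hx : 3 * A + 1 ≤ x) : lg (cP A a) x = Lam A a x := by
  rw [lg, H.cP_aux.1, H.dcF_hi hx, Real.log_exp]
theorem cP_le {x : ℝ} (hx : x ≤ 1) : cP A a x = x := by
  rw [H.cP_apply, H.cF_eq (j := 0) (by push_cast; linarith)]; rfl
end Adm

theorem BO.cP {A s : ℕ} {a : ι → Equiv.Perm ℝ} {w : ι → ℝ} (h : BO s (fun i => lg (a i)) w)
    (H : ∀ i, Adm A (a i)) (hA : 0 < A) (hw : ∀ i, w i ≤ 1) : BO s (fun i => lg (cP A (a i))) w := by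
  obtain ⟨h0, _, C, hC, h1⟩ := h.cR hA (fun i => (H i).mem) hw (3 * A + 4)
  obtain ⟨_, _, C', hC', h2⟩ := h.Lam H hA hw
  refine ⟨h0, fun i => Sm_lg (H i).cP_mem, C + C', by positivity, fun i j hj x => ?_⟩
  have e1 := mul_nonneg hC (h0 i)
  have e2 := mul_nonneg hC' (h0 i)
  rcases lt_or_ge x (3 * A + 2) with hx | hx
  · have : lg (_root_.cP A (a i)) =ᶠ[𝓝 x] lg (_root_.cR A (a i) (3 * A + 4)) :=
      mem_of_superset (Iio_mem_nhds hx) fun y (hy : y < _) => (H i).lg_cP_lo (by linarith)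
    rw [this.iteratedDeriv_eq]
    linarith [h1 i j hj x]
  · have : lg (_root_.cP A (a i)) =ᶠ[𝓝 x] _root_.Lam A (a i) :=
      mem_of_superset (Ioi_mem_nhds (show 3 * (A:ℝ) + 1 < x by linarith)) fun y (hy : _ < y) =>
        (H i).lg_cP_hi hy.le
    rw [this.iteratedDeriv_eq]
    linarith [h2 i j hj x]

theorem roll {h : ι → Equiv.Perm ℝ} {w : ι → ℝ} (hh : ∀ i, h i ∈ Dif)
    (h0 : ∀ i, ∀ y ≤ 0, h i y = y) (h3 : ∀ i, ∀ y, 3 ≤ y → h i y = y)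
    (bh : ∀ s, BO s (fun i => lg (h i)) w) :
    ∃ A : ℕ, 100 ≤ A ∧ ∃ δ : ℝ, 0 < δ ∧ ∃ f g : {i // w i ≤ δ} → Equiv.Perm ℝ,
      ∃ t : {i // w i ≤ δ} → ℝ, (∀ i, f i ∈ Dif) ∧ (∀ i, g i ∈ Dif) ∧
      (∀ i, ∀ y ≤ 0, f i y = y) ∧ (∀ i, ∀ y, 3 ≤ y → f i y = y) ∧
      (∀ i, ∀ y ≤ 0, g i y = y) ∧ (∀ i, ∀ y : ℝ, 3 * (A:ℝ) + 2 ≤ y → g i y = y + t i) ∧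
      (∀ i, tr 1 * f i * g i = g i * tr 1 * aA A (f i * h i)) ∧
      (∀ s, BO s (fun i => lg (f i)) fun i => w i) ∧ ∀ s, BO s (fun i => lg (g i)) fun i => w i := by
  obtain ⟨A, hA, δ, hδ, hδ1, L, hL, bL⟩ := fixpt hh h0 h3 bh
  have hAp : 0 < A := by omega
  have hw1 : ∀ i : {i // w i ≤ δ}, w i ≤ 1 := fun i => i.2.trans hδ1
  have st := fun i => (hL i).1
  have H := fun i => (hL i).2.1
  have bf := fun s => BO.fP st (bL s) hw1
  have ba := fun s => (bf s).lgmul ((bh s).reindex (fun i : {i // w i ≤ δ} => i.1))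
    (fun i => fP_mem (st i)) (fun i => hh i) hw1
  have cm := fun i => (H i).cP_mem
  have bm := fun i => bP_mem (st i)
  have gm := fun i => mul_mem (bm i) (inv_mem (cm i))
  refine ⟨A, hA, δ, hδ, fun i => fP (L i), fun i => bP (L i) * (cP A (fP (L i) * h i))⁻¹,
    fun i => (bP (L i) * (cP A (fP (L i) * h i))⁻¹) (3 * A + 2) - (3 * A + 2),
    fun i => fP_mem (st i), gm, fun i y hy => fP_le (st i) hy, fun i y hy => ?_, fun i y hy => ?_,
    fun i y hy => ?_, fun i => ?_, bf, fun s => ?_⟩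
  · have := (H i).ge y hy
    rwa [Equiv.Perm.mul_apply, h3 i y hy] at this
  · rw [Equiv.Perm.mul_apply]
    have : (cP A (fP (L i) * h i))⁻¹ y = y := by
      rw [Equiv.Perm.inv_eq_iff_eq, (H i).cP_le (by linarith)]
    rw [this, bP_le (st i) (by linarith)]
  · set g := bP (L i) * (cP A (fP (L i) * h i))⁻¹ with hg
    have dg : ∀ z : ℝ, 3 * (A:ℝ) + 2 ≤ z → deriv g z = 1 := by
      intro z hz
      set x := (cP A (fP (L i) * h i))⁻¹ z with hx
      have hx' : 3 * A + 1 ≤ x := by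
        by_contra hc
        push Not at hc
        have h1 := (H i).cR_half le_rfl (3 * A + 1)
        have h2 := Dif.mono (cm i) hc
        rw [hx, pinv2, (H i).cP_apply, (H i).cF_eq (j := 3 * A + 4) (by push_cast; linarith)] at h2
        linarith [(abs_le.1 h1).2]
      rw [← exp_lg (gm i), lg_mul (bm i) (inv_mem (cm i)), lg_inv (cm i), ← hx, (H i).lg_cP_hi hx',
        lg_bP (st i), chi_ge (by
          have := (H i).posR
          have : (100:ℝ) ≤ A := by exact_mod_cast hA
          linarith)]
      have e : Lam A (fP (L i) * h i) = L i := (hL i).2.2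
      rw [e]; simp
    rcases eq_or_lt_of_le hy with rfl | hy
    · ring
    · obtain ⟨c, hc, e⟩ := exists_deriv_eq_slope g hy (Dif.sm (gm i)).continuous.continuousOn
        (Dif.sm (gm i)).diff.differentiableOn
      rw [dg c hc.1.le, eq_div_iff (by linarith)] at e
      linarith
  · ext y
    obtain ⟨x, rfl⟩ := (cP A (fP (L i) * h i)).surjective y
    simp only [Equiv.Perm.mul_apply, tr_apply, pinv1]
    rw [(H i).cP_apply, ← (H i).cF_rec, ← (H i).cP_apply, pinv1, fP_apply, pinv1]; ring
  · exact (BO.bP st (bL s)).lgmul (((ba s).cP H hAp hw1).lginv cm hw1) bm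
      (fun i => inv_mem (cm i)) hw1
end

noncomputable section
variable {ι : Type*}

def cmt {G : Type*} [Group G] (x y : G) : G := x * y * x⁻¹ * y⁻¹

def Sp (r : ℝ) : Subgroup (Equiv.Perm ℝ) where
  carrier := {p | p ∈ Dif ∧ ∀ y, r ≤ |y| → p y = y}
  mul_mem' := fun {p q} hp hq => ⟨mul_mem hp.1 hq.1, fun y hy => by
    rw [Equiv.Perm.mul_apply, hq.2 y hy, hp.2 y hy]⟩
  one_mem' := ⟨one_mem _, fun _ _ => rfl⟩
  inv_mem' := fun {p} hp => ⟨inv_mem hp.1, fun y hy => by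
    rw [Equiv.Perm.inv_eq_iff_eq, hp.2 y hy]⟩

theorem Sp.mono {r r' : ℝ} (h : r ≤ r') {p : Equiv.Perm ℝ} (hp : p ∈ Sp r) : p ∈ Sp r' :=
  ⟨hp.1, fun y hy => hp.2 y (h.trans hy)⟩

theorem conj_trunc {K : ℝ → Prop} {p F F' : Equiv.Perm ℝ} (hp : ∀ y, ¬ K y → p y = y)
    (h : ∀ y, K y → F y = F' y) : F * p * F⁻¹ = F' * p * F'⁻¹ := by
  ext z
  simp only [Equiv.Perm.mul_apply]
  by_cases hy : K (F⁻¹ z)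
  · have e : F'⁻¹ z = F⁻¹ z := by rw [Equiv.Perm.inv_eq_iff_eq, ← h _ hy, pinv2]
    rw [e]
    refine h _ ?_
    by_contra hk
    have := p.injective (hp _ hk)
    rw [this] at hk
    exact hk hy
  · rw [hp _ hy, pinv2, hp, pinv2]
    intro hk
    have : F⁻¹ z = F'⁻¹ z := by rw [Equiv.Perm.inv_eq_iff_eq, h _ hk, pinv2]
    rw [this] at hy
    exact hy hk

theorem exists_aff {a b μ c : ℝ} (ha : 0 < a) (hab : a < b) (hμ : 0 < μ) (hμ1 : μ ≤ 1)
    (hc : |c| ≤ (1 - μ) * a) : ∃ q ∈ Sp b, ∀ y, |y| ≤ a → q y = c + μ * y := by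
  have hd : 0 < b ^ 2 - a ^ 2 := by nlinarith
  set χ : ℝ → ℝ := fun y => Real.smoothTransition ((b ^ 2 - y ^ 2) / (b ^ 2 - a ^ 2)) with hχ
  have sst : Sm Real.smoothTransition := Real.smoothTransition.contDiff
  have sχ : Sm χ := sst.comp (by fun_prop)
  have χin : ∀ y, |y| ≤ a → χ y = 1 := fun y hy => by
    apply Real.smoothTransition.one_of_one_le
    rw [le_div_iff₀ hd]
    have := sq_le_sq' (by linarith [neg_abs_le y, abs_nonneg y]) ((le_abs_self y).trans hy)
    linarith
  have χout : ∀ y, b ≤ |y| → χ y = 0 := fun y hy => by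
    apply Real.smoothTransition.zero_of_nonpos
    apply div_nonpos_of_nonpos_of_nonneg _ hd.le
    have : b ^ 2 ≤ |y| ^ 2 := by gcongr; linarith
    rw [sq_abs] at this; linarith
  set F : ℝ → ℝ := fun y => y + χ y * (c - (1 - μ) * y) with hF
  have sF : Sm F := by
    have : Sm fun y : ℝ => c - (1 - μ) * y :=
      contDiff_const.sub (contDiff_const.mul contDiff_id)
    exact contDiff_id.add (sχ.mul this)
  have dF : ∀ y, μ ≤ deriv F y := by
    intro y
    have h1 : HasDerivAt χ (deriv Real.smoothTransition ((b ^ 2 - y ^ 2) / (b ^ 2 - a ^ 2)) *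
        (-(2 * y) / (b ^ 2 - a ^ 2))) y := by
      have h0 := (sst.diff ((b ^ 2 - y ^ 2) / (b ^ 2 - a ^ 2))).hasDerivAt
      refine HasDerivAt.comp (h₂ := Real.smoothTransition)
        (h := fun y => (b ^ 2 - y ^ 2) / (b ^ 2 - a ^ 2)) y h0 ?_
      have := (((hasDerivAt_id y).pow 2).const_sub (b ^ 2)).div_const (b ^ 2 - a ^ 2)
      exact this.congr_deriv (by norm_num)
    have h2 : HasDerivAt (fun y : ℝ => c - (1 - μ) * y) (-(1 - μ)) y := by
      have := ((hasDerivAt_id y).const_mul (1 - μ)).const_sub c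
      simpa using this
    have h3 := ((hasDerivAt_id y).add (h1.mul h2)).deriv
    rw [show F = id + χ * (fun y : ℝ => c - (1 - μ) * y) by ext; simp [hF], h3]
    have k1 : χ y ≤ 1 := Real.smoothTransition.le_one _
    have k0 : 0 ≤ χ y := Real.smoothTransition.nonneg _
    have key : 0 ≤ deriv Real.smoothTransition ((b ^ 2 - y ^ 2) / (b ^ 2 - a ^ 2)) *
        (-(2 * y) / (b ^ 2 - a ^ 2)) * (c - (1 - μ) * y) := by
      rcases lt_or_ge (|y|) a with hy | hy
      · have : deriv Real.smoothTransition ((b ^ 2 - y ^ 2) / (b ^ 2 - a ^ 2)) = 0 := by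
          have : Real.smoothTransition =ᶠ[𝓝 ((b ^ 2 - y ^ 2) / (b ^ 2 - a ^ 2))] fun _ => 1 := by
            refine mem_of_superset (Ioi_mem_nhds (?_ : (1:ℝ) < _)) fun z hz =>
              Real.smoothTransition.one_of_one_le (le_of_lt hz)
            rw [lt_div_iff₀ hd]
            have : |y| ^ 2 < a ^ 2 := by gcongr
            rw [sq_abs] at this
            linarith
          rw [this.deriv_eq]; simp
        rw [this]; simp
      · have m : 0 ≤ deriv Real.smoothTransition ((b ^ 2 - y ^ 2) / (b ^ 2 - a ^ 2)) :=
          Real.smoothTransition.monotone.deriv_nonneg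
        rw [mul_assoc]
        refine mul_nonneg m ?_
        rw [div_mul_eq_mul_div]
        refine div_nonneg ?_ hd.le
        have e1 : y * c ≤ |y| * |c| := by rw [← abs_mul]; exact le_abs_self _
        have e2 : |y| * |c| ≤ |y| * ((1 - μ) * |y|) :=
          mul_le_mul_of_nonneg_left (hc.trans (mul_le_mul_of_nonneg_left hy (by linarith)))
            (abs_nonneg y)
        have e3 : |y| * |y| = y * y := abs_mul_abs_self y
        nlinarith
    nlinarith
  obtain ⟨e, m⟩ := mkDif sF (fun y => hμ.trans_le (dF y)) (surj_of_deriv sF hμ dF)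
  refine ⟨toPerm F, ⟨m, fun y hy => ?_⟩, fun y hy => ?_⟩
  · rw [e]; simp only [hF, χout y hy]; ring
  · rw [e]; simp only [hF, χin y hy]; ring

theorem trunc_Dl {A R : ℝ} (hA : 1 ≤ A) : ∃ W, ∃ q ∈ Sp W, ∀ y, |y| ≤ R → q y = Dl A y := by
  obtain ⟨q, hq, h⟩ := exists_aff (a := A * (|R| + 1)) (b := A * (|R| + 1) + 1) (μ := A⁻¹) (c := 0)
    (by positivity) (by linarith) (by positivity) (inv_le_one_of_one_le₀ hA) (by
      have := inv_le_one_of_one_le₀ hA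
      rw [abs_zero]; exact mul_nonneg (by linarith) (by positivity))
  refine ⟨_, q⁻¹, inv_mem hq, fun y hy => ?_⟩
  rw [Equiv.Perm.inv_eq_iff_eq, Dl_apply (by linarith), h]
  · field_simp; ring
  · rw [abs_mul, abs_of_pos (by linarith : 0 < A)]
    gcongr; linarith [le_abs_self R]

theorem trunc_tr (t R : ℝ) : ∃ W, ∃ q ∈ Sp W, ∀ y, |y| ≤ R → q y = tr t y := by
  obtain ⟨q, hq, h⟩ := exists_aff (a := |R| + |t| + 1) (b := |R| + |t| + 2) (μ := 1 / 2) (c := 0)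
    (by positivity) (by linarith) (by norm_num) (by norm_num) (by rw [abs_zero]; positivity)
  obtain ⟨q', hq', h'⟩ := exists_aff (a := |R| + |t| + 1) (b := |R| + |t| + 2) (μ := 1 / 2)
    (c := t / 2) (by positivity) (by linarith) (by norm_num) (by norm_num) (by
      rw [abs_div]; norm_num; linarith [abs_nonneg R])
  refine ⟨_, q⁻¹ * q', mul_mem (inv_mem hq) hq', fun y hy => ?_⟩
  have := le_abs_self R
  rw [Equiv.Perm.mul_apply, Equiv.Perm.inv_eq_iff_eq, h' _ (by linarith [abs_nonneg t]), tr_apply, h]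
  · ring
  · linarith [abs_add_le y t]

/-! level charts -/
def lv (ω : ℝ) (n : ℕ) : Equiv.Perm ℝ := tr (3 / 16 / 2 ^ n) * Dl (ω / 2 ^ n)
def lev (ω : ℝ) (n : ℕ) (p : Equiv.Perm ℝ) : Equiv.Perm ℝ := lv ω n * p * (lv ω n)⁻¹
theorem lev_mul (ω : ℝ) (n : ℕ) (p q : Equiv.Perm ℝ) : lev ω n (p * q) = lev ω n p * lev ω n q := by
  simp [lev, mul_assoc]
theorem lev_inv (ω : ℝ) (n : ℕ) (p : Equiv.Perm ℝ) : lev ω n p⁻¹ = (lev ω n p)⁻¹ := by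
  simp [lev, mul_assoc]
theorem lev_one (ω : ℝ) (n : ℕ) : lev ω n 1 = 1 := by
  simp [lev]
def KK (n : ℕ) (θ : ℝ) : Prop := 5 / 32 < 2 ^ n * θ ∧ 2 ^ n * θ < 7 / 32

variable {ω W : ℝ} (hω : 0 < ω) (hW : ω * W ≤ 1 / 32)
include hω
theorem lv_apply (n : ℕ) (x : ℝ) : lv ω n x = ω / 2 ^ n * x + 3 / 16 / 2 ^ n := by
  rw [lv, Equiv.Perm.mul_apply, Dl_apply (by positivity), tr_apply]
theorem lv_inv (n : ℕ) (x : ℝ) : (lv ω n)⁻¹ x = 2 ^ n / ω * x - 3 / 16 / ω := by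
  rw [Equiv.Perm.inv_eq_iff_eq, lv_apply hω]; field_simp; ring
theorem lev_apply (n : ℕ) (p : Equiv.Perm ℝ) (x : ℝ) :
    lev ω n p x = ω / 2 ^ n * p (2 ^ n / ω * x - 3 / 16 / ω) + 3 / 16 / 2 ^ n := by
  rw [lev, Equiv.Perm.mul_apply, Equiv.Perm.mul_apply, lv_inv hω, lv_apply hω]
theorem lev_mem {n : ℕ} {p : Equiv.Perm ℝ} (hp : p ∈ Dif) : lev ω n p ∈ Dif := by
  have : lv ω n ∈ Dif := mul_mem (tr_mem _) (Dl_mem (by positivity))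
  exact mul_mem (mul_mem this hp) (inv_mem this)
omit hω
theorem KK_uniq {m n : ℕ} {θ : ℝ} (h : KK m θ) (h' : KK n θ) : m = n := by
  have key : ∀ m n : ℕ, m < n → KK m θ → KK n θ → False := by
    intro m n hmn h h'
    obtain ⟨k, rfl⟩ := Nat.exists_eq_add_of_lt hmn
    have h1 := h'.2
    rw [show (2:ℝ) ^ (m + k + 1) * θ = 2 * 2 ^ k * (2 ^ m * θ) by ring] at h1
    have : (1:ℝ) ≤ 2 ^ k := one_le_pow₀ (by norm_num)
    nlinarith [h.1]
  rcases lt_trichotomy m n with h1 | h1 | h1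
  · exact (key m n h1 h h').elim
  · exact h1
  · exact (key n m h1 h' h).elim
theorem KK_quarter {n : ℕ} {θ : ℝ} (h : KK n θ) : |θ| < 1 / 4 := by
  have : (1:ℝ) ≤ 2 ^ n := one_le_pow₀ (by norm_num)
  obtain ⟨h1, h2⟩ := h
  have : 0 < θ := by
    by_contra hc
    push Not at hc
    nlinarith
  rw [abs_of_pos this]; nlinarith

include hω hW
theorem lev_out {n : ℕ} {p : Equiv.Perm ℝ} (hp : p ∈ Sp W) {θ : ℝ} (h : ¬ KK n θ) :
    lev ω n p θ = θ := by
  rw [lev_apply hω, hp.2]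
  · field_simp; ring
  · by_contra hc
    push Not at hc
    apply h
    have e : 2 ^ n / ω * θ - 3 / 16 / ω = (2 ^ n * θ - 3 / 16) / ω := by ring
    rw [e, abs_div, abs_of_pos hω, div_lt_iff₀ hω] at hc
    have := abs_lt.1 (hc.trans_le ((mul_comm W ω).le.trans hW))
    constructor <;> linarith [this.1, this.2]
theorem lev_KK {n : ℕ} {p : Equiv.Perm ℝ} (hp : p ∈ Sp W) {θ : ℝ} (h : KK n θ) :
    KK n (lev ω n p θ) := by
  by_contra hc
  have := (lev ω n p).injective (lev_out hω hW hp hc)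
  rw [this] at hc
  exact hc h
theorem lev_Sp {n : ℕ} {p : Equiv.Perm ℝ} (hp : p ∈ Sp W) : lev ω n p ∈ Sp (7 / 16) :=
  ⟨lev_mem hω hp.1, fun y hy => lev_out hω hW hp fun h => by have := KK_quarter h; linarith⟩
omit hω hW

def glueF (ω : ℝ) (x : ℕ → Equiv.Perm ℝ) (θ : ℝ) : ℝ := θ + ∑' n, (lev ω n (x n) θ - θ)
def Gl (ω : ℝ) (x : ℕ → Equiv.Perm ℝ) : Equiv.Perm ℝ := toPerm (glueF ω x)

include hω hW
theorem glue_in {x : ℕ → Equiv.Perm ℝ} (hx : ∀ n, x n ∈ Sp W) {n : ℕ} {θ : ℝ} (h : KK n θ) :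
    glueF ω x θ = lev ω n (x n) θ := by
  rw [glueF, tsum_eq_single n]
  · ring
  · intro m hm
    rw [lev_out hω hW (hx m) fun h' => hm (KK_uniq h' h), sub_self]
theorem glue_out {x : ℕ → Equiv.Perm ℝ} (hx : ∀ n, x n ∈ Sp W) {θ : ℝ} (h : ∀ n, ¬ KK n θ) :
    glueF ω x θ = θ := by
  simp [glueF, fun n => lev_out hω hW (hx n) (h n)]
theorem glue_mul {x y : ℕ → Equiv.Perm ℝ} (hx : ∀ n, x n ∈ Sp W) (hy : ∀ n, y n ∈ Sp W) (θ : ℝ) :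
    glueF ω (x * y) θ = glueF ω x (glueF ω y θ) := by
  have hxy : ∀ n, (x * y) n ∈ Sp W := fun n => mul_mem (hx n) (hy n)
  by_cases h : ∃ n, KK n θ
  · obtain ⟨n, h⟩ := h
    rw [glue_in hω hW hxy h, glue_in hω hW hy h, glue_in hω hW hx (lev_KK hω hW (hy n) h),
      Pi.mul_apply, lev_mul, Equiv.Perm.mul_apply]
  · push Not at h
    rw [glue_out hω hW hxy h, glue_out hω hW hy h, glue_out hω hW hx h]
theorem Gl_apply {x : ℕ → Equiv.Perm ℝ} (hx : ∀ n, x n ∈ Sp W) : ⇑(Gl ω x) = glueF ω x := by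
  have h1 : ∀ θ, glueF ω 1 θ = θ := fun θ => by simp [glueF, lev_one]
  have hx' : ∀ n, x⁻¹ n ∈ Sp W := fun n => inv_mem (hx n)
  have : Function.Bijective (glueF ω x) := Function.bijective_iff_has_inverse.2
    ⟨glueF ω x⁻¹, fun θ => by rw [← glue_mul hω hW hx' hx, inv_mul_cancel, h1],
      fun θ => by rw [← glue_mul hω hW hx hx', mul_inv_cancel, h1]⟩
  simp [Gl, toPerm, this]
theorem Gl_mul {x y : ℕ → Equiv.Perm ℝ} (hx : ∀ n, x n ∈ Sp W) (hy : ∀ n, y n ∈ Sp W) :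
    Gl ω (x * y) = Gl ω x * Gl ω y := by
  ext θ
  rw [Equiv.Perm.mul_apply, Gl_apply hω hW hx, Gl_apply hω hW hy,
    Gl_apply hω hW (x := x * y) fun n => mul_mem (hx n) (hy n), glue_mul hω hW hx hy]
theorem Gl_inv {x : ℕ → Equiv.Perm ℝ} (hx : ∀ n, x n ∈ Sp W) : Gl ω x⁻¹ = (Gl ω x)⁻¹ := by
  have hx' : ∀ n, x⁻¹ n ∈ Sp W := fun n => inv_mem (hx n)
  rw [eq_inv_iff_mul_eq_one, ← Gl_mul hω hW hx' hx, inv_mul_cancel]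
  ext θ
  rw [Gl_apply hω hW (x := 1) fun n => one_mem _]
  simp [glueF, lev_one]
theorem Gl_comm {x y : ℕ → Equiv.Perm ℝ} (hx : ∀ n, x n ∈ Sp W) (hy : ∀ n, y n ∈ Sp W) :
    Gl ω (cmt x y) = cmt (Gl ω x) (Gl ω y) := by
  have hx' : ∀ n, x⁻¹ n ∈ Sp W := fun n => inv_mem (hx n)
  have hy' : ∀ n, y⁻¹ n ∈ Sp W := fun n => inv_mem (hy n)
  rw [cmt, cmt,
    Gl_mul hω hW (x := x * y * x⁻¹) (fun n => mul_mem (mul_mem (hx n) (hy n)) (hx' n)) hy',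
    Gl_mul hω hW (x := x * y) (fun n => mul_mem (hx n) (hy n)) hx', Gl_mul hω hW hx hy, Gl_inv hω hW hx,
    Gl_inv hω hW hy]
omit hω hW
theorem single_Sp {n : ℕ} {p : Equiv.Perm ℝ} (hp : p ∈ Sp W) (m : ℕ) :
    (Pi.mulSingle n p : ℕ → Equiv.Perm ℝ) m ∈ Sp W := by
  by_cases h : m = n
  · subst h; simpa using hp
  · simp [h, one_mem]
include hω hW
theorem Gl_single {n : ℕ} {p : Equiv.Perm ℝ} (hp : p ∈ Sp W) :
    Gl ω (Pi.mulSingle n p) = lev ω n p := by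
  ext θ
  rw [Gl_apply hω hW (single_Sp hp), glueF, tsum_eq_single n]
  · simp
  · intro m hm; simp [hm, lev_one]
omit hω hW
end

noncomputable section
variable {ι : Type*}

def wt (n : ℕ) : ℝ := 1 / (n.factorial : ℝ)
theorem wt_pos (n : ℕ) : 0 < wt n := by unfold wt; positivity
theorem wt_le (n : ℕ) : wt n ≤ 1 := by
  unfold wt
  exact div_le_one_of_le₀ (by exact_mod_cast Nat.factorial_pos n) (by positivity)
theorem wt_tendsto : Tendsto wt atTop (𝓝 0) := by
  have := (Real.summable_pow_div_factorial 1).tendsto_atTop_zero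
  refine this.congr fun n => ?_
  simp [wt]

def EE : Subgroup (ℕ → Equiv.Perm ℝ) where
  carrier := {x | (∃ R, ∀ n, x n ∈ Sp R) ∧ ∀ s, BO s (fun n => lg (x n)) wt}
  mul_mem' := by
    rintro x y ⟨⟨R, hx⟩, bx⟩ ⟨⟨R', hy⟩, by'⟩
    exact ⟨⟨max R R', fun n => mul_mem (Sp.mono (le_max_left _ _) (hx n))
      (Sp.mono (le_max_right _ _) (hy n))⟩, fun s => (bx s).lgmul (by' s) (fun n => (hx n).1)
      (fun n => (hy n).1) wt_le⟩
  one_mem' := ⟨⟨0, fun n => one_mem _⟩, fun s => (BO.zero fun n => (wt_pos n).le).congr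
    fun n y => by rw [Pi.one_apply, lg_one]⟩
  inv_mem' := by
    rintro x ⟨⟨R, hx⟩, bx⟩
    exact ⟨⟨R, fun n => inv_mem (hx n)⟩, fun s => (bx s).lginv (fun n => (hx n).1) wt_le⟩

theorem EE.win {x : ℕ → Equiv.Perm ℝ} (hx : x ∈ EE) : ∃ R > 0, ∀ R' ≥ R, ∀ n, x n ∈ Sp R' := by
  obtain ⟨⟨R, h⟩, _⟩ := hx
  exact ⟨max R 1, by positivity, fun R' h' n => Sp.mono ((le_max_left _ _).trans h') (h n)⟩

theorem EE.disp {x : ℕ → Equiv.Perm ℝ} (hx : x ∈ EE) (s : ℕ) :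
    BO s (fun n y => x n y - y) wt := by
  obtain ⟨R, hR, h⟩ := EE.win hx
  have h := h R le_rfl
  have b := hx.2
  have sm : ∀ n, Sm fun y => x n y - y := fun n => (Dif.sm (h n).1).sub contDiff_id
  have dd : ∀ n y, deriv (fun y => x n y - y) y = deriv (x n) y - 1 := fun n y => by
    rw [deriv_fun_sub ((Dif.sm (h n).1).diff y) differentiableAt_fun_id]; simp
  have b1 := fun s => ((b s).dexpm1 (fun n => (h n).1) wt_le).congr dd
  have b0 : BO 0 (fun n y => x n y - y) wt := by
    obtain ⟨C, hC, hb⟩ := (b1 0).bd0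
    refine BO.mk0 (C := C * (2 * R)) (fun n => (wt_pos n).le) sm fun n y => ?_
    have hw := (wt_pos n).le
    rcases le_total R (|y|) with hy | hy
    · rw [(h n).2 y hy, sub_self, abs_zero]; positivity
    · have := mvt_bd (sm n) (hb n) y R
      rw [(h n).2 R (le_abs_self R), sub_self, sub_zero] at this
      have h2 : |y - R| ≤ 2 * R := by
        have := abs_sub y R
        rw [abs_of_pos hR] at this; linarith
      calc _ ≤ _ := this
        _ ≤ C * wt n * (2 * R) := by gcongr
        _ = _ := by ring
  exact (BO.succ b0 (b1 s)).le (Nat.le_succ s)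

theorem Gl_mem {ω W : ℝ} (hω : 0 < ω) (hW : ω * W ≤ 1 / 32) {x : ℕ → Equiv.Perm ℝ} (hx : x ∈ EE)
    (hx' : ∀ n, x n ∈ Sp W) : Gl ω x ∈ Sp (7 / 16) := by
  have sm : ∀ x : ℕ → Equiv.Perm ℝ, x ∈ EE → (∀ n, x n ∈ Sp W) → Sm (Gl ω x) := by
    intro x hx hx'
    rw [Gl_apply hω hW hx']
    have e : ∀ n θ, lev ω n (x n) θ - θ = ω / 2 ^ n *
        ((fun z => x n (z + -(3 / 16 / ω)) - (z + -(3 / 16 / ω))) (2 ^ n / ω * θ)) := fun n θ => by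
      rw [lev_apply hω]; simp only [← sub_eq_add_neg]; field_simp; ring
    have sl : ∀ n, Sm fun θ => lev ω n (x n) θ - θ := fun n =>
      (Dif.sm (lev_mem hω (hx' n).1)).sub contDiff_id
    refine contDiff_id.add (tsum_sm sl fun j => ?_).1
    obtain ⟨_, sb, C, hC, h⟩ := (EE.disp hx j).shift (-(3 / 16 / ω))
    refine ⟨fun n => ω * (1 / ω) ^ j * C * ((2 ^ j) ^ n / n.factorial),
      (Real.summable_pow_div_factorial _).mul_left _, fun n θ => ?_⟩
    have h2 := h n j le_rfl (2 ^ n / ω * θ)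
    rw [show (fun θ => lev ω n (x n) θ - θ) = fun θ => ω / 2 ^ n * ((fun z => x n (z + -(3 / 16 / ω)) -
      (z + -(3 / 16 / ω))) (2 ^ n / ω * θ)) from funext (e n), iteratedDeriv_const_mul_field,
      iter_scale (sb n), abs_mul, abs_mul, abs_of_pos (by positivity : 0 < ω / 2 ^ n),
      abs_of_pos (by positivity : 0 < (2 ^ n / ω) ^ j)]
    calc _ ≤ ω / 2 ^ n * ((2 ^ n / ω) ^ j * (C * wt n)) := by gcongr
      _ ≤ ω / 1 * ((2 ^ n / ω) ^ j * (C * wt n)) := by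
        have := (wt_pos n).le
        gcongr
        exact one_le_pow₀ (by norm_num)
      _ = _ := by
        simp only [wt, div_pow, ← pow_mul, mul_comm j n, one_div, inv_pow]; ring
  have out : ∀ θ : ℝ, 1 / 4 ≤ |θ| → Gl ω x θ = θ := fun θ hθ => by
    rw [Gl_apply hω hW hx', glue_out hω hW hx' fun n hn => by linarith [KK_quarter hn]]
  have s1 := sm x hx hx'
  refine ⟨⟨s1, ?_, ?_⟩, fun y hy => out y (by linarith)⟩
  · have := sm x⁻¹ (inv_mem hx) fun n => inv_mem (hx' n)
    rwa [Gl_inv hω hW hx'] at this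
  · rcases s1.continuous.strictMono_of_inj (Gl ω x).injective with h | h
    · exact h
    · have := h (show (1:ℝ) < 2 by norm_num)
      rw [out 1 (by norm_num), out 2 (by norm_num)] at this
      norm_num at this

/-! words -/
def Wd {G : Type*} [Group G] (S : Set G) (k : ℕ) (p : G) : Prop :=
  ∃ l : List G, l.length ≤ k ∧ (∀ x ∈ l, x ∈ S ∨ x⁻¹ ∈ S) ∧ l.prod = p
section
variable {G : Type*} [Group G] {S : Set G} {k k' : ℕ} {p q : G}
theorem Wd.mono (h : Wd S k p) (hk : k ≤ k') : Wd S k' p :=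
  let ⟨l, a, b, c⟩ := h; ⟨l, a.trans hk, b, c⟩
theorem Wd.sub (h : Wd S k p) {S' : Set G} (hk : S ⊆ S') : Wd S' k p :=
  let ⟨l, a, b, c⟩ := h; ⟨l, a, fun x hx => (b x hx).imp (fun h => hk h) fun h => hk h, c⟩
theorem Wd.mul (h : Wd S k p) (h' : Wd S k' q) : Wd S (k + k') (p * q) := by
  obtain ⟨l, a, b, rfl⟩ := h
  obtain ⟨l', a', b', rfl⟩ := h'
  refine ⟨l ++ l', by rw [List.length_append]; omega, fun x hx => ?_, by simp⟩
  rcases List.mem_append.1 hx with h | h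
  · exact b x h
  · exact b' x h
theorem Wd.inv (h : Wd S k p) : Wd S k p⁻¹ := by
  obtain ⟨l, a, b, rfl⟩ := h
  refine ⟨(l.map (·⁻¹)).reverse, by simpa using a, fun x hx => ?_, (List.prod_inv_reverse l).symm⟩
  simp only [List.mem_reverse, List.mem_map] at hx
  obtain ⟨y, hy, rfl⟩ := hx
  rw [inv_inv]; exact (b y hy).symm
theorem Wd.gen (h : p ∈ S) : Wd S 1 p := ⟨[p], le_rfl, by simp [h], by simp⟩
theorem Wd.pow (h : Wd S k p) (n : ℕ) : Wd S (n * k) (p ^ n) := by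
  induction n with
  | zero => exact ⟨[], by simp, by simp, by simp⟩
  | succ n ih => rw [pow_succ]; exact (ih.mul h).mono (by rw [Nat.succ_mul])
theorem Wd.map {H : Type*} [Group H] (f : G → H) {P : Subgroup G} (h1 : f 1 = 1)
    (hf : ∀ x ∈ P, ∀ y ∈ P, f (x * y) = f x * f y)
    (hS : S ⊆ P) (h : Wd S k p) : Wd (f '' S) k (f p) := by
  obtain ⟨l, a, b, rfl⟩ := h
  have b' : ∀ x ∈ l, x ∈ P := fun x hx => (b x hx).elim (fun h => hS h) fun h => inv_mem_iff.1 (hS h)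
  refine ⟨l.map f, by simpa using a, fun x hx => ?_, ?_⟩
  · obtain ⟨y, hy, rfl⟩ := List.mem_map.1 hx
    refine (b y hy).imp (fun h => ⟨y, h, rfl⟩) fun h => ⟨_, h, ?_⟩
    rw [eq_inv_iff_mul_eq_one, ← hf _ (hS h) _ (b' y hy), inv_mul_cancel, h1]
  · clear a b
    induction l with
    | nil => simp [h1]
    | cons c l ih =>
      have hl : ∀ x ∈ l, x ∈ P := fun x hx => b' x (List.mem_cons_of_mem _ hx)
      rw [List.map_cons, List.prod_cons, List.prod_cons, ih hl, hf _ (b' c (by simp)) _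
        (Subgroup.list_prod_mem P hl)]
end

def good (x : ℕ → Equiv.Perm ℝ) : Prop :=
  ∃ ω0 > 0, ∀ ω, 0 < ω → ω ≤ ω0 → ∃ S : Finset (Equiv.Perm ℝ), (S : Set (Equiv.Perm ℝ)) ⊆ Sp (7 / 16) ∧
    ∃ C : ℕ, ∀ n, Wd (S : Set (Equiv.Perm ℝ)) (C * (n + 1)) (lev ω 0 (x n))

open Classical in
theorem good.mul {x y : ℕ → Equiv.Perm ℝ} (hx : good x) (hy : good y) : good (x * y) := by
  obtain ⟨ω1, h1, hx⟩ := hx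
  obtain ⟨ω2, h2, hy⟩ := hy
  refine ⟨min ω1 ω2, lt_min h1 h2, fun ω h h' => ?_⟩
  obtain ⟨S, hS, C, hx⟩ := hx ω h (h'.trans (min_le_left _ _))
  obtain ⟨S', hS', C', hy⟩ := hy ω h (h'.trans (min_le_right _ _))
  refine ⟨S ∪ S', ?_, C + C', fun n => ?_⟩
  · rw [Finset.coe_union]; exact union_subset hS hS'
  · rw [Pi.mul_apply, lev_mul]
    exact (((hx n).sub (by simp)).mul ((hy n).sub (by simp))).mono (by rw [add_mul])

theorem good.inv {x : ℕ → Equiv.Perm ℝ} (hx : good x) : good x⁻¹ := by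
  obtain ⟨ω1, h1, hx⟩ := hx
  refine ⟨ω1, h1, fun ω h h' => ?_⟩
  obtain ⟨S, hS, C, hx⟩ := hx ω h h'
  exact ⟨S, hS, C, fun n => by rw [Pi.inv_apply, lev_inv]; exact (hx n).inv⟩

theorem exists_small {W : ℝ} (hW : 0 < W) {ω : ℝ} (h : ω ≤ 1 / 32 / W) : ω * W ≤ 1 / 32 := by
  rwa [le_div_iff₀ hW] at h

open Classical in
theorem good_fin {x : ℕ → Equiv.Perm ℝ} (hx : x ∈ EE) {N : ℕ} (h : ∀ n ≥ N, x n = 1) : good x := by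
  obtain ⟨R, hR, hw⟩ := EE.win hx
  refine ⟨1 / 32 / R, by positivity, fun ω h1 h2 => ?_⟩
  have hW := exists_small hR h2
  refine ⟨(Finset.range N).image fun n => lev ω 0 (x n), ?_, 1, fun n => ?_⟩
  · intro p hp
    obtain ⟨n, _, rfl⟩ := Finset.mem_image.1 (Finset.mem_coe.1 hp)
    exact lev_Sp h1 hW (hw R le_rfl n)
  · rcases lt_or_ge n N with hn | hn
    · exact (Wd.gen (Finset.mem_coe.2 (Finset.mem_image_of_mem _ (Finset.mem_range.2 hn)))).mono
        (by omega)
    · rw [h n hn, lev_one]; exact ⟨[], by simp, by simp, by simp⟩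

theorem exists_F : ∃ F ∈ Sp (7 / 16), ∀ ω W : ℝ, 0 < ω → ω * W ≤ 1 / 32 → ∀ p ∈ Sp W, ∀ n,
    F ^ n * lev ω 0 p * (F ^ n)⁻¹ = lev ω n p := by
  obtain ⟨F, hF, h⟩ := exists_aff (a := 1 / 4) (b := 7 / 16) (μ := 1 / 2) (c := 0)
    (by norm_num) (by norm_num) (by norm_num) (by norm_num) (by norm_num)
  refine ⟨F, hF, fun ω W h1 h2 p hp n => ?_⟩
  induction n with
  | zero => simp
  | succ n ih =>
    rw [pow_succ', mul_inv_rev, show F * F ^ n * lev ω 0 p * ((F ^ n)⁻¹ * F⁻¹) =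
      F * (F ^ n * lev ω 0 p * (F ^ n)⁻¹) * F⁻¹ by group, ih,
      conj_trunc (K := KK n) (F' := Dl (1 / 2)) (fun y hy => lev_out h1 h2 hp hy)]
    · have : Dl (1 / 2) * lv ω n = lv ω (n + 1) := by
        ext z
        rw [Equiv.Perm.mul_apply, lv_apply h1, lv_apply h1, Dl_apply (by norm_num), pow_succ]
        field_simp
      rw [lev, lev, ← this, mul_inv_rev]; group
    · intro y hy
      rw [h y (KK_quarter hy).le, Dl_apply (by norm_num), zero_add]

/-- reduction: words for the level-`n` embedding. -/
theorem good_of {x : ℕ → Equiv.Perm ℝ} {P : Equiv.Perm ℝ} {W : ℝ} (hW : 0 < W) (hP : P ∈ Sp W)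
    (hx : ∀ n, x n ∈ Sp W) {T : ℝ → Finset (Equiv.Perm ℝ)} {C : ℕ}
    (h : ∀ ω, 0 < ω → ω * W ≤ 1 / 32 → (T ω : Set (Equiv.Perm ℝ)) ⊆ Sp (7 / 16) ∧ ∀ n, ∀ S : Set (Equiv.Perm ℝ),
      (T ω : Set (Equiv.Perm ℝ)) ⊆ S → Wd S (2 * n + 1) (lev ω n P) → Wd S (C * (n + 1)) (lev ω n (x n))) :
    good x := by
  classical
  obtain ⟨F, hF, hF2⟩ := exists_F
  refine ⟨1 / 32 / W, by positivity, fun ω h1 h2 => ?_⟩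
  have hWω := exists_small hW h2
  obtain ⟨hT, h⟩ := h ω h1 hWω
  have hc := hF2 ω W h1 hWω
  have hS : ((T ω ∪ {F, lev ω 0 P} : Finset (Equiv.Perm ℝ)) : Set (Equiv.Perm ℝ)) ⊆ Sp (7 / 16) := by
    rw [Finset.coe_union, Finset.coe_pair]
    exact union_subset hT (by
      rintro y (rfl | rfl)
      · exact hF
      · exact lev_Sp h1 hWω hP)
  refine ⟨T ω ∪ {F, lev ω 0 P}, hS, C + 2, fun n => ?_⟩
  set S : Set (Equiv.Perm ℝ) := ((T ω ∪ {F, lev ω 0 P} : Finset (Equiv.Perm ℝ)) : Set (Equiv.Perm ℝ)) with hSd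
  have wF : Wd S (n * 1) (F ^ n) := (Wd.gen (by simp [hSd])).pow n
  have wP : Wd S 1 (lev ω 0 P) := Wd.gen (by simp [hSd])
  have := h n S (by rw [hSd, Finset.coe_union]; exact subset_union_left) (by
    rw [← hc P hP n]
    exact ((wF.mul wP).mul wF.inv).mono (by omega))
  rw [show lev ω 0 (x n) = (F ^ n)⁻¹ * lev ω n (x n) * F ^ n by rw [← hc _ (hx n) n]; group]
  exact ((wF.inv.mul this).mul wF).mono (by nlinarith)

theorem cmt_single {x : ℕ → Equiv.Perm ℝ} {P : Equiv.Perm ℝ} (n : ℕ) :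
    cmt (Pi.mulSingle n P) x = Pi.mulSingle n (cmt P (x n)) := by
  funext m
  by_cases h : m = n
  · subst h; simp [cmt]
  · simp [cmt, h]

theorem Wd.cmt {G : Type*} [Group G] {S : Set G} {k k' : ℕ} {p q : G} (h : Wd S k p) (h' : Wd S k' q) :
    Wd S (2 * k + 2 * k') (cmt p q) :=
  (((h.mul h').mul h.inv).mul h'.inv).mono (by omega)

theorem lev_cmt {ω W : ℝ} (hω : 0 < ω) (hW : ω * W ≤ 1 / 32) {x : ℕ → Equiv.Perm ℝ}
    (hx : ∀ n, x n ∈ Sp W) {P : Equiv.Perm ℝ} (hP : P ∈ Sp W) (n : ℕ) :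
    lev ω n (_root_.cmt P (x n)) = _root_.cmt (lev ω n P) (Gl ω x) := by
  rw [← Gl_single hω hW hP, ← Gl_comm hω hW (single_Sp hP) hx, cmt_single, Gl_single hω hW]
  exact mul_mem (mul_mem (mul_mem hP (hx n)) (inv_mem hP)) (inv_mem (hx n))

theorem good_P {x : ℕ → Equiv.Perm ℝ} (hx : x ∈ EE) {P : Equiv.Perm ℝ} {W0 : ℝ} (hP : P ∈ Sp W0) :
    good fun n => cmt P (x n) := by
  obtain ⟨R, hR, hw⟩ := EE.win hx
  have hw := hw _ (le_max_left R W0)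
  have hP := Sp.mono (le_max_right R W0) hP
  refine good_of (lt_max_of_lt_left hR) hP (fun n => mul_mem (mul_mem (mul_mem hP (hw n)) (inv_mem hP))
    (inv_mem (hw n))) (T := fun ω => {Gl ω x}) (C := 4) fun ω h1 h2 => ⟨?_, fun n S hS hl => ?_⟩
  · rw [Finset.coe_singleton]; exact singleton_subset_iff.2 (Gl_mem h1 h2 hx hw)
  · rw [lev_cmt h1 h2 hw hP]
    exact (hl.cmt (Wd.gen (hS (by simp)))).mono (by omega)

theorem good_cmt {x y : ℕ → Equiv.Perm ℝ} (hx : x ∈ EE) (hy : y ∈ EE) : good (cmt x y) := by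
  classical
  obtain ⟨R, hR, hw⟩ := EE.win hx
  obtain ⟨R', hR', hw'⟩ := EE.win hy
  set r := max R R' with hr
  have hxr := hw r (le_max_left R R')
  have hyr := hw' r (le_max_right R R')
  have hrp : 0 < r := lt_max_of_lt_left hR
  obtain ⟨W0, V, hV, hVt⟩ := trunc_tr (2 * r) r
  set W := max r W0
  have hV := Sp.mono (le_max_right r W0) hV
  have hxW := hw W ((le_max_left R R').trans (le_max_left _ _))
  have hyW := hw' W ((le_max_right R R').trans (le_max_left _ _))
  have key : ∀ n, cmt (cmt V (x n))⁻¹ (y n) = cmt (x n) (y n) := by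
    intro n
    have cm : (V * (x n)⁻¹ * V⁻¹) * y n = y n * (V * (x n)⁻¹ * V⁻¹) := by
      rw [conj_trunc (K := fun y => |y| ≤ r) (F' := tr (2 * r)) (fun z hz =>
        (inv_mem (hxr n)).2 z (not_le.1 hz).le) (fun z hz => hVt z hz)]
      ext z
      simp only [Equiv.Perm.mul_apply, tr_inv_apply, tr_apply]
      have hx' := (inv_mem (hxr n)).2
      have hyy := (hyr n).2
      rcases le_total r (|z|) with hz | hz
      · rw [hyy z hz]
        symm; apply hyy
        by_contra hc
        push Not at hc
        set u := (x n)⁻¹ (z - 2 * r)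
        have : (x n)⁻¹ u = u := hx' u (by
          rw [abs_lt] at hc
          rw [abs_of_neg (by linarith)]; linarith)
        have e := (x n)⁻¹.injective this
        rw [e] at hc
        linarith [abs_lt.1 hc, (by ring_nf : z - 2 * r + 2 * r = z), (by rw [sub_add_cancel] at hc; exact hc : |z| < r)]
      · have h1 : ∀ v : ℝ, |v| ≤ r → (x n)⁻¹ (v - 2 * r) = v - 2 * r := fun v hv => hx' _ (by
          rw [abs_of_nonpos (by linarith [le_abs_self v])]; linarith [le_abs_self v])
        have h2 : |y n z| ≤ r := by
          by_contra hc
          push Not at hc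
          have := (y n).injective (hyy _ hc.le)
          rw [this] at hc; linarith
        rw [h1 _ hz, h1 _ h2]; ring_nf
    have e1 : (cmt V (x n))⁻¹ = x n * (V * (x n)⁻¹ * V⁻¹) := by simp [cmt, mul_assoc]
    rw [e1]
    set b := V * (x n)⁻¹ * V⁻¹
    simp only [cmt, mul_inv_rev]
    rw [show x n * b * y n * (b⁻¹ * (x n)⁻¹) * (y n)⁻¹ = x n * (b * y n) * b⁻¹ * (x n)⁻¹ * (y n)⁻¹ by group,
      cm]
    group
  have hc : ∀ n, cmt V (x n) ∈ Sp W := fun n =>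
    mul_mem (mul_mem (mul_mem hV (hxW n)) (inv_mem hV)) (inv_mem (hxW n))
  refine good_of (lt_max_of_lt_left hrp) hV (fun n => mul_mem (mul_mem (mul_mem (hxW n) (hyW n))
    (inv_mem (hxW n))) (inv_mem (hyW n))) (T := fun ω => {Gl ω x, Gl ω y}) (C := 10)
    fun ω h1 h2 => ⟨?_, fun n S hS hl => ?_⟩
  · rw [Finset.coe_pair]
    rintro _ (rfl | rfl)
    · exact Gl_mem h1 h2 hx hxW
    · exact Gl_mem h1 h2 hy hyW
  · rw [show cmt x y n = cmt (x n) (y n) from rfl, ← key n, lev_cmt h1 h2 hyW (inv_mem (hc n)), lev_inv,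
      lev_cmt h1 h2 hxW hV]
    exact ((hl.cmt (Wd.gen (hS (by simp)))).inv.cmt (Wd.gen (hS (by simp)))).mono (by omega)
end

noncomputable section
variable {ι : Type*}

abbrev Sq := ℕ → Equiv.Perm ℝ
def Tt (t : ℝ) : Sq := fun _ => tr t
def Dt (c : ℝ) : Sq := fun _ => Dl c
theorem Tt_add (a b : ℝ) : Tt (a + b) = Tt a * Tt b := by
  funext n; ext y; simp [Tt]; ring

def St (q : Sq) (s : ℕ → ℝ) : Prop := (∀ n, q n ∈ Dif) ∧ (∀ σ, BO σ (fun n => lg (q n)) wt) ∧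
  ∃ r, ∀ n, |s n| ≤ r ∧ (∀ y ≤ -r, q n y = y) ∧ ∀ y ≥ r, q n y = y + s n

theorem St.mul {q q' : Sq} {s s' : ℕ → ℝ} (h : St q s) (h' : St q' s') : St (q * q') (s + s') := by
  obtain ⟨d, b, r, h⟩ := h
  obtain ⟨d', b', r', h'⟩ := h'
  refine ⟨fun n => mul_mem (d n) (d' n), fun σ => (b σ).lgmul (b' σ) d d' wt_le, r + r', fun n => ?_⟩
  obtain ⟨h1, h2, h3⟩ := h n
  obtain ⟨h1', h2', h3'⟩ := h' n
  have := abs_nonneg (s n)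
  have := abs_nonneg (s' n)
  refine ⟨(abs_add_le _ _).trans (by linarith), fun y hy => ?_, fun y hy => ?_⟩
  · rw [Pi.mul_apply, Equiv.Perm.mul_apply, h2' y (by linarith), h2 y (by linarith)]
  · have := neg_abs_le (s' n)
    rw [Pi.mul_apply, Equiv.Perm.mul_apply, h3' y (by linarith), h3 _ (by linarith), Pi.add_apply]; ring

theorem St.inv {q : Sq} {s : ℕ → ℝ} (h : St q s) : St q⁻¹ (-s) := by
  obtain ⟨d, b, r, h⟩ := h
  refine ⟨fun n => inv_mem (d n), fun σ => (b σ).lginv d wt_le, r + r, fun n => ?_⟩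
  obtain ⟨h1, h2, h3⟩ := h n
  have := abs_nonneg (s n)
  refine ⟨by rw [Pi.neg_apply, abs_neg]; linarith, fun y hy => ?_, fun y hy => ?_⟩
  · rw [Pi.inv_apply, Equiv.Perm.inv_eq_iff_eq, h2 y (by linarith)]
  · have := le_abs_self (s n)
    rw [Pi.inv_apply, Equiv.Perm.inv_eq_iff_eq, Pi.neg_apply, h3 _ (by linarith)]; ring

theorem St.tr {q : Sq} {s : ℕ → ℝ} (h : St q s) (t : ℝ) : St (Tt t * q * (Tt t)⁻¹) s := by
  obtain ⟨d, b, r, h⟩ := h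
  refine ⟨fun n => mul_mem (mul_mem (tr_mem t) (d n)) (inv_mem (tr_mem t)),
    fun σ => (b σ).conj_tr d t, r + |t|, fun n => ?_⟩
  obtain ⟨h1, h2, h3⟩ := h n
  have k1 := abs_nonneg t
  have k2 := le_abs_self t
  have k3 := neg_abs_le t
  refine ⟨by linarith, fun y hy => ?_, fun y hy => ?_⟩ <;>
    simp only [Pi.mul_apply, Pi.inv_apply, Tt, Equiv.Perm.mul_apply, tr_inv_apply, tr_apply]
  · rw [h2 _ (by linarith)]; ring
  · rw [h3 _ (by linarith)]; ring

theorem St.Dl {q : Sq} {s : ℕ → ℝ} (h : St q s) {c : ℝ} (hc : 0 < c) :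
    St (Dt c * q * (Dt c)⁻¹) fun n => c * s n := by
  obtain ⟨d, b, r, h⟩ := h
  refine ⟨fun n => mul_mem (mul_mem (Dl_mem hc) (d n)) (inv_mem (Dl_mem hc)),
    fun σ => (b σ).conj_Dl d hc, c * r, fun n => ?_⟩
  obtain ⟨h1, h2, h3⟩ := h n
  refine ⟨by rw [abs_mul, abs_of_pos hc]; gcongr, fun y hy => ?_, fun y hy => ?_⟩ <;>
    simp only [Pi.mul_apply, Pi.inv_apply, Dt, Equiv.Perm.mul_apply, Dl_inv_apply hc, Dl_apply hc]
  · rw [h2]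
    · field_simp
    · rw [div_le_iff₀ hc]; linarith
  · rw [h3]
    · field_simp
    · rw [ge_iff_le, le_div_iff₀ hc]; linarith

theorem St.of {x : Sq} (h : x ∈ EE) : St x 0 := by
  obtain ⟨R, hR, hw⟩ := EE.win h
  have hw := hw R le_rfl
  refine ⟨fun n => (hw n).1, h.2, R, fun n => ⟨by simpa using hR.le, fun y hy => ?_, fun y hy => ?_⟩⟩
  · exact (hw n).2 y (by rw [abs_of_neg (by linarith)]; linarith)
  · rw [(hw n).2 y (by rw [abs_of_pos (by linarith)]; linarith)]; simp

theorem St.EE {x : Sq} (h : St x 0) : x ∈ EE := by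
  obtain ⟨d, b, r, h⟩ := h
  refine ⟨⟨r, fun n => ⟨d n, fun y hy => ?_⟩⟩, b⟩
  obtain ⟨h1, h2, h3⟩ := h n
  rcases le_abs'.1 hy with hy | hy
  · exact h2 y hy
  · rw [h3 y hy]; simp

theorem EE_tr {x : Sq} (h : x ∈ EE) (t : ℝ) : Tt t * x * (Tt t)⁻¹ ∈ EE := ((St.of h).tr t).EE
theorem EE_Dl {x : Sq} (h : x ∈ EE) {c : ℝ} (hc : 0 < c) : Dt c * x * (Dt c)⁻¹ ∈ EE :=
  St.EE (by have := (St.of h).Dl hc; simp only [Pi.zero_apply, mul_zero] at this; exact this)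
theorem St.sub0 {q q' : Sq} {s : ℕ → ℝ} (h : St q s) (h' : St q' s) : q * q'⁻¹ ∈ _root_.EE :=
  St.EE (by have := h.mul h'.inv; rwa [add_neg_cancel] at this)

theorem St.conj {q : Sq} {s : ℕ → ℝ} (h : St q s) {y : Sq} (hy : y ∈ _root_.EE) :
    ∃ k ∈ _root_.EE, q * y * q⁻¹ = k * y * k⁻¹ := by
  obtain ⟨R, hR, hw⟩ := EE.win hy
  have hw := hw R le_rfl
  obtain ⟨r, hr⟩ := h.2.2
  refine ⟨q * (Tt (R + r) * q * (Tt (R + r))⁻¹)⁻¹, h.sub0 (h.tr _), ?_⟩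
  funext n
  refine conj_trunc (K := fun y => |y| ≤ R) (fun z hz => (hw n).2 z (not_le.1 hz).le) fun z hz => ?_
  have : (Tt (R + r) * q * (Tt (R + r))⁻¹)⁻¹ n z = z := by
    rw [Pi.inv_apply, Equiv.Perm.inv_eq_iff_eq]
    simp only [Pi.mul_apply, Pi.inv_apply, Tt, Equiv.Perm.mul_apply, tr_inv_apply, tr_apply]
    rw [(hr n).2.1 _ (by linarith [le_abs_self z])]; ring
  rw [Pi.mul_apply, Equiv.Perm.mul_apply, this]

theorem exists_phi : ∃ (Q : Type) (_ : CommGroup Q) (φ : Sq → Q),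
    (∀ x ∈ EE, ∀ y ∈ EE, φ (x * y) = φ x * φ y) ∧ (∀ x ∈ EE, φ x = 1 ↔ good x) := by
  classical
  let N : Subgroup EE :=
    { carrier := {x | good (x : Sq)}
      mul_mem' := fun h h' => good.mul h h'
      one_mem' := good_fin (N := 0) (one_mem _) fun _ _ => rfl
      inv_mem' := fun h => good.inv h }
  have mN : ∀ x : EE, x ∈ N ↔ good (x : Sq) := fun x => Iff.rfl
  have nN : N.Normal := ⟨fun x hx y => by
    rw [mN] at hx ⊢
    have := (good_cmt y.2 x.2).mul hx
    simpa [cmt] using this⟩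
  let Q : CommGroup (EE ⧸ N) := { QuotientGroup.Quotient.group N with
    mul_comm := fun a b => by
      induction a using QuotientGroup.induction_on with | _ a => ?_
      induction b using QuotientGroup.induction_on with | _ b => ?_
      refine (QuotientGroup.eq (s := N)).2 ?_
      rw [mN]
      have := good_cmt (inv_mem b.2) (inv_mem a.2)
      simpa [cmt, mul_assoc] using this }
  refine ⟨EE ⧸ N, Q, fun x => if h : x ∈ EE then ((⟨x, h⟩ : EE) : EE ⧸ N) else 1, ?_, ?_⟩
  · intro x hx y hy
    simp only [hx, hy, mul_mem hx hy, dif_pos]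
    rfl
  · intro x hx
    simp only [hx, dif_pos]
    exact (QuotientGroup.eq_one_iff (N := N) _).trans (mN _)

section
variable {Q : Type} [CommGroup Q] {φ : Sq → Q} (φm : ∀ x ∈ EE, ∀ y ∈ EE, φ (x * y) = φ x * φ y)
  (φg : ∀ x ∈ EE, φ x = 1 ↔ good x)
include φm φg
theorem phi_one : φ 1 = 1 := by
  have := φm 1 (one_mem _) 1 (one_mem _)
  simpa using this
theorem phi_inv {x : Sq} (hx : x ∈ EE) : φ x⁻¹ = (φ x)⁻¹ := by
  rw [eq_inv_iff_mul_eq_one, ← φm _ (inv_mem hx) _ hx, inv_mul_cancel, phi_one φm φg]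
theorem phi_eq {x y : Sq} (hx : x ∈ EE) (hy : y ∈ EE) (h : good (x * y⁻¹)) : φ x = φ y := by
  rw [← φg _ (mul_mem hx (inv_mem hy)), φm _ hx _ (inv_mem hy), phi_inv φm φg hy] at h
  rwa [mul_inv_eq_one] at h
theorem phi_tr {x : Sq} (hx : x ∈ EE) (t : ℝ) : φ (Tt t * x * (Tt t)⁻¹) = φ x := by
  refine phi_eq φm φg (EE_tr hx t) hx ?_
  obtain ⟨R, hR, hw⟩ := EE.win hx
  have hw := hw R le_rfl
  obtain ⟨W, P, hP, hq⟩ := trunc_tr t R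
  have := good_P hx hP
  convert this using 1
  funext n
  rw [cmt, conj_trunc (K := fun y => |y| ≤ R) (fun z hz => (hw n).2 z (not_le.1 hz).le) hq]
  rfl
theorem phi_Dl {x : Sq} (hx : x ∈ EE) {A : ℝ} (hA : 1 ≤ A) : φ (Dt A * x * (Dt A)⁻¹) = φ x := by
  refine phi_eq φm φg (EE_Dl hx (by linarith)) hx ?_
  obtain ⟨R, hR, hw⟩ := EE.win hx
  have hw := hw R le_rfl
  obtain ⟨W, P, hP, hq⟩ := trunc_Dl (R := R) hA
  have := good_P hx hP
  convert this using 1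
  funext n
  rw [cmt, conj_trunc (K := fun y => |y| ≤ R) (fun z hz => (hw n).2 z (not_le.1 hz).le) hq]
  rfl
theorem phi_St {q : Sq} {s : ℕ → ℝ} (h : St q s) {y : Sq} (hy : y ∈ EE) :
    q * y * q⁻¹ ∈ EE ∧ φ (q * y * q⁻¹) = φ y := by
  obtain ⟨k, hk, e⟩ := h.conj hy
  rw [e]
  refine ⟨mul_mem (mul_mem hk hy) (inv_mem hk), ?_⟩
  rw [φm _ (mul_mem hk hy) _ (inv_mem hk), φm _ hk _ hy, phi_inv φm φg hk, mul_comm (φ k),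
    mul_inv_cancel_right]
omit φm φg
variable (φ) in
def rr (t : ℝ) (q : Sq) : Q := φ (Tt t * q * (Tt t)⁻¹ * q⁻¹)
theorem rr_mem {q : Sq} {s : ℕ → ℝ} (h : St q s) (t : ℝ) : Tt t * q * (Tt t)⁻¹ * q⁻¹ ∈ EE :=
  (h.tr t).sub0 h
include φm φg
theorem rr_mul {q q' : Sq} {s s' : ℕ → ℝ} (h : St q s) (h' : St q' s') (t : ℝ) :
    rr φ t (q * q') = rr φ t q * rr φ t q' := by
  have h1 := phi_St φm φg (h.tr t) (rr_mem h' t)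
  rw [rr, show Tt t * (q * q') * (Tt t)⁻¹ * (q * q')⁻¹ = (Tt t * q * (Tt t)⁻¹) *
    (Tt t * q' * (Tt t)⁻¹ * q'⁻¹) * (Tt t * q * (Tt t)⁻¹)⁻¹ * (Tt t * q * (Tt t)⁻¹ * q⁻¹) by group,
    φm _ h1.1 _ (rr_mem h t), h1.2, mul_comm]
  rfl
theorem rr_EE {k : Sq} (h : k ∈ EE) (t : ℝ) : rr φ t k = 1 := by
  rw [rr, φm _ (EE_tr h t) _ (inv_mem h), phi_tr φm φg h, phi_inv φm φg h, mul_inv_cancel]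
theorem rr_eq {q q' : Sq} {s : ℕ → ℝ} (h : St q s) (h' : St q' s) (t : ℝ) :
    rr φ t q = rr φ t q' := by
  have h2 := h.sub0 h'
  have := rr_mul φm φg (St.of h2) h' t
  rwa [inv_mul_cancel_right, rr_EE φm φg h2, one_mul] at this
theorem rr_pow {q : Sq} {s : ℕ → ℝ} (h : St q s) (t : ℝ) (m : ℕ) :
    St (q ^ m) (fun n => m * s n) ∧ rr φ t (q ^ m) = rr φ t q ^ m := by
  induction m with
  | zero =>
    refine ⟨?_, by rw [pow_zero, pow_zero, rr_EE φm φg (one_mem _)]⟩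
    have := St.of (one_mem EE)
    simp only [pow_zero, Nat.cast_zero, zero_mul]; exact this
  | succ m ih =>
    constructor
    · have := ih.1.mul h
      rw [pow_succ]
      convert this using 1
      funext n; simp; ring
    · rw [pow_succ, pow_succ, rr_mul φm φg ih.1 h, ih.2]
theorem rr_tr {q : Sq} {s : ℕ → ℝ} (h : St q s) (m : ℕ) :
    rr φ (-m) q = rr φ (-1) q ^ m := by
  induction m with
  | zero =>
    rw [pow_zero, rr, show Tt (-((0:ℕ):ℝ)) = 1 by funext n; ext y; simp [Tt]]
    simp [phi_one φm φg]
  | succ m ih =>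
    rw [rr, show (-((m + 1 : ℕ) : ℝ)) = -m + -1 by push_cast; ring, Tt_add,
      show Tt (-m) * Tt (-1) * q * (Tt (-m) * Tt (-1))⁻¹ * q⁻¹ = Tt (-m) *
        (Tt (-1) * q * (Tt (-1))⁻¹ * q⁻¹) * (Tt (-m))⁻¹ * (Tt (-m) * q * (Tt (-m))⁻¹ * q⁻¹) by group,
      φm _ (EE_tr (rr_mem h _) _) _ (rr_mem h _), phi_tr φm φg (rr_mem h _), pow_succ, ← ih, mul_comm]
    rfl
theorem rr_key {q : Sq} {s : ℕ → ℝ} (h : St q s) {A : ℕ} (hA : 1 ≤ A) :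
    rr φ (-1) q ^ (A * A) = rr φ (-1) q := by
  have hA' : (1:ℝ) ≤ A := by exact_mod_cast hA
  have hp : (0:ℝ) < A := by linarith
  have h1 : St (Dt A * q * (Dt A)⁻¹) fun n => A * s n := h.Dl hp
  obtain ⟨h2, e2⟩ := rr_pow φm φg h (-1) A
  have e3 := rr_eq φm φg h2 h1 (-1)
  rw [pow_mul, ← e2, e3, ← rr_tr φm φg h1, rr]
  have : Dt A * Tt (-1) = Tt (-A) * Dt A := by
    funext n; ext y
    simp only [Pi.mul_apply, Dt, Tt, Equiv.Perm.mul_apply, Dl_apply hp, tr_apply]; ring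
  have e4 : Tt (-A) = Dt A * Tt (-1) * (Dt A)⁻¹ := by rw [this]; group
  rw [e4, show Dt A * Tt (-1) * (Dt A)⁻¹ * (Dt A * q * (Dt A)⁻¹) * (Dt A * Tt (-1) * (Dt A)⁻¹)⁻¹ *
    (Dt A * q * (Dt A)⁻¹)⁻¹ = Dt A * (Tt (-1) * q * (Tt (-1))⁻¹ * q⁻¹) * (Dt A)⁻¹ by group,
    phi_Dl φm φg (rr_mem h _) hA']
  rfl
theorem rr_triv {q : Sq} {s : ℕ → ℝ} (h : St q s) {A : ℕ} (hA : 2 ≤ A) : rr φ (-1) q = 1 := by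
  obtain ⟨m, hm⟩ : ∃ m, A * A = m + 1 := ⟨A * A - 1, by
    have := Nat.mul_le_mul hA hA; omega⟩
  have hmp : 0 < m := by have := Nat.mul_le_mul hA hA; omega
  have hmr : (0:ℝ) < m := by exact_mod_cast hmp
  have h1 := h.Dl (inv_pos.2 hmr)
  have e1 := rr_key φm φg h1 (A := A) (by omega)
  rw [hm, pow_succ, mul_eq_right] at e1
  obtain ⟨h2, e2⟩ := rr_pow φm φg h1 (-1) m
  have : (fun n => (m:ℝ) * ((m:ℝ)⁻¹ * s n)) = s := by funext n; field_simp
  rw [this] at h2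
  rw [rr_eq φm φg h h2, e2, e1]
theorem good_rel {f g h : Sq} {s : ℕ → ℝ} (hf : f ∈ EE) (hg : St g s) (hh : h ∈ EE) {A : ℕ} (hA : 2 ≤ A)
    (e : Tt 1 * f * g = g * Tt 1 * (Dt A * (f * h) * (Dt A)⁻¹)) : good h := by
  have hA' : (1:ℝ) ≤ A := by exact_mod_cast (by omega : 1 ≤ A)
  have m1 := EE_Dl (mul_mem hf hh) (c := (A:ℝ)) (by linarith)
  have h1 := phi_St φm φg hg m1
  have hT : Tt (-1) = (Tt 1)⁻¹ := by funext n; ext y; simp [Tt]; ring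
  have e1 : f = (Tt (-1) * g * (Tt (-1))⁻¹ * g⁻¹) * (g * (Dt A * (f * h) * (Dt A)⁻¹) * g⁻¹) := by
    calc f = (Tt 1)⁻¹ * (Tt 1 * f * g) * g⁻¹ := by group
      _ = _ := by rw [e, hT]; group
  have e2 := congrArg φ e1
  rw [φm _ (rr_mem hg _) _ h1.1, h1.2, phi_Dl φm φg (mul_mem hf hh) hA', φm _ hf _ hh] at e2
  have e3 := rr_triv φm φg hg hA
  rw [rr] at e3
  rw [e3, one_mul, left_eq_mul] at e2
  exact (φg _ hh).1 e2
end

theorem BO.extd {w : ℕ → ℝ} (w0 : ∀ n, 0 ≤ w n) {δ : ℝ} {s : ℕ} {f : {i // w i ≤ δ} → Equiv.Perm ℝ}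
    (h : BO s (fun i => lg (f i)) fun i => w i) :
    BO s (fun n => lg (if hn : w n ≤ δ then f ⟨n, hn⟩ else 1)) w := by
  obtain ⟨_, h1, C, hC, h2⟩ := h
  refine ⟨w0, fun n => ?_, C, hC, fun n j hj x => ?_⟩
  · by_cases hn : w n ≤ δ
    · simp only [hn, dif_pos]; exact h1 _
    · simp only [hn, dif_neg, not_false_eq_true, lg_one]; exact contDiff_const
  · by_cases hn : w n ≤ δ
    · simp only [hn, dif_pos]; exact h2 ⟨n, hn⟩ j hj x
    · simp only [hn, dif_neg, not_false_eq_true, lg_one]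
      rw [show iteratedDeriv j (fun _ : ℝ => (0:ℝ)) x = 0 by simp [iteratedDeriv_const], abs_zero]
      exact mul_nonneg hC (w0 n)

theorem good_main {h : Sq} (hh : ∀ i, h i ∈ Dif)
    (h0 : ∀ i, ∀ y ≤ 0, h i y = y) (h3 : ∀ i, ∀ y, 3 ≤ y → h i y = y)
    (bh : ∀ s, BO s (fun i => lg (h i)) wt) : good h := by
  obtain ⟨A, hA, δ, hδ, f, g, t, hf, hg, f0, f3, g0, g3, e, bf, bg⟩ := roll hh h0 h3 bh
  have w0 : ∀ n, 0 ≤ wt n := fun n => (wt_pos n).le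
  have bf' := fun s => (bf s).extd w0
  have bg' := fun s => (bg s).extd w0
  have bh' := fun s => ((bh s).reindex fun i : {i // wt i ≤ δ} => i.1).extd w0
  set f' : Sq := fun n => if hn : wt n ≤ δ then f ⟨n, hn⟩ else 1 with hf'
  set g' : Sq := fun n => if hn : wt n ≤ δ then g ⟨n, hn⟩ else 1 with hg'
  set h' : Sq := fun n => if hn : wt n ≤ δ then h n else 1 with hh'
  have mem : ∀ k : Sq, (∀ n, k n ∈ Dif) → (∀ i, ∀ y ≤ 0, k i y = y) → (∀ i, ∀ y, 3 ≤ y → k i y = y) →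
      (∀ s, BO s (fun i => lg (k i)) wt) → k ∈ EE := fun k k1 k2 k3 k4 =>
    ⟨⟨3, fun n => ⟨k1 n, fun y hy => (le_abs'.1 hy).elim (fun h => k2 n y (by linarith)) (k3 n y)⟩⟩, k4⟩
  have mh := mem h hh h0 h3 bh
  have mf' : f' ∈ EE := by
    refine mem f' (fun n => ?_) (fun n y hy => ?_) (fun n y hy => ?_) bf' <;>
      by_cases hn : wt n ≤ δ <;> simp only [hf', hn, dif_pos, dif_neg, not_false_eq_true]
    · exact hf _
    · exact one_mem _
    · exact f0 _ _ hy
    · rfl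
    · exact f3 _ _ hy
    · rfl
  have mh' : h' ∈ EE := by
    refine mem h' (fun n => ?_) (fun n y hy => ?_) (fun n y hy => ?_) bh' <;>
      by_cases hn : wt n ≤ δ <;> simp only [hh', hn, dif_pos, dif_neg, not_false_eq_true]
    · exact hh _
    · exact one_mem _
    · exact h0 _ _ hy
    · rfl
    · exact h3 _ _ hy
    · rfl
  have hg'm : ∀ n, g' n ∈ Dif := fun n => by
    by_cases hn : wt n ≤ δ <;> simp only [hg', hn, dif_pos, dif_neg, not_false_eq_true]
    · exact hg _
    · exact one_mem _
  have sg : St g' fun n => if hn : wt n ≤ δ then t ⟨n, hn⟩ else 0 := by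
    obtain ⟨C, hC, hb⟩ := ((bg 0).dexpm1 hg fun i => wt_le _).bd0
    refine ⟨hg'm, bg', max (C * (3 * A + 2)) (3 * A + 2), fun n => ?_⟩
    by_cases hn : wt n ≤ δ <;> simp only [hg', hn, dif_pos, dif_neg, not_false_eq_true]
    · refine ⟨?_, fun y hy => g0 _ _ ?_, fun y hy => g3 _ _ ((le_max_right _ _).trans hy)⟩
      · set i : {i // wt i ≤ δ} := ⟨n, hn⟩
        have sm : Sm fun y => g i y - y := (Dif.sm (hg i)).sub contDiff_id
        have := mvt_bd sm (C := C) (fun y => by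
          rw [deriv_fun_sub ((Dif.sm (hg i)).diff y) differentiableAt_fun_id, deriv_id'']
          exact (hb i y).trans (mul_le_of_le_one_right hC (wt_le _))) (3 * A + 2) 0
        rw [g3 i _ le_rfl, g0 i 0 le_rfl, sub_zero, sub_zero, sub_zero, add_sub_cancel_left,
          abs_of_pos (by positivity : (0:ℝ) < 3 * A + 2)] at this
        exact this.trans (le_max_left _ _)
      · have : (0:ℝ) ≤ 3 * A + 2 := by positivity
        linarith [le_max_right (C * (3 * A + 2)) (3 * (A:ℝ) + 2)]
    · refine ⟨by simp only [abs_zero]; positivity, fun y _ => rfl, fun y _ => by simp⟩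
  have hAp : 0 < A := by omega
  have rel : Tt 1 * f' * g' = g' * Tt 1 * (Dt A * (f' * h') * (Dt A)⁻¹) := by
    funext n
    by_cases hn : wt n ≤ δ <;>
      simp only [Pi.mul_apply, Pi.inv_apply, Tt, Dt, hf', hg', hh', hn, dif_pos, dif_neg, not_false_eq_true]
    · exact e ⟨n, hn⟩
    · simp
  obtain ⟨Q, _, φ, φm, φg⟩ := exists_phi
  have gh' := good_rel φm φg mf' sg mh' (by omega) rel
  obtain ⟨N, hN⟩ := eventually_atTop.1 (wt_tendsto.eventually_le_const hδ)
  have := (good_fin (mul_mem mh (inv_mem mh')) (N := N) fun n hn => by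
    simp [hh', hN n hn]).mul gh'
  rwa [inv_mul_cancel_right] at this
end

noncomputable section
variable {ι : Type*}

def perF (v : ℝ → ℝ) (θ : ℝ) : ℝ := v (θ - ⌊θ + 1 / 2⌋)
theorem perF_per (v : ℝ → ℝ) (θ : ℝ) : perF v (θ + 1) = perF v θ := by
  rw [perF, perF, show θ + 1 + 1 / 2 = θ + 1 / 2 + 1 by ring, Int.floor_add_one]
  push_cast; congr 1; ring
theorem abs_int_ge {m : ℤ} (h : m ≠ 0) : (1:ℝ) ≤ |(m:ℝ)| := by
  exact_mod_cast Int.one_le_abs h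
theorem perF_eq {v : ℝ → ℝ} (h : ∀ y, 7 / 16 ≤ |y| → v y = 0) {θ : ℝ} (k : ℤ) (hk : |θ - k| < 9 / 16) :
    perF v θ = v (θ - k) := by
  rw [perF]
  set r := ⌊θ + 1 / 2⌋ with hr
  by_cases e : r = k
  · rw [e]
  · have h1 := Int.floor_le (θ + 1 / 2)
    have h2 := Int.lt_floor_add_one (θ + 1 / 2)
    rw [← hr] at h1 h2
    have h3 : |θ - r| ≤ 1 / 2 := abs_le.2 ⟨by linarith, by linarith⟩
    have h4 := abs_int_ge (sub_ne_zero.2 e)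
    push_cast at h4
    have h5 : |(r:ℝ) - k| ≤ |θ - k| + |θ - r| := by
      have := abs_sub (θ - k) (θ - r)
      rwa [show θ - k - (θ - r) = (r:ℝ) - k by ring] at this
    rw [h _ (by linarith), h _ (by linarith)]
theorem perF_nhds {v : ℝ → ℝ} (h : ∀ y, 7 / 16 ≤ |y| → v y = 0) (θ : ℝ) :
    ∃ k : ℤ, perF v =ᶠ[𝓝 θ] fun z => v (z - k) := by
  refine ⟨⌊θ + 1 / 2⌋, ?_⟩
  have h1 := Int.floor_le (θ + 1 / 2)
  have h2 := Int.lt_floor_add_one (θ + 1 / 2)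
  have : IsOpen {z : ℝ | |z - ⌊θ + 1 / 2⌋| < 9 / 16} :=
    isOpen_lt (by fun_prop) continuous_const
  refine mem_of_superset (this.mem_nhds ?_) fun z hz => perF_eq h _ hz
  show |θ - ⌊θ + 1 / 2⌋| < 9 / 16
  exact abs_lt.2 ⟨by linarith, by linarith⟩
theorem perF_sm {v : ℝ → ℝ} (hv : Sm v) (h : ∀ y, 7 / 16 ≤ |y| → v y = 0) : Sm (perF v) := by
  rw [Sm, contDiff_iff_contDiffAt]
  intro θ
  obtain ⟨k, hk⟩ := perF_nhds h θ
  exact ContDiffAt.congr_of_eventuallyEq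
    ((hv.comp (contDiff_id.sub contDiff_const)).contDiffAt) hk

/-! the homomorphism to the circle -/
def IB : Set ℝ := Ico (-1 / 2) (-1 / 2 + 1)
theorem Sp_IB {p : Equiv.Perm ℝ} (hp : p ∈ Sp (7 / 16)) (x : ℝ) : p x ∈ IB ↔ x ∈ IB := by
  have m := Dif.mono hp.1
  have e1 := hp.2 (-1 / 2) (by norm_num [abs_of_neg])
  have e2 := hp.2 (-1 / 2 + 1) (by norm_num [abs_of_pos])
  simp only [IB, mem_Ico]
  refine and_congr ?_ ?_
  · conv_lhs => rw [← e1]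
    exact m.le_iff_le
  · conv_lhs => rw [← e2]
    exact m.lt_iff_lt
instance : Fact ((0:ℝ) < 1) := ⟨one_pos⟩
def eIB : S1 ≃ IB := AddCircle.equivIco (1:ℝ) (-1 / 2)
theorem eIB_symm (x : IB) : eIB.symm x = ((x : ℝ) : S1) := rfl
open Classical in
def pi1 (p : Equiv.Perm ℝ) : Equiv.Perm S1 :=
  if h : ∀ x, p x ∈ IB ↔ x ∈ IB then (eIB.trans (p.subtypePerm h)).trans eIB.symm else 1
theorem pi1_apply {p : Equiv.Perm ℝ} (hp : p ∈ Sp (7 / 16)) {x : ℝ} (hx : x ∈ IB) :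
    pi1 p (x : S1) = ((p x : ℝ) : S1) := by
  have h := Sp_IB hp
  have e : eIB (x : S1) = ⟨x, hx⟩ := by
    rw [← Equiv.eq_symm_apply, eIB_symm]
  rw [pi1, dif_pos h, Equiv.trans_apply, Equiv.trans_apply, e, eIB_symm]
  rfl
theorem exists_rep (z : S1) : ∃ x ∈ IB, z = (x : S1) :=
  ⟨eIB z, (eIB z).2, by rw [← eIB_symm, Equiv.symm_apply_apply]⟩
theorem pi1_one : pi1 1 = 1 := by
  ext z
  obtain ⟨x, hx, rfl⟩ := exists_rep z
  rw [pi1_apply (one_mem _) hx]; rfl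
theorem pi1_mul {p q : Equiv.Perm ℝ} (hp : p ∈ Sp (7 / 16)) (hq : q ∈ Sp (7 / 16)) :
    pi1 (p * q) = pi1 p * pi1 q := by
  ext z
  obtain ⟨x, hx, rfl⟩ := exists_rep z
  rw [pi1_apply (mul_mem hp hq) hx, Equiv.Perm.mul_apply, Equiv.Perm.mul_apply, pi1_apply hq hx,
    pi1_apply hp ((Sp_IB hq x).2 hx)]
theorem coe_sub_int (θ : ℝ) (m : ℤ) : ((θ - m : ℝ) : S1) = (θ : S1) := by
  have := AddCircle.coe_add_period (1:ℝ)
  rw [QuotientAddGroup.eq, AddSubgroup.mem_zmultiples_iff]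
  exact ⟨m, by simp⟩
theorem pi1_lift {p : Equiv.Perm ℝ} (hp : p ∈ Sp (7 / 16)) : HasLift (pi1 p) := by
  have hv : Sm fun y => p y - y := (Dif.sm hp.1).sub contDiff_id
  have h0 : ∀ y, 7 / 16 ≤ |y| → (fun y => p y - y) y = 0 := fun y hy => by simp [hp.2 y hy]
  refine ⟨fun θ => θ + perF (fun y => p y - y) θ, contDiff_id.add (perF_sm hv h0), fun x => ?_,
    fun x => ?_, fun x => ?_⟩
  · beta_reduce; rw [perF_per]; ring
  · obtain ⟨k, hk⟩ := perF_nhds h0 x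
    have : (fun θ => θ + perF (fun y => p y - y) θ) =ᶠ[𝓝 x] fun θ => p (θ - k) + k := by
      filter_upwards [hk] with z hz
      rw [hz]; ring
    rw [this.deriv_eq, deriv_add_const, deriv_comp_sub_const]
    exact Dif.pos hp.1 _
  · have h1 := Int.floor_le (x + 1 / 2)
    have h2 := Int.lt_floor_add_one (x + 1 / 2)
    rw [← coe_sub_int x ⌊x + 1 / 2⌋, pi1_apply hp ⟨by linarith, by linarith⟩,
      ← coe_sub_int (x + perF (fun y => p y - y) x) ⌊x + 1 / 2⌋, perF]
    congr 1; ring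

/-! restriction to a fundamental domain -/
open Classical in
def kF (H : Equiv.Perm ℝ) (y : ℝ) : ℝ := if |y| ≤ 1 / 2 then H y else y
section
variable {H : Equiv.Perm ℝ} (hH : H ∈ Dif) (h0 : ∀ y, 3 / 8 ≤ |y| → |y| ≤ 5 / 8 → H y = y)
include h0
theorem kF_out {y : ℝ} (hy : 3 / 8 ≤ |y|) : kF H y = y := by
  unfold kF; split_ifs with h
  · exact h0 y hy (by linarith)
  · rfl
theorem kF_in {y : ℝ} (hy : |y| ≤ 5 / 8) : kF H y = H y := by
  unfold kF; split_ifs with h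
  · rfl
  · exact (h0 y (by linarith) hy).symm
theorem kF_nhds (y : ℝ) : kF H =ᶠ[𝓝 y] H ∨ kF H =ᶠ[𝓝 y] ⇑(1 : Equiv.Perm ℝ) := by
  rcases lt_or_ge (|y|) (5 / 8) with h | h
  · left
    exact mem_of_superset ((isOpen_lt continuous_abs continuous_const).mem_nhds h)
      fun z hz => kF_in h0 (le_of_lt hz)
  · right
    exact mem_of_superset ((isOpen_lt continuous_const continuous_abs).mem_nhds
      (show 3 / 8 < |y| by linarith)) fun z hz => kF_out h0 (le_of_lt hz)
include hH
theorem kF_mem : ⇑(toPerm (kF H)) = kF H ∧ toPerm (kF H) ∈ Sp (3 / 8) := by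
  have s1 : Sm (kF H) := contDiff_iff_contDiffAt.2 fun y => by
    rcases kF_nhds h0 y with h | h
    · exact (Dif.sm hH).contDiffAt.congr_of_eventuallyEq h
    · exact (Dif.sm (one_mem Dif)).contDiffAt.congr_of_eventuallyEq h
  have d1 : ∀ y, 0 < deriv (kF H) y := fun y => by
    rcases kF_nhds h0 y with h | h
    · rw [h.deriv_eq]; exact Dif.pos hH y
    · rw [h.deriv_eq]; exact Dif.pos (one_mem Dif) y
  have b1 : ∀ y, |kF H y - y| ≤ 1 := fun y => by
    rcases le_or_gt (|y|) (1 / 2) with h | h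
    · rw [kF_in h0 (by linarith)]
      rw [abs_le] at h
      have m1 := (Dif.mono hH).monotone h.1
      have m2 := (Dif.mono hH).monotone h.2
      rw [h0 (-(1 / 2)) (by norm_num [abs_of_pos]) (by norm_num [abs_of_pos])] at m1
      rw [h0 (1 / 2) (by norm_num [abs_of_pos]) (by norm_num [abs_of_pos])] at m2
      exact abs_le.2 ⟨by linarith [h.1, h.2], by linarith [h.1, h.2]⟩
    · rw [kF_out h0 (by linarith)]; simp
  obtain ⟨e, m⟩ := mkDif s1 d1 (surj_of_bdd s1.continuous b1)
  exact ⟨e, m, fun y hy => by rw [e, kF_out h0 hy]⟩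
end
theorem BO.kF {H : ι → Equiv.Perm ℝ} {w : ι → ℝ} {s : ℕ} (hH : ∀ i, H i ∈ Dif)
    (h0 : ∀ i y, 3 / 8 ≤ |y| → |y| ≤ 5 / 8 → H i y = y) (h : BO s (fun i => lg (H i)) w) :
    BO s (fun i => lg (toPerm (kF (H i)))) w := by
  obtain ⟨h1, h2, C, hC, h3⟩ := h
  have e := fun i => (kF_mem (hH i) (h0 i)).1
  refine ⟨h1, fun i => Sm_lg (kF_mem (hH i) (h0 i)).2.1, C, hC, fun i j hj x => ?_⟩
  have key : ∀ q : Equiv.Perm ℝ, _root_.kF (H i) =ᶠ[𝓝 x] q → lg (toPerm (_root_.kF (H i))) =ᶠ[𝓝 x] lg q := by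
    intro q hq
    filter_upwards [hq.eventuallyEq_nhds] with z hz
    rw [lg, lg, e i, hz.deriv_eq]
  rcases kF_nhds (h0 i) x with h | h
  · rw [(key _ h).iteratedDeriv_eq]; exact h3 i j hj x
  · rw [(key _ h).iteratedDeriv_eq, lg_one,
      show iteratedDeriv j (fun _ : ℝ => (0:ℝ)) x = 0 by simp, abs_zero]
    exact mul_nonneg hC (h1 i)

/-! small displacement gives small log-derivative -/
theorem lgof {v : ι → ℝ → ℝ} {w : ι → ℝ} (hw : ∀ i, w i ≤ 1) (hv : ∀ s, BO s v w)
    (hd : ∀ i x, |deriv (v i) x| ≤ 1 / 2) {M : ι → ℝ} (hM : ∀ i x, |v i x| ≤ M i) :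
    (∀ i, ⇑(toPerm fun x => x + v i x) = fun x => x + v i x) ∧
    (∀ i, toPerm (fun x => x + v i x) ∈ Dif) ∧
    ∀ s, BO s (fun i => lg (toPerm fun x => x + v i x)) w := by
  have sv : ∀ i, Sm (v i) := (hv 0).2.1
  have sF : ∀ i, Sm fun x => x + v i x := fun i => contDiff_id.add (sv i)
  have dF : ∀ i x, deriv (fun x => x + v i x) x = 1 + deriv (v i) x := fun i x => by
    rw [deriv_fun_add differentiableAt_fun_id ((sv i).diff x)]; simp
  have pF : ∀ i x, 1 / 2 ≤ 1 + deriv (v i) x := fun i x => by linarith [(abs_le.1 (hd i x)).1]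
  have mk := fun i => mkDif (sF i) (fun x => by rw [dF]; linarith [pF i x])
    (surj_of_bdd (sF i).continuous (C := M i) fun x => by simpa using hM i x)
  have m := fun i => (mk i).2
  refine ⟨fun i => (mk i).1, m, fun s => ?_⟩
  have el : ∀ i x, lg (toPerm fun x => x + v i x) x = Real.log (1 + deriv (v i) x) := fun i x => by
    rw [lg, (mk i).1, dF]
  have sl := fun i => Sm_lg (m i)
  obtain ⟨C, hC, hb⟩ := (hv 1).der.bd0
  have b0 : BO 0 (fun i => lg (toPerm fun x => x + v i x)) w := by
    refine BO.mk0 (C := 2 * C) (hv 0).1 sl fun i x => ?_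
    have h1 := Real.log_le_sub_one_of_pos (by linarith [pF i x] : 0 < 1 + deriv (v i) x)
    have h2 := Real.one_sub_inv_le_log_of_pos (by linarith [pF i x] : 0 < 1 + deriv (v i) x)
    have h3 := hb i x
    set t := deriv (v i) x
    have h4 : 1 - (1 + t)⁻¹ = t / (1 + t) := by
      have : 1 + t ≠ 0 := ne_of_gt (by linarith [pF i x])
      field_simp; ring
    have h5 : |t / (1 + t)| ≤ 2 * |t| := by
      rw [abs_div, abs_of_pos (by linarith [pF i x] : 0 < 1 + t), div_le_iff₀ (by linarith [pF i x])]
      nlinarith [pF i x, abs_nonneg t]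
    rw [el, abs_le]
    constructor
    · linarith [neg_abs_le (t / (1 + t))]
    · linarith [le_abs_self t, abs_nonneg t]
  have ed : ∀ i x, deriv (lg (toPerm fun x => x + v i x)) x =
      deriv (deriv (v i)) x * Real.exp (-lg (toPerm fun x => x + v i x) x) := fun i x => by
    rw [show lg (toPerm fun x => x + v i x) = fun x => Real.log (1 + deriv (v i) x) from funext (el i),
      deriv.log (((sv i).der.diff x).const_add 1) (by linarith [pF i x]), deriv_const_add]
    simp only []
    rw [Real.exp_neg, Real.exp_log (by linarith [pF i x])]; rfl
  induction s with
  | zero => exact b0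
  | succ s ih =>
    refine BO.succ b0 (BO.congr ?_ ed)
    exact (hv (s + 2)).der.der.mul1 ((ih.neg.one hw).exp)
end

noncomputable section
variable {ι : Type*}

open Classical in
theorem real_word {k : ℕ → Equiv.Perm ℝ} (hk : ∀ n, k n ∈ Sp (3 / 8))
    (bk : ∀ s, BO s (fun n => lg (k n)) wt) :
    ∃ S : Finset (Equiv.Perm ℝ), (S : Set (Equiv.Perm ℝ)) ⊆ Sp (7 / 16) ∧ ∃ C : ℕ, ∀ n,
      Wd (S : Set (Equiv.Perm ℝ)) (C * (n + 1)) (k n) := by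
  have h4 : (0:ℝ) < 4 := by norm_num
  set κ : ℕ → Equiv.Perm ℝ := fun n => tr (3 / 2) * (Dl 4 * k n * (Dl 4)⁻¹) * (tr (3 / 2))⁻¹ with hκ
  have m1 : ∀ n, Dl 4 * k n * (Dl 4)⁻¹ ∈ Dif := fun n =>
    mul_mem (mul_mem (Dl_mem h4) (hk n).1) (inv_mem (Dl_mem h4))
  have m2 : ∀ n, κ n ∈ Dif := fun n => mul_mem (mul_mem (tr_mem _) (m1 n)) (inv_mem (tr_mem _))
  have ap : ∀ n y, κ n y = 4 * k n ((y - 3 / 2) / 4) + 3 / 2 := fun n y => by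
    simp only [hκ, Equiv.Perm.mul_apply, tr_apply, tr_inv_apply, Dl_apply h4, Dl_inv_apply h4]
  have fx : ∀ n y, 3 / 8 ≤ |(y - 3 / 2) / 4| → κ n y = y := fun n y h => by
    rw [ap, (hk n).2 _ h]; ring
  obtain ⟨ω0, hω0, H⟩ := good_main m2
    (fun n y hy => fx n y (by rw [abs_of_neg (by linarith)]; linarith))
    (fun n y hy => fx n y (by rw [abs_of_pos (by linarith)]; linarith))
    (fun s => ((bk s).conj_Dl (fun n => (hk n).1) h4).conj_tr m1 _)
  set ω := min ω0 (1 / 32) with hω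
  have p : 0 < ω := lt_min hω0 (by norm_num)
  have q : ω ≤ 1 / 32 := min_le_right _ _
  obtain ⟨S, hS, C, hW⟩ := H ω p (min_le_left _ _)
  obtain ⟨Z, hZ, eZ⟩ := exists_aff (a := 3 / 8) (b := 7 / 16) (μ := 4 * ω) (c := 3 / 16 + 3 * ω / 2)
    (by norm_num) (by norm_num) (by linarith) (by linarith)
    (by rw [abs_of_pos (by linarith)]; linarith)
  have key : ∀ n, k n = Z⁻¹ * lev ω 0 (κ n) * Z := fun n => by
    have e : Z * k n * Z⁻¹ = (lv ω 0 * (tr (3 / 2) * Dl 4)) * k n * (lv ω 0 * (tr (3 / 2) * Dl 4))⁻¹ := by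
      refine conj_trunc (K := fun y => |y| ≤ 3 / 8) (fun y hy => (hk n).2 y (not_le.1 hy).le)
        fun y hy => ?_
      rw [eZ y hy]
      simp only [Equiv.Perm.mul_apply, lv_apply p, tr_apply, Dl_apply h4]
      ring
    have e2 : lev ω 0 (κ n) = Z * k n * Z⁻¹ := by
      rw [e, lev, hκ]; group
    rw [e2]; group
  refine ⟨insert Z S, ?_, C + 2, fun n => ?_⟩
  · rw [Finset.coe_insert]; exact insert_subset hZ hS
  · rw [key]
    have g : Wd ((insert Z S : Finset (Equiv.Perm ℝ)) : Set (Equiv.Perm ℝ)) 1 Z := Wd.gen (by simp)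
    refine ((g.inv.mul ((hW n).sub (by simp))).mul g).mono ?_
    nlinarith

theorem per_iter {u : ℝ → ℝ} (hp : Function.Periodic u 1) (j : ℕ) :
    Function.Periodic (iteratedDeriv j u) 1 := by
  induction j with
  | zero => simpa using hp
  | succ j ih => rw [iteratedDeriv_succ]; exact per_der ih
theorem per_bdd {u : ℝ → ℝ} (hu : Sm u) (hp : Function.Periodic u 1) (j : ℕ) :
    ∃ C, ∀ x, |iteratedDeriv j u x| ≤ C :=
  Sm.bdd_of_per (hu.iter j).continuous (per_iter hp j)

theorem disp_of {n : ℕ} {f : Equiv.Perm S1} {ε : ℝ} (hf : HasLift f) (hd : distC n f 1 < ε) :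
    ∃ u : ℝ → ℝ, Sm u ∧ Function.Periodic u 1 ∧ (∀ x : ℝ, f (x : S1) = ((x + u x : ℝ) : S1)) ∧
      ∀ j ≤ n, ∀ x, |iteratedDeriv j u x| ≤ ε := by
  obtain ⟨F0, hF0⟩ := hf
  have hid : IsLift 1 (fun x => x) := ⟨contDiff_id, fun x => rfl, fun x => by simp, fun x => rfl⟩
  obtain ⟨d, ⟨F, G, hF, hG, rfl⟩, hlt⟩ := exists_lt_of_csInf_lt
    (s := {d | ∃ F G, IsLift f F ∧ IsLift 1 G ∧ d = liftDist n F G}) ⟨_, F0, _, hF0, hid, rfl⟩ hd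
  have sF : Sm F := hF.1
  have sG : Sm G := hG.1
  have su : Sm fun x => F x - G x := sF.sub sG
  have pu : Function.Periodic (fun x => F x - G x) 1 := fun x => by
    simp only [hF.2.1, hG.2.1]; ring
  refine ⟨fun x => F x - G x, su, pu, fun x => ?_, fun j hj x => ?_⟩
  · have := hG.2.2.2 x
    rw [Equiv.Perm.one_apply] at this
    rw [hF.2.2.2, AddCircle.coe_add, AddCircle.coe_sub, this]; abel
  · have e : ∀ j x, iteratedDeriv j F x - iteratedDeriv j G x = iteratedDeriv j (fun x => F x - G x) x :=
      fun j x => (iter_sub sF sG j x).symm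
    refine le_trans ?_ hlt.le
    unfold liftDist
    simp only [e]
    have b1 : BddAbove (range fun x => |iteratedDeriv j (fun x => F x - G x) x|) := by
      obtain ⟨C, hC⟩ := per_bdd su pu j
      exact ⟨C, by rintro _ ⟨y, rfl⟩; exact hC y⟩
    refine (le_ciSup b1 x).trans ?_
    exact le_ciSup (f := fun j : Fin (n + 1) => ⨆ x, |iteratedDeriv (j:ℕ) (fun x => F x - G x) x|)
      (Set.finite_range _).bddAbove ⟨j, by omega⟩

theorem BO.ofdisp {u : ℕ → ℝ → ℝ} (su : ∀ n, Sm (u n)) (pu : ∀ n, Function.Periodic (u n) 1)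
    (bu : ∀ n, ∀ j ≤ n, ∀ x, |iteratedDeriv j (u n) x| ≤ _root_.wt n) (r : ℕ) : BO r u _root_.wt := by
  have h := fun n j => per_bdd (su n) (pu n) j
  choose K hK using h
  have pos : ∀ n j, 0 ≤ |K n j| / _root_.wt n := fun n j => div_nonneg (abs_nonneg _) (wt_pos n).le
  refine ⟨fun n => (wt_pos n).le, su, 1 + ∑ n ∈ Finset.range r, ∑ j ∈ Finset.range (r + 1), |K n j| / _root_.wt n,
    ?_, fun n j hj x => ?_⟩
  · exact add_nonneg zero_le_one (Finset.sum_nonneg fun n _ => Finset.sum_nonneg fun j _ => pos n j)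
  · have s0 : 0 ≤ ∑ n ∈ Finset.range r, ∑ j ∈ Finset.range (r + 1), |K n j| / _root_.wt n :=
      Finset.sum_nonneg fun n _ => Finset.sum_nonneg fun j _ => pos n j
    rcases le_or_gt r n with h | h
    · refine (bu n j (hj.trans h) x).trans ?_
      nlinarith [wt_pos n]
    · have h1 : |K n j| / _root_.wt n ≤ ∑ j ∈ Finset.range (r + 1), |K n j| / _root_.wt n :=
        Finset.single_le_sum (f := fun j => |K n j| / _root_.wt n) (fun j _ => pos n j)
          (Finset.mem_range.2 (by omega))
      have h2 := Finset.single_le_sum (f := fun n => ∑ j ∈ Finset.range (r + 1), |K n j| / _root_.wt n)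
        (fun n _ => Finset.sum_nonneg fun j _ => pos n j) (Finset.mem_range.2 h)
      have h3 : |K n j| ≤ (1 + ∑ n ∈ Finset.range r, ∑ j ∈ Finset.range (r + 1), |K n j| / _root_.wt n) *
          _root_.wt n := by
        rw [← div_le_iff₀ (wt_pos n)]
        linarith
      exact ((hK n j x).trans (le_abs_self _)).trans h3

theorem BO.cutoff {u : ℕ → ℝ → ℝ} {w : ℕ → ℝ} {r : ℕ} (h : BO r u w) (N : ℕ) :
    BO r (fun n => if N ≤ n then u n else fun _ => 0) w := by
  obtain ⟨h1, h2, C, hC, h3⟩ := h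
  refine ⟨h1, fun n => ?_, C, hC, fun n j hj x => ?_⟩
  · beta_reduce; split_ifs
    · exact h2 n
    · exact contDiff_const
  · beta_reduce; split_ifs
    · exact h3 n j hj x
    · rw [iter_zero_fn, abs_zero]; exact mul_nonneg hC (h1 n)

def cut (y : ℝ) : ℝ := Real.smoothTransition (((3 / 8) ^ 2 - y ^ 2) / ((3 / 8) ^ 2 - (1 / 4) ^ 2))
theorem cut_sm : Sm cut := by
  have sst : Sm Real.smoothTransition := Real.smoothTransition.contDiff
  exact sst.comp ((contDiff_const.sub (contDiff_id.pow 2)).div_const _)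
theorem cut_out {y : ℝ} (h : 3 / 8 ≤ |y|) : cut y = 0 := by
  refine Real.smoothTransition.zero_of_nonpos (div_nonpos_of_nonpos_of_nonneg ?_ (by norm_num))
  rw [← sq_abs y]; nlinarith
theorem cut_in {y : ℝ} (h : |y| ≤ 1 / 4) : cut y = 1 := by
  refine Real.smoothTransition.one_of_one_le ?_
  rw [le_div_iff₀ (by norm_num), ← sq_abs y]; nlinarith [abs_nonneg y]
theorem cut0 : ∀ y, 7 / 16 ≤ |y| → cut y = 0 := fun y h => cut_out (by linarith)
def cc : ℝ → ℝ := perF cut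
theorem cc_sm : Sm cc := perF_sm cut_sm cut0
theorem cc_per : Function.Periodic cc 1 := perF_per cut
theorem cc_zero {y : ℝ} (h1 : 3 / 8 ≤ |y|) (h2 : |y| ≤ 5 / 8) : cc y = 0 := by
  rw [cc, perF]
  apply cut_out
  by_cases h : ⌊y + 1 / 2⌋ = 0
  · rw [h]; simpa using h1
  · have h4 := abs_int_ge h
    have := abs_sub_abs_le_abs_sub (⌊y + 1 / 2⌋ : ℝ) y
    rw [abs_sub_comm] at this
    linarith
theorem cc_one {y : ℝ} (h1 : 3 / 8 ≤ |y|) (h2 : |y| ≤ 5 / 8) : cc (y - 1 / 2) = 1 := by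
  rcases le_total 0 y with h | h
  · rw [abs_of_nonneg h] at h1 h2
    have : |y - 1 / 2| ≤ 1 / 4 := abs_le.2 ⟨by linarith, by linarith⟩
    rw [cc, perF_eq cut0 0 (by push_cast; rw [sub_zero]; linarith)]
    exact cut_in (by push_cast; rwa [sub_zero])
  · rw [abs_of_nonpos h] at h1 h2
    have : |y - 1 / 2 - ((-1 : ℤ):ℝ)| ≤ 1 / 4 := by push_cast; exact abs_le.2 ⟨by linarith, by linarith⟩
    rw [cc, perF_eq cut0 (-1) (by linarith)]
    exact cut_in this

/-- the fragmentation into two pieces -/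
theorem frag {h : ℕ → Equiv.Perm S1} {u : ℕ → ℝ → ℝ} (su : ∀ n, Sm (u n))
    (pu : ∀ n, Function.Periodic (u n) 1) (bu : ∀ n, ∀ j ≤ n, ∀ x, |iteratedDeriv j (u n) x| ≤ wt n)
    (eu : ∀ n, ∀ x : ℝ, h n (x : S1) = ((x + u n x : ℝ) : S1)) :
    ∃ (N : ℕ) (k1 k2 : ℕ → Equiv.Perm ℝ), (∀ n, k1 n ∈ Sp (3 / 8)) ∧ (∀ n, k2 n ∈ Sp (3 / 8)) ∧
      (∀ s, BO s (fun n => lg (k1 n)) wt) ∧ (∀ s, BO s (fun n => lg (k2 n)) wt) ∧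
      ∀ n ≥ N, h n = pi1 (k1 n) * ((rot ((1 / 2 : ℝ) : S1))⁻¹ * pi1 (k2 n) * rot ((1 / 2 : ℝ) : S1)) := by
  have B := BO.ofdisp su pu bu
  have Bc : ∀ s, BO s (fun n x => cc x * u n x) wt := fun s =>
    (BO.const cc_sm (per_bdd cc_sm cc_per) s).one_mul (B s)
  have ev : ∀ v : ℕ → ℝ → ℝ, (∀ s, BO s v wt) → ∃ N, ∀ n ≥ N, ∀ x, |deriv (v n) x| ≤ 1 / 2 := by
    intro v hv
    obtain ⟨C, hC, hb⟩ := (hv 1).der.bd0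
    have := (wt_tendsto.const_mul C).eventually_le_const
      (show C * 0 < 1 / 2 by rw [mul_zero]; norm_num)
    obtain ⟨N, hN⟩ := eventually_atTop.1 this
    exact ⟨N, fun n hn x => (hb n x).trans (hN n hn)⟩
  obtain ⟨N1, hN1⟩ := ev _ B
  obtain ⟨N2, hN2⟩ := ev _ Bc
  set N := max N1 N2
  set U : ℕ → ℝ → ℝ := fun n => if N ≤ n then u n else fun _ => 0 with hU
  set V : ℕ → ℝ → ℝ := fun n => if N ≤ n then (fun x => cc x * u n x) else fun _ => 0 with hV
  have eV : ∀ n x, V n x = cc x * U n x := fun n x => by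
    simp only [hU, hV]; split_ifs <;> simp
  have pU : ∀ n, Function.Periodic (U n) 1 := fun n => by
    simp only [hU]; split_ifs
    · exact pu n
    · intro x; rfl
  have pV : ∀ n, Function.Periodic (V n) 1 := fun n x => by
    rw [eV, eV, cc_per, pU]
  have BU : ∀ s, BO s U wt := fun s => (B s).cutoff N
  have BV : ∀ s, BO s V wt := fun s => (Bc s).cutoff N
  have dU : ∀ n x, |deriv (U n) x| ≤ 1 / 2 := fun n x => by
    simp only [hU]; split_ifs with hn
    · exact hN1 n ((le_max_left _ _).trans hn) x
    · simp
  have dV : ∀ n x, |deriv (V n) x| ≤ 1 / 2 := fun n x => by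
    simp only [hV]; split_ifs with hn
    · exact hN2 n ((le_max_right _ _).trans hn) x
    · simp
  have MU := fun n => Sm.bdd_of_per ((BU 0).2.1 n).continuous (pU n)
  have MV := fun n => Sm.bdd_of_per ((BV 0).2.1 n).continuous (pV n)
  choose M hM using MU
  choose M' hM' using MV
  obtain ⟨eF, mF, bF⟩ := lgof wt_le BU dU hM
  obtain ⟨eP, mP, bP⟩ := lgof wt_le BV dV hM'
  set F : ℕ → Equiv.Perm ℝ := fun n => toPerm fun x => x + U n x with hF
  set P : ℕ → Equiv.Perm ℝ := fun n => toPerm fun x => x + V n x with hP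
  have aF : ∀ n x, F n x = x + U n x := fun n x => congrFun (eF n) x
  have aP : ∀ n x, P n x = x + V n x := fun n x => congrFun (eP n) x
  have f1 : ∀ n y, 3 / 8 ≤ |y| → |y| ≤ 5 / 8 → P n y = y := fun n y h1 h2 => by
    rw [aP, eV, cc_zero h1 h2]; ring
  set Q : ℕ → Equiv.Perm ℝ := fun n => tr (1 / 2) * ((P n)⁻¹ * F n) * (tr (1 / 2))⁻¹ with hQ
  have aQ : ∀ n y, Q n y = (P n)⁻¹ (F n (y - 1 / 2)) + 1 / 2 := fun n y => by
    simp only [hQ, Equiv.Perm.mul_apply, tr_apply, tr_inv_apply]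
  have mH : ∀ n, (P n)⁻¹ * F n ∈ Dif := fun n => mul_mem (inv_mem (mP n)) (mF n)
  have mQ : ∀ n, Q n ∈ Dif := fun n => mul_mem (mul_mem (tr_mem _) (mH n)) (inv_mem (tr_mem _))
  have f2 : ∀ n y, 3 / 8 ≤ |y| → |y| ≤ 5 / 8 → Q n y = y := fun n y h1 h2 => by
    have : F n (y - 1 / 2) = P n (y - 1 / 2) := by rw [aF, aP, eV, cc_one h1 h2, one_mul]
    rw [aQ, this, pinv1]; ring
  have bQ : ∀ s, BO s (fun n => lg (Q n)) wt := fun s =>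
    (((bP s).lginv mP wt_le).lgmul (bF s) (fun n => inv_mem (mP n)) mF wt_le).conj_tr mH _
  refine ⟨N, fun n => toPerm (kF (P n)), fun n => toPerm (kF (Q n)), fun n => (kF_mem (mP n) (f1 n)).2,
    fun n => (kF_mem (mQ n) (f2 n)).2, fun s => (bP s).kF mP f1, fun s => (bQ s).kF mQ f2,
    fun n hn => ?_⟩
  have q1 : ∀ y : ℝ, pi1 (toPerm (kF (P n))) (y : S1) = ((P n y : ℝ) : S1) := fun y => by
    have h1 := Int.floor_le (y + 1 / 2)
    have h2 := Int.lt_floor_add_one (y + 1 / 2)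
    have hI : y - ⌊y + 1 / 2⌋ ∈ IB := ⟨by linarith, by linarith⟩
    rw [← coe_sub_int y ⌊y + 1 / 2⌋, pi1_apply (Sp.mono (by norm_num) (kF_mem (mP n) (f1 n)).2) hI,
      (kF_mem (mP n) (f1 n)).1, kF_in (f1 n) (abs_le.2 ⟨by linarith, by linarith⟩),
      ← coe_sub_int (P n y) ⌊y + 1 / 2⌋, aP, aP]
    have := (pV n).sub_int_mul_eq (x := y) ⌊y + 1 / 2⌋
    rw [mul_one] at this
    rw [this]; congr 1; ring
  have q2 : ∀ w ∈ IB, pi1 (toPerm (kF (Q n))) (w : S1) = ((Q n w : ℝ) : S1) := fun w hI => by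
    rw [pi1_apply (Sp.mono (by norm_num) (kF_mem (mQ n) (f2 n)).2) hI, (kF_mem (mQ n) (f2 n)).1,
      kF_in (f2 n) (abs_le.2 ⟨by linarith [hI.1], by linarith [hI.2]⟩)]
  ext z
  obtain ⟨w, hw, e⟩ := exists_rep (z + ((1 / 2 : ℝ) : S1))
  have ez : z = ((w - 1 / 2 : ℝ) : S1) := by
    rw [AddCircle.coe_sub, ← e]; abel
  have r1 : rot ((1 / 2 : ℝ) : S1) z = (w : S1) := e
  have r2 : ∀ y : ℝ, (rot ((1 / 2 : ℝ) : S1))⁻¹ ((y + 1 / 2 : ℝ) : S1) = (y : S1) := fun y => by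
    rw [Equiv.Perm.inv_eq_iff_eq]
    exact AddCircle.coe_add _ _ _
  rw [Equiv.Perm.mul_apply, Equiv.Perm.mul_apply, Equiv.Perm.mul_apply, r1, q2 w hw, aQ, r2, q1, pinv2,
    aF, ez, eu]
  simp only [hU, if_pos hn]

theorem rot_lift (t : ℝ) : HasLift (rot (t : S1)) :=
  ⟨fun x => x + t, contDiff_id.add contDiff_const, fun x => by ring, fun x => by simp,
    fun x => (AddCircle.coe_add _ _ _).symm⟩

theorem Wd.fin {S : Set (Equiv.Perm S1)} {k : ℕ} {g : Equiv.Perm S1} (h : Wd S k g) :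
    g ∈ Subgroup.closure S ∧ wordLength S g ≤ k := by
  obtain ⟨l, a, b, c⟩ := h
  constructor
  · rw [← c]
    refine Subgroup.list_prod_mem _ fun x hx => (b x hx).elim (fun h => Subgroup.subset_closure h)
      fun h => inv_mem_iff.1 (Subgroup.subset_closure h)
  · refine le_trans (Nat.sInf_le ?_) a
    exact ⟨l, rfl, b, c⟩

open Classical in
theorem main_thm :
    ∃ (κ : ℕ → ℕ) (ε : ℕ → ℝ),
      Tendsto κ atTop atTop ∧ Tendsto ε atTop (nhds 0) ∧ (∀ n, 0 < ε n) ∧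
      ∀ h : ℕ → Equiv.Perm S1, (∀ n, HasLift (h n)) →
        (∀ n, distC n (h n) 1 < ε n) →
        ∃ S : Finset (Equiv.Perm S1), (∀ g ∈ S, HasLift g) ∧
          ∀ n, h n ∈ Subgroup.closure (S : Set (Equiv.Perm S1)) ∧
            wordLength (S : Set (Equiv.Perm S1)) (h n) ≤ κ n := by
  refine ⟨fun n => (n + 1) ^ 2, wt, ?_, wt_tendsto, wt_pos, fun h hl hd => ?_⟩
  · exact tendsto_atTop_mono (fun n => by rw [id]; nlinarith) tendsto_id
  have hx := fun n => disp_of (hl n) (hd n)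
  choose u su pu eu bu using hx
  obtain ⟨N, k1, k2, s1, s2, b1, b2, e⟩ := frag su pu bu eu
  obtain ⟨S1', hS1, C1, w1⟩ := real_word s1 b1
  obtain ⟨S2', hS2, C2, w2⟩ := real_word s2 b2
  set ρ := rot ((1 / 2 : ℝ) : S1)
  set T : Finset (Equiv.Perm S1) := S1'.image pi1 ∪ S2'.image pi1 ∪ {ρ} ∪
    (Finset.range (max N (C1 + C2 + 2))).image h with hT
  have hom : ∀ x ∈ Sp (7 / 16), ∀ y ∈ Sp (7 / 16), pi1 (x * y) = pi1 x * pi1 y :=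
    fun x hx y hy => pi1_mul hx hy
  refine ⟨T, fun g hg => ?_, fun n => Wd.fin ?_⟩
  · simp only [hT, Finset.mem_union, Finset.mem_image, Finset.mem_singleton] at hg
    rcases hg with ((⟨p, hp, rfl⟩ | ⟨p, hp, rfl⟩) | rfl) | ⟨n, _, rfl⟩
    · exact pi1_lift (hS1 hp)
    · exact pi1_lift (hS2 hp)
    · exact rot_lift _
    · exact hl n
  · rcases lt_or_ge n (max N (C1 + C2 + 2)) with hn | hn
    · refine (Wd.gen ?_).mono (by nlinarith : 1 ≤ (n + 1) ^ 2)
      rw [Finset.mem_coe, hT]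
      exact Finset.mem_union_right _ (Finset.mem_image_of_mem _ (Finset.mem_range.2 hn))
    · have hC : C1 + C2 + 2 ≤ n := (le_max_right _ _).trans hn
      rw [e n ((le_max_left _ _).trans hn)]
      have v1 : Wd (T : Set (Equiv.Perm S1)) (C1 * (n + 1)) (pi1 (k1 n)) := by
        refine ((w1 n).map pi1 pi1_one hom hS1).sub ?_
        rw [← Finset.coe_image, Finset.coe_subset, hT]
        intro x hx; simp only [Finset.mem_union]; tauto
      have v2 : Wd (T : Set (Equiv.Perm S1)) (C2 * (n + 1)) (pi1 (k2 n)) := by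
        refine ((w2 n).map pi1 pi1_one hom hS2).sub ?_
        rw [← Finset.coe_image, Finset.coe_subset, hT]
        intro x hx; simp only [Finset.mem_union]; tauto
      have v3 : Wd (T : Set (Equiv.Perm S1)) 1 ρ := Wd.gen (by simp [hT])
      refine (v1.mul ((v3.inv.mul v2).mul v3)).mono ?_
      nlinarith
end

/-- there exist `k_n → ∞` and `ε_n → 0`, `ε_n > 0`, such that any sequence
`h_n` of smooth circle diffeomorphisms with `‖h_n − id‖_{C^n} < ε_n` lies in a single
finitely generated subgroup, with word lengths `d_S(h_n, id) ≤ k_n`. -/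
theorem exists_distortion_bounds :
    ∃ (κ : ℕ → ℕ) (ε : ℕ → ℝ),
      Tendsto κ atTop atTop ∧ Tendsto ε atTop (nhds 0) ∧ (∀ n, 0 < ε n) ∧
      ∀ h : ℕ → Equiv.Perm S1, (∀ n, HasLift (h n)) →
        (∀ n, distC n (h n) 1 < ε n) →
        ∃ S : Finset (Equiv.Perm S1), (∀ g ∈ S, HasLift g) ∧
          ∀ n, h n ∈ Subgroup.closure (S : Set (Equiv.Perm S1)) ∧
            wordLength (S : Set (Equiv.Perm S1)) (h n) ≤ κ n := 
  main_thm

end
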